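/- arXiv:1903.06067 — 2 statements merged into one kernel-verified Lean document; each statement's English description precedes it below -/
import Mathlib

section
/- Let C₁ > 0, 1 < b < 2 and ε > 0 be given. For any nonnegative initial data f₀ ∈ L¹(ℝ³), the modified Boltzmann equation ∂_s f = Q_ε(f,f) with f(0) = f₀ has a unique solution f ∈ C¹([0,∞); L¹(ℝ³)), and this solution is nonnegative. Moreover, if f₀ is isotropic (f₀(p) depends only on |p|) and satisfies ∫_{ℝ³} f₀(p)|p|^m d³p < ∞ for every real m with −2 ≤ m ≤ 2, then there exist T > 0 and a constant C_T, both independent of ε, such that sup_{0 ≤ s ≤ T} ∫_{ℝ³} f(s,p)|p|^m d³p ≤ C_T for every real m with −2 ≤ m ≤ 2. -/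
noncomputable section

open MeasureTheory Real Metric
open scoped RealInnerProductSpace

/-- Momentum space `ℝ³`. -/
abbrev R3 : Type := EuclideanSpace ℝ (Fin 3)

/-- The relative momentum `ρ(p,q) = √(2(|p||q| − p·q))`. -/
def relMom (p q : R3) : ℝ := Real.sqrt (2 * (‖p‖ * ‖q‖ - ⟪p, q⟫))

/-- Post-collision momentum `p'`. -/
def pPost (p q ω : R3) : R3 :=
  (1 / 2 : ℝ) • (p + q) + (relMom p q / 2) • ω
    + (⟪p + q, ω⟫ / 2 / (‖p‖ + ‖q‖ + relMom p q)) • (p + q)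

/-- Post-collision momentum `q'`. -/
def qPost (p q ω : R3) : R3 :=
  (1 / 2 : ℝ) • (p + q) - (relMom p q / 2) • ω
    - (⟪p + q, ω⟫ / 2 / (‖p‖ + ‖q‖ + relMom p q)) • (p + q)

/-- Post-collision energy `p'⁰`. -/
def p0Post (p q ω : R3) : ℝ := (‖p‖ + ‖q‖) / 2 + ⟪p + q, ω⟫ / 2

/-- Post-collision energy `q'⁰`. -/
def q0Post (p q ω : R3) : ℝ := (‖p‖ + ‖q‖) / 2 - ⟪p + q, ω⟫ / 2

/-- The surface measure `dω` on the unit sphere `S² ⊂ ℝ³` (total mass `4π`). -/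
def sphMeasure : Measure (sphere (0 : R3) 1) := (volume : Measure R3).toSphere

/-- The (modified, for `ε > 0`) massless Boltzmann collision operator with scattering
cross-section `σ = C₁ h^{-b}`. -/
def Qcoll (C₁ b ε : ℝ) (f : R3 → ℝ) (p : R3) : ℝ :=
  C₁ * ∫ q : R3, ∫ ω : sphere (0 : R3) 1,
      (if ε ≤ relMom p q then relMom p q ^ (2 - b) / (‖p‖ * ‖q‖) else 0)
        * (f (pPost p q ω) * f (qPost p q ω) - f p * f q) ∂sphMeasure

/-- `F : ℝ → L¹(ℝ³)` is a `C¹` solution of the (massless, cutoff-`ε`) Boltzmann equation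
`∂ₛ f = Q_ε(f,f)` on the time set `S`, with initial datum `f₀`: `F` is differentiable
on `S` with a continuous derivative `F'` which a.e. represents `Q_ε(F s, F s)`. -/
def IsSolOn (C₁ b ε : ℝ) (f₀ : R3 → ℝ)
    (F : ℝ → Lp ℝ 1 (volume : Measure R3)) (S : Set ℝ) : Prop :=
  (⇑(F 0) =ᵐ[(volume : Measure R3)] f₀) ∧
  ∃ F' : ℝ → Lp ℝ 1 (volume : Measure R3),
    ContinuousOn F' S ∧
    (∀ s ∈ S, HasDerivWithinAt F (F' s) S s) ∧
    (∀ s ∈ S, ⇑(F' s) =ᵐ[(volume : Measure R3)] Qcoll C₁ b ε ⇑(F s))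


section


/-! ### Part A: Wild sums -/
section WildSum

variable {E : Type*} [NormedAddCommGroup E] [NormedSpace ℝ E]

/-- Coefficients of the Wild sum. -/
def wildCoef (Γ : E →L[ℝ] E →L[ℝ] E) (f0 : E) : ℕ → E
  | 0 => f0
  | n + 1 => ((n : ℝ) + 1)⁻¹ • ∑ i : Fin (n + 1), Γ (wildCoef Γ f0 i) (wildCoef Γ f0 (n - i))
  termination_by n => n
  decreasing_by all_goals omega

lemma wildCoef_zero (Γ : E →L[ℝ] E →L[ℝ] E) (f0 : E) : wildCoef Γ f0 0 = f0 := by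
  rw [wildCoef]

lemma wildCoef_succ (Γ : E →L[ℝ] E →L[ℝ] E) (f0 : E) (n : ℕ) :
    wildCoef Γ f0 (n + 1) = ((n : ℝ) + 1)⁻¹ •
      ∑ i ∈ Finset.range (n + 1), Γ (wildCoef Γ f0 i) (wildCoef Γ f0 (n - i)) := by
  rw [wildCoef, Finset.sum_range]

lemma bilin_cauchy [CompleteSpace E] (Γ : E →L[ℝ] E →L[ℝ] E) (u v : ℕ → E)
    (hu : Summable fun n => ‖u n‖) (hv : Summable fun n => ‖v n‖) :
    Γ (∑' n, u n) (∑' n, v n) = ∑' n, ∑ i ∈ Finset.range (n + 1), Γ (u i) (v (n - i)) := by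
  have hs : Summable fun x : ℕ × ℕ => Γ (u x.1) (v x.2) := by
    have h1 : Summable fun x : ℕ × ℕ => ‖u x.1‖ * ‖v x.2‖ :=
      hu.mul_of_nonneg hv (fun _ => norm_nonneg _) (fun _ => norm_nonneg _)
    refine Summable.of_norm_bounded (h1.mul_left ‖Γ‖) ?_
    intro x
    simpa [mul_assoc] using Γ.le_opNorm₂ (u x.1) (v x.2)
  have hA : ∑' x : ℕ × ℕ, Γ (u x.1) (v x.2) = Γ (∑' n, u n) (∑' n, v n) := by
    rw [hs.tsum_prod]
    have h2 : ∀ i, ∑' j, Γ (u i) (v j) = Γ (u i) (∑' j, v j) := fun i =>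
      ((Γ (u i)).map_tsum hv.of_norm).symm
    simp_rw [h2]
    have := (Γ.flip (∑' j, v j)).map_tsum hu.of_norm
    simpa using this.symm
  rw [← hA, ← Equiv.tsum_eq (Finset.HasAntidiagonal.sigmaAntidiagonalEquivProd (A := ℕ))]
  have hs' := (Finset.HasAntidiagonal.sigmaAntidiagonalEquivProd (A := ℕ)).summable_iff.2 hs
  refine (Summable.tsum_sigma' (f := (fun x : ℕ × ℕ => Γ (u x.1) (v x.2)) ∘
    Finset.HasAntidiagonal.sigmaAntidiagonalEquivProd) ?_ hs').trans ?_
  rotate_left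
  · refine tsum_congr fun n => ?_
    rw [tsum_fintype]
    have := Finset.Nat.sum_antidiagonal_eq_sum_range_succ (fun i j => Γ (u i) (v j)) n
    rw [← this]
    exact Finset.sum_coe_sort (Finset.HasAntidiagonal.antidiagonal n)
      (fun x : ℕ × ℕ => Γ (u x.1) (v x.2))
  · intro n
    exact (hasSum_fintype _).summable

/-- Existence via Wild sums. -/
lemma wild_existence [CompleteSpace E] (Γ : E →L[ℝ] E →L[ℝ] E) (l : E →L[ℝ] ℝ) (lam : ℝ)
    (hlam : 0 < lam) (K : Set E) (hKc : IsClosed K) (hK0 : (0 : E) ∈ K)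
    (hKadd : ∀ f ∈ K, ∀ g ∈ K, f + g ∈ K)
    (hKsmul : ∀ c : ℝ, 0 ≤ c → ∀ f ∈ K, c • f ∈ K)
    (hKΓ : ∀ f ∈ K, ∀ g ∈ K, Γ f g ∈ K)
    (hKl : ∀ f ∈ K, ∀ g ∈ K, l (Γ f g) = lam * l f * l g)
    (hKn : ∀ f ∈ K, ‖f‖ = l f) (f0 : E) (hf0 : f0 ∈ K) :
    ∃ F : ℝ → E, F 0 = f0 ∧ (∀ t, 0 ≤ t → F t ∈ K) ∧ (∀ t, 0 ≤ t → l (F t) = l f0) ∧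
      ∀ t, 0 ≤ t → HasDerivAt F (Γ (F t) (F t) - (lam * l f0) • F t) t := by
  rcases eq_or_ne f0 0 with h0 | h0
  · subst h0
    refine ⟨fun _ => 0, rfl, fun _ _ => hK0, fun _ _ => rfl, fun t _ => ?_⟩
    simpa using hasDerivAt_const t (0 : E)
  have hM : 0 < l f0 := by rw [← hKn f0 hf0]; exact norm_pos_iff.2 h0
  set M := l f0 with hMdef
  set b := wildCoef Γ f0 with hb
  have hKsum : ∀ (s : Finset ℕ) (u : ℕ → E), (∀ i ∈ s, u i ∈ K) → ∑ i ∈ s, u i ∈ K := by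
    intro s u
    induction s using Finset.induction_on with
    | empty => intro _; simpa using hK0
    | insert a s ha ih =>
      intro h
      rw [Finset.sum_insert ha]
      exact hKadd _ (h _ (Finset.mem_insert_self _ _)) _
        (ih fun i hi => h i (Finset.mem_insert_of_mem hi))
  have hbK : ∀ n, b n ∈ K ∧ l (b n) = lam ^ n * M ^ (n + 1) := by
    intro n
    induction n using Nat.strong_induction_on with
    | _ n ih =>
      cases n with
      | zero => simp [hb, wildCoef_zero, hf0, hMdef]
      | succ n =>
        rw [hb, wildCoef_succ, ← hb]
        constructor
        · refine hKsmul _ (by positivity) _ (hKsum _ _ fun i hi => ?_)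
          rw [Finset.mem_range] at hi
          exact hKΓ _ (ih i hi).1 _ (ih (n - i) (by omega)).1
        · rw [map_smul, map_sum]
          have : ∀ i ∈ Finset.range (n + 1), l (Γ (b i) (b (n - i)))
              = lam ^ (n + 1) * M ^ (n + 2) := by
            intro i hi
            rw [Finset.mem_range] at hi
            rw [hKl _ (ih i hi).1 _ (ih (n - i) (by omega)).1, (ih i hi).2,
              (ih (n - i) (by omega)).2]
            obtain ⟨k, rfl⟩ : ∃ k, n = i + k := ⟨n - i, by omega⟩
            simp only [add_tsub_cancel_left]
            ring
          rw [Finset.sum_congr rfl this]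
          simp only [Finset.sum_const, Finset.card_range, nsmul_eq_mul, smul_eq_mul]
          push_cast
          field_simp
  have hbn : ∀ n, ‖b n‖ = (lam * M) ^ n * M := fun n => by
    rw [hKn _ (hbK n).1, (hbK n).2]; ring
  set c := lam * M with hc
  have hcpos : 0 < c := mul_pos hlam hM
  set g : ℝ → E := fun σ => ∑' n, σ ^ n • b n with hg
  have hsum : ∀ σ : ℝ, |σ| < 1 / c → Summable fun n => ‖σ ^ n • b n‖ := by
    intro σ hσ
    have h1 : |σ| * c < 1 := by rwa [lt_div_iff₀ hcpos] at hσ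
    have h2 : Summable fun n : ℕ => (|σ| * c) ^ n * M :=
      (summable_geometric_of_lt_one (by positivity) h1).mul_right M
    refine h2.congr fun n => ?_
    rw [norm_smul, hbn, norm_pow, Real.norm_eq_abs]; ring
  have hgder : ∀ σ : ℝ, |σ| < 1 / c → HasDerivAt g (Γ (g σ) (g σ)) σ := by
    intro σ hσ
    obtain ⟨r, hr1, hr2⟩ := exists_between hσ
    have hr0 : 0 < r := lt_of_le_of_lt (abs_nonneg _) hr1
    have h1 : r * c < 1 := by rwa [lt_div_iff₀ hcpos] at hr2
    have hu : Summable fun n : ℕ => (n : ℝ) * r ^ (n - 1) * (c ^ n * M) := by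
      have h3 := (summable_pow_mul_geometric_of_norm_lt_one 1 (r := r * c)
        (by rw [Real.norm_eq_abs, abs_of_nonneg (by positivity)]; exact h1)).mul_right (M / r)
      refine h3.congr fun n => ?_
      cases n with
      | zero => simp
      | succ n => simp only [Nat.add_sub_cancel]; push_cast; field_simp; ring
    have h4 := hasDerivAt_tsum_of_isPreconnected (g := fun (n : ℕ) (z : ℝ) => z ^ n • b n)
      (g' := fun n z => ((n : ℝ) * z ^ (n - 1)) • b n) (t := Metric.ball (0 : ℝ) r) (y := σ)
      (y₀ := 0) hu Metric.isOpen_ball (convex_ball (0 : ℝ) r).isPreconnected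
      (fun n y _ => (hasDerivAt_pow n y).smul_const (b n))
      (fun n y hy => by
        rw [norm_smul, hbn, norm_mul, norm_pow]
        rw [mem_ball_zero_iff] at hy
        simp only [Real.norm_natCast]
        gcongr)
      (by simpa using hr0) (hsum 0 (by simpa using hcpos)).of_norm
      (by simpa using hr1)
    convert h4 using 1
    rw [hg]
    simp only
    rw [bilin_cauchy Γ _ _ (hsum σ hσ) (hsum σ hσ)]
    have hS : Summable fun n : ℕ => ((n : ℝ) * σ ^ (n - 1)) • b n := by
      refine Summable.of_norm_bounded hu fun n => ?_
      rw [norm_smul, hbn, norm_mul, norm_pow]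
      simp only [Real.norm_eq_abs, Nat.abs_cast]
      gcongr
    rw [hS.tsum_eq_zero_add]
    simp only [Nat.cast_zero, zero_mul, zero_smul, zero_add]
    refine tsum_congr fun n => ?_
    rw [hb, wildCoef_succ, ← hb, smul_smul, Finset.smul_sum]
    refine Finset.sum_congr rfl fun i hi => ?_
    rw [Finset.mem_range] at hi
    obtain ⟨k, rfl⟩ : ∃ k, n = i + k := ⟨n - i, by omega⟩
    simp only [map_smul, _root_.smul_apply, smul_smul, add_tsub_cancel_left,
      Nat.add_sub_cancel]
    congr 1
    push_cast
    field_simp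
    ring
  set sg : ℝ → ℝ := fun t => (1 - Real.exp (-c * t)) / c with hsg
  have hsgpos : ∀ t, 0 ≤ t → 0 ≤ sg t ∧ |sg t| < 1 / c := by
    intro t ht
    have h1 : Real.exp (-c * t) ≤ 1 := Real.exp_le_one_iff.2 (by nlinarith)
    have h2 := Real.exp_pos (-c * t)
    have h3 : 0 ≤ sg t := div_nonneg (by linarith) hcpos.le
    refine ⟨h3, ?_⟩
    rw [abs_of_nonneg h3]
    exact div_lt_div_of_pos_right (by linarith) hcpos
  have hsgder : ∀ t, HasDerivAt sg (Real.exp (-c * t)) t := by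
    intro t
    have h1 : HasDerivAt (fun t => -c * t) (-c) t := by
      simpa using (hasDerivAt_id t).const_mul (-c)
    have := ((h1.exp).const_sub 1).div_const c
    refine this.congr_deriv ?_
    rw [div_eq_iff hcpos.ne']; ring
  refine ⟨fun t => Real.exp (-c * t) • g (sg t), ?_, ?_, ?_, ?_⟩
  · have h1 : g 0 = ∑' n, (0 : ℝ) ^ n • b n := rfl
    have : sg 0 = 0 := by simp [hsg]
    simp only []
    rw [this, h1, tsum_eq_single 0]
    · simp [hb, wildCoef_zero]
    · intro n hn; simp [hn]
  · intro t ht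
    obtain ⟨h1, h2⟩ := hsgpos t ht
    refine hKsmul _ (Real.exp_pos _).le _ ?_
    have h3 := (hsum _ h2).of_norm.hasSum.tendsto_sum_nat
    exact hKc.mem_of_tendsto h3 (Filter.Eventually.of_forall fun N =>
      hKsum _ _ fun i _ => hKsmul _ (pow_nonneg h1 _) _ (hbK i).1)
  · intro t ht
    obtain ⟨h1, h2⟩ := hsgpos t ht
    rw [map_smul, hg]
    simp only
    rw [l.map_tsum (hsum _ h2).of_norm]
    have h3 : ∀ n, l (sg t ^ n • b n) = (sg t * c) ^ n * M := by
      intro n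
      rw [map_smul, (hbK n).2, smul_eq_mul, hc]; ring_nf
    have h4 : sg t * c = 1 - Real.exp (-c * t) := by rw [hsg]; field_simp
    have h5 := Real.exp_pos (-c * t)
    have h6 : Real.exp (-c * t) ≤ 1 := Real.exp_le_one_iff.2 (by nlinarith)
    simp_rw [h3, h4]
    rw [tsum_mul_right, tsum_geometric_of_lt_one (by linarith) (by linarith), smul_eq_mul]
    field_simp
    simp
  · intro t ht
    obtain ⟨h1, h2⟩ := hsgpos t ht
    have h3 : HasDerivAt (fun t => g (sg t)) (Real.exp (-c * t) • Γ (g (sg t)) (g (sg t))) t :=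
      HasDerivAt.scomp t (hgder _ h2) (hsgder t)
    have h0 : HasDerivAt (fun t => -c * t) (-c) t := by
      simpa using (hasDerivAt_id t).const_mul (-c)
    have h4 := h0.exp.smul h3
    refine h4.congr_deriv ?_
    simp only [map_smul, _root_.smul_apply, smul_smul]
    rw [sub_eq_add_neg, ← neg_smul]
    congr 2
    ring

end WildSum

end

section


/-! ### Part B: geometry of collisions -/
section Geometry

/-- Total energy as a function of total momentum and relative momentum. -/
def totE (P : R3) (r : ℝ) : ℝ := Real.sqrt (r ^ 2 + ‖P‖ ^ 2)

/-- Prolate parametrization of the post-collisional momentum. -/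
def Tmap (P y : R3) : R3 :=
  (1 / 2 : ℝ) • (P + y) + (⟪P, y⟫ / (2 * (‖y‖ * (totE P ‖y‖ + ‖y‖)))) • P

lemma relMom_eq (p q : R3) : relMom p q = Real.sqrt ((‖p‖ + ‖q‖) ^ 2 - ‖p + q‖ ^ 2) := by
  unfold relMom
  congr 1
  rw [norm_add_sq_real]; ring

lemma relMom_sq (p q : R3) : relMom p q ^ 2 = 2 * (‖p‖ * ‖q‖ - ⟪p, q⟫) := by
  unfold relMom
  rw [Real.sq_sqrt]
  have := real_inner_le_norm p q
  linarith

lemma relMom_nonneg (p q : R3) : 0 ≤ relMom p q := Real.sqrt_nonneg _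

lemma relMom_sq_le (p q : R3) : relMom p q ^ 2 ≤ 4 * (‖p‖ * ‖q‖) := by
  rw [relMom_sq]
  have := neg_le_of_abs_le (abs_real_inner_le_norm p q)
  linarith

lemma totE_sq (P : R3) (r : ℝ) : totE P r ^ 2 = r ^ 2 + ‖P‖ ^ 2 := Real.sq_sqrt (by positivity)

lemma totE_pos (P : R3) {r : ℝ} (hr : 0 < r) : 0 < totE P r := Real.sqrt_pos.2 (by positivity)

lemma norm_le_totE (P : R3) (r : ℝ) : ‖P‖ ≤ totE P r := by
  apply Real.le_sqrt_of_sq_le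
  nlinarith [sq_nonneg r]

lemma Tmap_neg (P y : R3) : Tmap P (-y) = P - Tmap P y := by
  unfold Tmap
  rw [norm_neg, inner_neg_right, neg_div, neg_smul]
  module

lemma norm_Tmap (P y : R3) (hy : y ≠ 0) :
    ‖Tmap P y‖ = totE P ‖y‖ / 2 + ⟪P, y⟫ / (2 * ‖y‖) := by
  have hr : 0 < ‖y‖ := norm_pos_iff.2 hy
  have hE := totE_pos P hr
  have hE2 := totE_sq P ‖y‖
  have hPE := norm_le_totE P ‖y‖
  have hu := neg_le_of_abs_le (abs_real_inner_le_norm P y)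
  have hnn : 0 ≤ totE P ‖y‖ / 2 + ⟪P, y⟫ / (2 * ‖y‖) := by
    have : totE P ‖y‖ / 2 + ⟪P, y⟫ / (2 * ‖y‖) = (totE P ‖y‖ * ‖y‖ + ⟪P, y⟫) / (2 * ‖y‖) := by
      field_simp
    rw [this]
    apply div_nonneg _ (by positivity)
    nlinarith
  refine (sq_eq_sq₀ (norm_nonneg _) hnn).1 ?_
  rw [← real_inner_self_eq_norm_sq]
  unfold Tmap
  simp only [inner_add_left, inner_add_right, inner_smul_left, inner_smul_right,
    real_inner_self_eq_norm_sq, real_inner_comm P y, RCLike.conj_to_real]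
  generalize totE P ‖y‖ = E at *
  generalize (⟪P, y⟫ : ℝ) = u at *
  generalize ‖y‖ = r at *
  generalize ‖P‖ = s at *
  have hs : s ^ 2 = E ^ 2 - r ^ 2 := by linarith
  rw [hs]
  field_simp
  ring

lemma relMom_Tmap (P y : R3) (hy : y ≠ 0) : relMom (Tmap P y) (P - Tmap P y) = ‖y‖ := by
  rw [relMom_eq, ← Tmap_neg, norm_Tmap P y hy, norm_Tmap P (-y) (neg_ne_zero.2 hy), Tmap_neg,
    norm_neg, inner_neg_right]
  have : (totE P ‖y‖ / 2 + ⟪P, y⟫ / (2 * ‖y‖) + (totE P ‖y‖ / 2 + -⟪P, y⟫ / (2 * ‖y‖))) ^ 2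
      - ‖Tmap P y + (P - Tmap P y)‖ ^ 2 = ‖y‖ ^ 2 := by
    rw [add_sub_cancel]
    have := totE_sq P ‖y‖
    linear_combination this
  rw [this, Real.sqrt_sq (norm_nonneg _)]

lemma sumE_Tmap (P y : R3) (hy : y ≠ 0) : ‖Tmap P y‖ + ‖P - Tmap P y‖ = totE P ‖y‖ := by
  rw [← Tmap_neg, norm_Tmap P y hy, norm_Tmap P (-y) (neg_ne_zero.2 hy), norm_neg,
    inner_neg_right]
  ring

lemma prodE_Tmap (P y : R3) (hy : y ≠ 0) : ‖Tmap P y‖ * ‖P - Tmap P y‖ =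
    (totE P ‖y‖ ^ 2 - ⟪P, y⟫ ^ 2 / ‖y‖ ^ 2) / 4 := by
  have hr : 0 < ‖y‖ := norm_pos_iff.2 hy
  rw [← Tmap_neg, norm_Tmap P y hy, norm_Tmap P (-y) (neg_ne_zero.2 hy), norm_neg,
    inner_neg_right]
  field_simp
  ring

lemma pPost_Tmap (P y ω : R3) (hy : y ≠ 0) (hω : ‖ω‖ = 1) :
    pPost (Tmap P y) (P - Tmap P y) ω = Tmap P (‖y‖ • ω) := by
  have hr : 0 < ‖y‖ := norm_pos_iff.2 hy
  have hE := totE_pos P hr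
  unfold pPost
  rw [relMom_Tmap P y hy, sumE_Tmap P y hy, add_sub_cancel]
  unfold Tmap
  rw [norm_smul, hω, norm_norm, mul_one, inner_smul_right]
  have : ‖y‖ * ⟪P, ω⟫ / (2 * (‖y‖ * (totE P ‖y‖ + ‖y‖))) = ⟪P, ω⟫ / 2 / (totE P ‖y‖ + ‖y‖) := by
    field_simp
  rw [this]
  module

lemma qPost_eq (p q ω : R3) : qPost p q ω = p + q - pPost p q ω := by
  unfold qPost pPost; module

lemma qPost_Tmap (P y ω : R3) (hy : y ≠ 0) (hω : ‖ω‖ = 1) :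
    qPost (Tmap P y) (P - Tmap P y) ω = P - Tmap P (‖y‖ • ω) := by
  rw [qPost_eq, pPost_Tmap P y ω hy hω, add_sub_cancel]

/-- Inverse of `Tmap P`. -/
def Tinv (P p : R3) : R3 :=
  p - (P - p) - ((‖p‖ - ‖P - p‖) / (‖p‖ + ‖P - p‖ + relMom p (P - p))) • P

lemma Tinv_Tmap (P y : R3) (hy : y ≠ 0) : Tinv P (Tmap P y) = y := by
  have hr : 0 < ‖y‖ := norm_pos_iff.2 hy
  have hE := totE_pos P hr
  unfold Tinv
  rw [relMom_Tmap P y hy, sumE_Tmap P y hy, ← Tmap_neg, norm_Tmap P y hy,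
    norm_Tmap P (-y) (neg_ne_zero.2 hy), norm_neg, inner_neg_right]
  unfold Tmap
  rw [norm_neg, inner_neg_right, neg_div, neg_smul]
  have : (totE P ‖y‖ / 2 + ⟪P, y⟫ / (2 * ‖y‖) - (totE P ‖y‖ / 2 + -⟪P, y⟫ / (2 * ‖y‖)))
      / (totE P ‖y‖ + ‖y‖) = 2 * (⟪P, y⟫ / (2 * (‖y‖ * (totE P ‖y‖ + ‖y‖)))) := by
    field_simp
    ring
  rw [this]
  module

lemma norm_Tinv (P p : R3) (h : 0 < ‖p‖ + ‖P - p‖) : ‖Tinv P p‖ = relMom p (P - p) := by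
  obtain ⟨q, rfl⟩ : ∃ q, P = p + q := ⟨P - p, by abel⟩
  unfold Tinv
  rw [add_sub_cancel_left] at *
  refine (sq_eq_sq₀ (norm_nonneg _) (relMom_nonneg _ _)).1 ?_
  have h0 := relMom_nonneg p q
  have h1 := relMom_sq p q
  rw [← real_inner_self_eq_norm_sq]
  simp only [inner_add_left, inner_add_right, inner_smul_left, inner_smul_right, inner_sub_left,
    inner_sub_right, real_inner_self_eq_norm_sq, real_inner_comm p q, RCLike.conj_to_real]
  generalize relMom p q = r at *
  generalize (⟪p, q⟫ : ℝ) = u at *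
  generalize ‖p‖ = a at *
  generalize ‖q‖ = b at *
  have hu : u = a * b - r ^ 2 / 2 := by linarith
  have hne : a + b + r ≠ 0 := by positivity
  rw [hu]
  field_simp
  ring

lemma Tmap_Tinv (P p : R3) (h : 0 < relMom p (P - p)) : Tmap P (Tinv P p) = p := by
  obtain ⟨q, rfl⟩ : ∃ q, P = p + q := ⟨P - p, by abel⟩
  have hn := norm_Tinv (p + q) p
  rw [add_sub_cancel_left] at *
  have hpq : 0 < ‖p‖ + ‖q‖ := by
    by_contra hc
    have h1 := norm_nonneg p
    have h2 := norm_nonneg q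
    have h3 : ‖p‖ = 0 := by linarith
    have h4 := relMom_sq_le p q
    rw [h3] at h4
    nlinarith
  replace hn := hn hpq
  have h1 := relMom_sq p q
  have hE : totE (p + q) (relMom p q) = ‖p‖ + ‖q‖ := by
    unfold totE
    rw [h1, norm_add_sq_real]
    have : 2 * (‖p‖ * ‖q‖ - ⟪p, q⟫) + (‖p‖ ^ 2 + 2 * ⟪p, q⟫ + ‖q‖ ^ 2) = (‖p‖ + ‖q‖) ^ 2 := by
      ring
    rw [this, Real.sqrt_sq hpq.le]
  unfold Tmap
  rw [hn, hE]
  have hin : ⟪p + q, Tinv (p + q) p⟫ = relMom p q * (‖p‖ - ‖q‖) := by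
    unfold Tinv
    rw [add_sub_cancel_left]
    simp only [inner_add_left, inner_add_right, inner_smul_right,
      inner_sub_right, real_inner_self_eq_norm_sq, real_inner_comm p q]
    generalize relMom p q = r at *
    generalize (⟪p, q⟫ : ℝ) = u at *
    generalize ‖p‖ = a at *
    generalize ‖q‖ = b at *
    have hu : u = a * b - r ^ 2 / 2 := by linarith
    have hne : a + b + r ≠ 0 := by positivity
    rw [hu]
    field_simp
    ring
  rw [hin]
  have : relMom p q * (‖p‖ - ‖q‖) / (2 * (relMom p q * (‖p‖ + ‖q‖ + relMom p q)))
     = (1 / 2) * ((‖p‖ - ‖q‖) / (‖p‖ + ‖q‖ + relMom p q)) := by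
    have hne : ‖p‖ + ‖q‖ + relMom p q ≠ 0 := by positivity
    field_simp
  rw [this]
  unfold Tinv
  rw [add_sub_cancel_left]
  module

lemma hasFDerivAt_Tmap (P y : R3) (hy : y ≠ 0) : ∃ D : R3 →L[ℝ] R3,
    HasFDerivAt (Tmap P) D y ∧
      D.det = (totE P ‖y‖ ^ 2 - ⟪P, y⟫ ^ 2 / ‖y‖ ^ 2) / (8 * (‖y‖ * totE P ‖y‖)) := by
  have hr : 0 < ‖y‖ := norm_pos_iff.2 hy
  have hE := totE_pos P hr
  set a : R3 → ℝ := fun y => ⟪P, y⟫ / (2 * (‖y‖ * (totE P ‖y‖ + ‖y‖))) with ha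
  have hda : DifferentiableAt ℝ a y := by
    have h1 : DifferentiableAt ℝ (fun y : R3 => ‖y‖) y := differentiableAt_id.norm ℝ hy
    have h2 : DifferentiableAt ℝ (fun y : R3 => totE P ‖y‖) y := by
      unfold totE
      refine DifferentiableAt.sqrt (by fun_prop) ?_
      positivity
    rw [ha]
    have h3 : DifferentiableAt ℝ (fun y : R3 => (⟪P, y⟫ : ℝ)) y :=
      (differentiableAt_const P).inner ℝ differentiableAt_id
    have h4 : DifferentiableAt ℝ (fun y : R3 => 2 * (‖y‖ * (totE P ‖y‖ + ‖y‖))) y :=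
      (h1.fun_mul (h2.fun_add h1)).const_mul 2
    have h5 : 2 * (‖y‖ * (totE P ‖y‖ + ‖y‖)) ≠ 0 := by positivity
    simp only [div_eq_mul_inv]
    exact h3.fun_mul (h4.fun_inv h5)
  obtain ⟨A, hA⟩ := hda
  have hAP : A P = ‖P‖ ^ 2 / (2 * (‖y‖ * (totE P ‖y‖ + ‖y‖)))
      - ⟪P, y⟫ ^ 2 / (2 * ‖y‖ ^ 3 * totE P ‖y‖) := by
    have hline : HasDerivAt (fun t : ℝ => y + t • P) P 0 := by
      simpa using ((hasDerivAt_id (0 : ℝ)).smul_const P).const_add y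
    have h1 : HasDerivAt (fun t : ℝ => a (y + t • P)) (A P) 0 := by
      have hA' : HasFDerivAt a A (y + (0 : ℝ) • P) := by simpa using hA
      exact hA'.comp_hasDerivAt (0 : ℝ) hline
    have hs : HasDerivAt (fun t : ℝ => ‖y + t • P‖) (⟪P, y⟫ / ‖y‖) 0 := by
      have h2 : HasDerivAt (fun t : ℝ => ‖y + t • P‖ ^ 2) (2 * ⟪P, y⟫) 0 := by
        have := hline.norm_sq
        simpa [real_inner_comm] using this
      have h3 := h2.sqrt (by simpa using hy)
      simp only [Real.sqrt_sq (norm_nonneg _), zero_smul, add_zero] at h3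
      refine h3.congr_deriv ?_
      field_simp
    have hu : HasDerivAt (fun t : ℝ => ⟪P, y + t • P⟫) (‖P‖ ^ 2) 0 := by
      have : (fun t : ℝ => ⟪P, y + t • P⟫) = fun t : ℝ => ⟪P, y⟫ + t * ‖P‖ ^ 2 := by
        funext t
        rw [inner_add_right, inner_smul_right, real_inner_self_eq_norm_sq]
      rw [this]
      simpa using ((hasDerivAt_id (0 : ℝ)).mul_const (‖P‖ ^ 2)).const_add ⟪P, y⟫
    have hEd : HasDerivAt (fun t : ℝ => totE P ‖y + t • P‖) (⟪P, y⟫ / totE P ‖y‖) 0 := by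
      have h2 := ((hs.pow 2).add_const (‖P‖ ^ 2)).sqrt (by simp; positivity)
      simp only [zero_smul, add_zero] at h2
      unfold totE
      refine h2.congr_deriv ?_
      simp only [Pi.pow_apply, zero_smul, add_zero]
      have hE' := hE
      unfold totE at hE'
      field_simp
      ring
    have hden := (hs.mul (hEd.add hs)).const_mul 2
    have h3 := hu.div hden (by simp; constructor <;> positivity)
    have h4 := h1.unique h3
    rw [h4]
    simp only [Pi.mul_apply, Pi.add_apply, zero_smul, add_zero]
    have hE2 := totE_sq P ‖y‖
    generalize totE P ‖y‖ = E at *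
    generalize (⟪P, y⟫ : ℝ) = u at *
    generalize ‖y‖ = r at *
    generalize ‖P‖ = s at *
    have hs : s ^ 2 = E ^ 2 - r ^ 2 := by linarith
    rw [hs]
    field_simp
    ring
  have hT : HasFDerivAt (Tmap P) ((1 / 2 : ℝ) • (ContinuousLinearMap.id ℝ R3) + A.smulRight P) y := by
    have h1 : HasFDerivAt (fun y : R3 => (1 / 2 : ℝ) • (P + y))
        ((1 / 2 : ℝ) • (ContinuousLinearMap.id ℝ R3)) y :=
      ((hasFDerivAt_id y).const_add P).const_smul (1 / 2 : ℝ)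
    exact h1.add (hA.smul_const P)
  refine ⟨_, hT, ?_⟩
  have hdet : ((1 / 2 : ℝ) • (ContinuousLinearMap.id ℝ R3) + A.smulRight P).det
      = (1 / 8) * (1 + 2 * A P) := by
    have h1 : (((1 / 2 : ℝ) • (ContinuousLinearMap.id ℝ R3) + A.smulRight P :
        R3 →L[ℝ] R3) : R3 →ₗ[ℝ] R3) = (1 / 2 : ℝ) •
          LinearMap.transvection ((2 : ℝ) • (A : R3 →ₗ[ℝ] ℝ)) P := by
      ext1 x
      simp [LinearMap.transvection.apply, smul_smul]
    rw [ContinuousLinearMap.det, h1, LinearMap.det_smul, LinearMap.transvection.det]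
    simp
    norm_num
  rw [hdet, hAP]
  have hE2 := totE_sq P ‖y‖
  generalize totE P ‖y‖ = E at *
  generalize (⟪P, y⟫ : ℝ) = u at *
  generalize ‖y‖ = r at *
  generalize ‖P‖ = s at *
  have hs : s ^ 2 = E ^ 2 - r ^ 2 := by linarith
  rw [hs]
  field_simp
  ring

end Geometry

end

section


section ChangeOfVariables

open scoped ENNReal

instance instFinSph : IsFiniteMeasure sphMeasure := by unfold sphMeasure; infer_instance

/-- Jacobian of `Tmap P`. -/
def Jac (P y : R3) : ℝ :=
  (totE P ‖y‖ ^ 2 - ⟪P, y⟫ ^ 2 / ‖y‖ ^ 2) / (8 * (‖y‖ * totE P ‖y‖))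

lemma relMom_zero_null (P : R3) : ∀ᵐ p : R3, 0 < relMom p (P - p) := by
  have hs : (Submodule.span ℝ {P}) ≠ (⊤ : Submodule ℝ R3) := by
    intro h
    have h1 : Module.finrank ℝ (Submodule.span ℝ {P}) ≤ 1 := by
      simpa using finrank_span_le_card (R := ℝ) ({P} : Set R3)
    rw [h, finrank_top] at h1
    simp at h1
  have h0 := Measure.addHaar_submodule (volume : Measure R3) _ hs
  rw [ae_iff]
  refine measure_mono_null ?_ h0
  intro p hp
  simp only [Set.mem_ofPred_eq, not_lt] at hp
  have h1 : relMom p (P - p) = 0 := le_antisymm hp (relMom_nonneg _ _)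
  have h2 := relMom_sq p (P - p)
  rw [h1] at h2
  have h3 : ⟪p, P - p⟫ = ‖p‖ * ‖P - p‖ := by linarith
  rw [inner_eq_norm_mul_iff_real] at h3
  have h4 : (‖P - p‖ + ‖p‖) • p = ‖p‖ • P := by
    rw [add_smul, h3, smul_sub]; abel
  rw [SetLike.mem_coe, Submodule.mem_span_singleton]
  by_cases h5 : ‖P - p‖ + ‖p‖ = 0
  · have h6 : ‖p‖ = 0 := by linarith [norm_nonneg p, norm_nonneg (P - p)]
    exact ⟨0, by rw [norm_eq_zero.1 h6]; simp⟩
  · refine ⟨(‖P - p‖ + ‖p‖)⁻¹ * ‖p‖, ?_⟩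
    rw [mul_smul, ← h4, smul_smul, inv_mul_cancel₀ h5, one_smul]

lemma ae_ne_zero : ∀ᵐ y : R3, y ≠ 0 := by
  rw [ae_iff]; simp

lemma Jac_pos (P y : R3) (hy : y ≠ 0) : 0 < Jac P y := by
  have hr : 0 < ‖y‖ := norm_pos_iff.2 hy
  have hE := totE_pos P hr
  unfold Jac
  apply div_pos _ (by positivity)
  rw [totE_sq]
  have h1 : ⟪P, y⟫ ^ 2 / ‖y‖ ^ 2 ≤ ‖P‖ ^ 2 := by
    rw [div_le_iff₀ (by positivity), ← mul_pow]
    exact sq_le_sq' (neg_le_of_abs_le (abs_real_inner_le_norm P y)) (real_inner_le_norm P y)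
  have : 0 < ‖y‖ ^ 2 := by positivity
  linarith

lemma lintegral_Tmap (P : R3) (g : R3 → ℝ≥0∞) :
    ∫⁻ p, g p = ∫⁻ y, ENNReal.ofReal (Jac P y) * g (Tmap P y) := by
  choose! D hD hdet using hasFDerivAt_Tmap P
  have hinj : Set.InjOn (Tmap P) ({0}ᶜ : Set R3) := by
    intro x hx y hy h
    rw [← Tinv_Tmap P x hx, ← Tinv_Tmap P y hy, h]
  have h := lintegral_image_eq_lintegral_abs_det_fderiv_mul (volume : Measure R3)
    (measurableSet_singleton (0 : R3)).compl (fun x hx => (hD x hx).hasFDerivWithinAt) hinj g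
  have himg : ∀ᵐ p : R3, p ∈ Tmap P '' ({0}ᶜ : Set R3) := by
    filter_upwards [relMom_zero_null P] with p hp
    refine ⟨Tinv P p, ?_, Tmap_Tinv P p hp⟩
    have h2 : 0 < ‖p‖ + ‖P - p‖ := by
      by_contra hc
      have h6 : ‖p‖ = 0 := by linarith [norm_nonneg p, norm_nonneg (P - p)]
      have := relMom_sq_le p (P - p)
      rw [h6] at this
      nlinarith
    have := norm_Tinv P p h2
    intro hz
    rw [Set.mem_singleton_iff.1 hz, norm_zero] at this
    linarith
  rw [Measure.restrict_eq_self_of_ae_mem himg] at h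
  rw [h, restrict_compl_singleton]
  refine lintegral_congr_ae ?_
  filter_upwards [ae_ne_zero] with y hy
  rw [hdet y hy, ← Jac, abs_of_pos (Jac_pos P y hy)]

lemma Jac_div (P y : R3) (hy : y ≠ 0) : Jac P y / (‖Tmap P y‖ * ‖P - Tmap P y‖)
    = 1 / (2 * (‖y‖ * totE P ‖y‖)) := by
  have h1 := Jac_pos P y hy
  have hr : 0 < ‖y‖ := norm_pos_iff.2 hy
  have hE := totE_pos P hr
  rw [prodE_Tmap P y hy]
  unfold Jac at *
  have h2 : 0 < totE P ‖y‖ ^ 2 - ⟪P, y⟫ ^ 2 / ‖y‖ ^ 2 := by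
    by_contra hc
    exact absurd h1 (not_lt.2 (div_nonpos_of_nonpos_of_nonneg (not_lt.1 hc) (by positivity)))
  generalize totE P ‖y‖ ^ 2 - ⟪P, y⟫ ^ 2 / ‖y‖ ^ 2 = X at *
  field_simp
  norm_num

lemma lintegral_polar (F : R3 → ℝ≥0∞) (hF : Measurable F) :
    ∫⁻ y, F y = ∫⁻ ω, ∫⁻ r in Set.Ioi (0 : ℝ), ENNReal.ofReal (r ^ 2) * F (r • (ω : R3))
      ∂volume ∂sphMeasure := by
  have h1 : ∫⁻ y, F y = ∫⁻ y : ({(0 : R3)}ᶜ : Set R3), F y ∂(Measure.comap Subtype.val volume) := by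
    rw [lintegral_subtype_comap (measurableSet_singleton _).compl, restrict_compl_singleton]
  have hmp := (volume : Measure R3).measurePreserving_homeomorphUnitSphereProd
  have h2 := hmp.lintegral_comp_emb (Homeomorph.measurableEmbedding _)
    (fun x : sphere (0 : R3) 1 × Set.Ioi (0 : ℝ) => F ((x.2 : ℝ) • (x.1 : R3)))
  have h3 : ∀ y : ({(0 : R3)}ᶜ : Set R3), (fun x : sphere (0 : R3) 1 × Set.Ioi (0 : ℝ) =>
      F ((x.2 : ℝ) • (x.1 : R3))) (homeomorphUnitSphereProd R3 y) = F y := by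
    intro y
    have hy : ‖(y : R3)‖ ≠ 0 := norm_ne_zero_iff.2 y.2
    simp [smul_smul, hy]
  simp only [h3] at h2
  have hm : Measurable (fun x : sphere (0 : R3) 1 × Set.Ioi (0 : ℝ) =>
      F ((x.2 : ℝ) • (x.1 : R3))) := hF.comp (by fun_prop)
  rw [h1, h2, lintegral_prod _ hm.aemeasurable]
  refine lintegral_congr fun ω => ?_
  have hm2 : Measurable (fun r : Set.Ioi (0 : ℝ) => F ((r : ℝ) • (ω : R3))) :=
    hF.comp (by fun_prop)
  rw [Measure.volumeIoiPow, lintegral_withDensity_eq_lintegral_mul _ (by fun_prop) hm2]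
  simp only [Pi.mul_apply]
  rw [lintegral_subtype_comap measurableSet_Ioi
    (fun r : ℝ => ENNReal.ofReal (r ^ (Module.finrank ℝ R3 - 1)) * F (r • (ω : R3)))]
  simp

lemma measurable_relMom : Measurable (fun x : R3 × R3 => relMom x.1 x.2) := by
  unfold relMom; fun_prop

lemma measurable_pPost : Measurable (fun x : (R3 × R3) × sphere (0 : R3) 1 =>
    pPost x.1.1 x.1.2 x.2) := by
  unfold pPost relMom; fun_prop

lemma measurable_qPost : Measurable (fun x : (R3 × R3) × sphere (0 : R3) 1 =>
    qPost x.1.1 x.1.2 x.2) := by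
  unfold qPost relMom; fun_prop

lemma measurable_Tmap : Measurable (fun x : R3 × R3 => Tmap x.1 x.2) := by
  unfold Tmap totE; fun_prop

lemma measurable_Tmap_right (P : R3) : Measurable (Tmap P) := by
  have h : Measurable (fun y : R3 => (P, y)) := by fun_prop
  have h2 : Tmap P = (fun x : R3 × R3 => Tmap x.1 x.2) ∘ (fun y : R3 => (P, y)) := by
    funext y; rfl
  rw [h2]
  exact measurable_Tmap.comp h

/-- Kernel `w(ρ)/(|p||q|)` in `ℝ≥0∞`. -/
def kap (w : ℝ → ℝ≥0∞) (p q : R3) : ℝ≥0∞ :=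
  w (relMom p q) * ENNReal.ofReal (1 / (‖p‖ * ‖q‖))

lemma measurable_kap {w : ℝ → ℝ≥0∞} (hw : Measurable w) :
    Measurable (fun x : R3 × R3 => kap w x.1 x.2) := by
  unfold kap
  have h1 : Measurable (fun x : R3 × R3 => w (relMom x.1 x.2)) := hw.comp measurable_relMom
  have h2 : Measurable (fun x : R3 × R3 => ENNReal.ofReal (1 / (‖x.1‖ * ‖x.2‖))) := by fun_prop
  exact h1.mul h2

lemma kap_symm_aux (w : ℝ → ℝ≥0∞) (hw : Measurable w) (P : R3)
    (Φ : R3 → R3 → ℝ≥0∞) (hΦ : Measurable (fun x : R3 × R3 => Φ x.1 x.2)) :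
    ∫⁻ p, kap w p (P - p) * ∫⁻ ω : sphere (0 : R3) 1, Φ p (pPost p (P - p) ω) ∂sphMeasure
     = ∫⁻ ω₂, ∫⁻ ω, ∫⁻ r in Set.Ioi (0 : ℝ), ENNReal.ofReal (r ^ 2) *
      (w r * ENNReal.ofReal (1 / (2 * (r * totE P r))) *
        Φ (Tmap P (r • (ω₂ : R3))) (Tmap P (r • (ω : R3)))) ∂volume ∂sphMeasure ∂sphMeasure := by
  have hT := measurable_Tmap
  have hTP : Measurable (Tmap P) := measurable_Tmap_right P
  have htE : Measurable (totE P) := by unfold totE; fun_prop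
  rw [lintegral_Tmap P (fun p => kap w p (P - p) *
    ∫⁻ ω : sphere (0 : R3) 1, Φ p (pPost p (P - p) ω) ∂sphMeasure)]
  have h1 : ∫⁻ y, ENNReal.ofReal (Jac P y) * (kap w (Tmap P y) (P - Tmap P y) *
      ∫⁻ ω : sphere (0 : R3) 1, Φ (Tmap P y) (pPost (Tmap P y) (P - Tmap P y) ω) ∂sphMeasure)
      = ∫⁻ y, w ‖y‖ * ENNReal.ofReal (1 / (2 * (‖y‖ * totE P ‖y‖))) *
      ∫⁻ ω : sphere (0 : R3) 1, Φ (Tmap P y) (Tmap P (‖y‖ • (ω : R3))) ∂sphMeasure := by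
    refine lintegral_congr_ae ?_
    filter_upwards [ae_ne_zero] with y hy
    have h2 : ∀ ω : sphere (0 : R3) 1, pPost (Tmap P y) (P - Tmap P y) ω
        = Tmap P (‖y‖ • (ω : R3)) := fun ω => pPost_Tmap P y ω hy (by simp)
    simp only [h2]
    rw [kap, relMom_Tmap P y hy, ← Jac_div P y hy, div_eq_mul_one_div (Jac P y),
      ENNReal.ofReal_mul (Jac_pos P y hy).le]
    ring
  rw [h1, lintegral_polar]
  · refine lintegral_congr fun ω₂ => ?_
    have hm : Measurable (fun x : ℝ × sphere (0 : R3) 1 => ENNReal.ofReal (x.1 ^ 2) *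
      (w x.1 * ENNReal.ofReal (1 / (2 * (x.1 * totE P x.1))) *
        Φ (Tmap P (x.1 • (ω₂ : R3))) (Tmap P (x.1 • (x.2 : R3))))) := by
      have := hΦ.comp (((hTP.comp (by fun_prop :
        Measurable (fun x : ℝ × sphere (0 : R3) 1 => x.1 • (ω₂ : R3)))).prodMk
        (hTP.comp (by fun_prop : Measurable (fun x : ℝ × sphere (0 : R3) 1 => x.1 • (x.2 : R3))))))
      have := this
      simp only [Function.comp_def] at this
      fun_prop
    rw [← lintegral_lintegral_swap hm.aemeasurable]
    refine setLIntegral_congr_fun measurableSet_Ioi fun r hr => ?_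
    have hr0 : (0 : ℝ) < r := hr
    have hn : ‖r • (ω₂ : R3)‖ = r := by rw [norm_smul]; simp [hr0.le]
    simp only [hn]
    have hm2 : Measurable (fun ω : sphere (0 : R3) 1 =>
        Φ (Tmap P (r • (ω₂ : R3))) (Tmap P (r • (ω : R3)))) :=
      hΦ.comp (measurable_const.prodMk (hTP.comp (by fun_prop)))
    rw [lintegral_const_mul _ (hm2.const_mul _), lintegral_const_mul _ hm2]
  · have hm2 : Measurable (fun x : R3 × sphere (0 : R3) 1 =>
        Φ (Tmap P x.1) (Tmap P (‖x.1‖ • (x.2 : R3)))) :=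
      hΦ.comp ((hTP.comp measurable_fst).prodMk (hTP.comp (by fun_prop)))
    have hm3 := hm2.lintegral_prod_right' (ν := sphMeasure)
    fun_prop

lemma lintegral_sum_mom (F : R3 → R3 → ℝ≥0∞) (hF : Measurable (fun x : R3 × R3 => F x.1 x.2)) :
    ∫⁻ p, ∫⁻ q, F p q = ∫⁻ P, ∫⁻ p, F p (P - p) := by
  have h1 : ∀ p, ∫⁻ q, F p q = ∫⁻ P, F p (P - p) := fun p =>
    (lintegral_sub_right_eq_self (fun q => F p q) p).symm
  simp only [h1]
  rw [lintegral_lintegral_swap]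
  exact (hF.comp (by fun_prop : Measurable (fun x : R3 × R3 => (x.1, x.2 - x.1)))).aemeasurable

/-- Pre/post collisional symmetry. -/
lemma kap_symm (w : ℝ → ℝ≥0∞) (hw : Measurable w)
    (Φ : R3 × R3 → R3 × R3 → ℝ≥0∞)
    (hΦ : Measurable (fun x : (R3 × R3) × (R3 × R3) => Φ x.1 x.2)) :
    ∫⁻ p, ∫⁻ q, kap w p q * ∫⁻ ω : sphere (0 : R3) 1,
        Φ (p, q) (pPost p q ω, qPost p q ω) ∂sphMeasure
     = ∫⁻ p, ∫⁻ q, kap w p q * ∫⁻ ω : sphere (0 : R3) 1,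
        Φ (pPost p q ω, qPost p q ω) (p, q) ∂sphMeasure := by
  have hp := measurable_pPost
  have hq := measurable_qPost
  have hk := measurable_kap hw
  have hm1 : Measurable (fun x : R3 × R3 => kap w x.1 x.2 * ∫⁻ ω : sphere (0 : R3) 1,
        Φ (x.1, x.2) (pPost x.1 x.2 ω, qPost x.1 x.2 ω) ∂sphMeasure) := by
    refine hk.mul ?_
    exact (hΦ.comp (measurable_fst.prodMk (hp.prodMk hq))).lintegral_prod_right'
  have hm2 : Measurable (fun x : R3 × R3 => kap w x.1 x.2 * ∫⁻ ω : sphere (0 : R3) 1,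
        Φ (pPost x.1 x.2 ω, qPost x.1 x.2 ω) (x.1, x.2) ∂sphMeasure) := by
    refine hk.mul ?_
    exact (hΦ.comp ((hp.prodMk hq).prodMk measurable_fst)).lintegral_prod_right'
  rw [lintegral_sum_mom _ hm1, lintegral_sum_mom (fun p q => kap w p q *
    ∫⁻ ω : sphere (0 : R3) 1, Φ (pPost p q ω, qPost p q ω) (p, q) ∂sphMeasure) hm2]
  refine lintegral_congr fun P => ?_
  have hqe : ∀ p : R3, ∀ ω : sphere (0 : R3) 1, qPost p (P - p) ω = P - pPost p (P - p) ω := by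
    intro p ω
    rw [qPost_eq]; abel_nf
  simp only [hqe]
  have h1 := kap_symm_aux w hw P (fun p p' => Φ (p, P - p) (p', P - p'))
    (hΦ.comp (by fun_prop :
      Measurable (fun x : R3 × R3 => ((x.1, P - x.1), (x.2, P - x.2)))))
  have h2 := kap_symm_aux w hw P (fun p p' => Φ (p', P - p') (p, P - p))
    (hΦ.comp (by fun_prop :
      Measurable (fun x : R3 × R3 => ((x.2, P - x.2), (x.1, P - x.1)))))
  rw [h1, h2, lintegral_lintegral_swap]
  have hTP : Measurable (Tmap P) :=
    measurable_Tmap_right P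
  have htE : Measurable (totE P) := by unfold totE; fun_prop
  have hm : Measurable (fun x : (sphere (0 : R3) 1 × sphere (0 : R3) 1) × ℝ =>
      ENNReal.ofReal (x.2 ^ 2) * (w x.2 * ENNReal.ofReal (1 / (2 * (x.2 * totE P x.2))) *
        Φ (Tmap P (x.2 • (x.1.1 : R3)), P - Tmap P (x.2 • (x.1.1 : R3)))
          (Tmap P (x.2 • (x.1.2 : R3)), P - Tmap P (x.2 • (x.1.2 : R3))))) := by
    have h1 : Measurable (fun x : (sphere (0 : R3) 1 × sphere (0 : R3) 1) × ℝ =>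
      Tmap P (x.2 • (x.1.1 : R3))) := hTP.comp (by fun_prop)
    have h2 : Measurable (fun x : (sphere (0 : R3) 1 × sphere (0 : R3) 1) × ℝ =>
      Tmap P (x.2 • (x.1.2 : R3))) := hTP.comp (by fun_prop)
    have h3 := hΦ.comp ((h1.prodMk (h1.const_sub P)).prodMk (h2.prodMk (h2.const_sub P)))
    simp only [Function.comp_def] at h3
    fun_prop
  exact (hm.lintegral_prod_right' (ν := volume.restrict (Set.Ioi (0:ℝ)))).aemeasurable

end ChangeOfVariables

end

section


section Zonal

open scoped ENNReal

/-- Radial cutoff. -/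
def kcut : ℝ → ℝ≥0∞ := (Set.Iio (1 : ℝ)).indicator 1

/-- Normalisation constant. -/
def ccut : ℝ≥0∞ := ∫⁻ r in Set.Ioi (0 : ℝ), ENNReal.ofReal (r ^ 2) * kcut r

lemma measurable_kcut : Measurable kcut := measurable_one.indicator measurableSet_Iio

lemma sphere_avg (H : R3 → ℝ≥0∞) (hH : Measurable H) :
    ccut * ∫⁻ ω : sphere (0 : R3) 1, H ω ∂sphMeasure
      = ∫⁻ y : R3, kcut ‖y‖ * H (‖y‖⁻¹ • y) := by
  have hk := measurable_kcut
  have hm : Measurable (fun y : R3 => kcut ‖y‖ * H (‖y‖⁻¹ • y)) := by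
    have h1 : Measurable (fun y : R3 => H (‖y‖⁻¹ • y)) := hH.comp (by fun_prop)
    have h2 : Measurable (fun y : R3 => kcut ‖y‖) := hk.comp (by fun_prop)
    exact h2.mul h1
  rw [lintegral_polar _ hm, ccut]
  have h1 : Measurable (fun ω : sphere (0 : R3) 1 => H ω) := hH.comp (by fun_prop)
  rw [← lintegral_const_mul _ h1]
  refine lintegral_congr fun ω => ?_
  have h2 : Measurable (fun r : ℝ => ENNReal.ofReal (r ^ 2) * kcut r) := by fun_prop
  rw [← lintegral_mul_const _ h2]
  refine setLIntegral_congr_fun measurableSet_Ioi fun r hr => ?_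
  have hr0 : (0 : ℝ) < r := hr
  have hn : ‖r • (ω : R3)‖ = r := by rw [norm_smul]; simp [hr0.le]
  simp only [hn]
  rw [smul_smul, inv_mul_cancel₀ hr0.ne', one_smul, mul_assoc]

lemma ccut_mul : ccut * sphMeasure Set.univ = volume (ball (0 : R3) 1) := by
  have h := sphere_avg (fun _ => 1) measurable_const
  simp only [lintegral_const, one_mul, mul_one] at h
  rw [h]
  have : ∀ y : R3, kcut ‖y‖ = (ball (0 : R3) 1).indicator 1 y := by
    intro y
    simp [kcut, Set.indicator]
  simp only [this]
  rw [lintegral_indicator_one measurableSet_ball]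

lemma ccut_ne_zero : ccut ≠ 0 := by
  intro h
  have := ccut_mul
  rw [h, zero_mul] at this
  exact (measure_ball_pos volume (0 : R3) one_pos).ne this

lemma sph_univ_ne_zero : sphMeasure Set.univ ≠ 0 := by
  intro h
  have := ccut_mul
  rw [h, mul_zero] at this
  exact (measure_ball_pos volume (0 : R3) one_pos).ne this

lemma ccut_ne_top : ccut ≠ ⊤ := by
  intro h
  have := ccut_mul
  rw [h, ENNReal.top_mul sph_univ_ne_zero] at this
  exact measure_ball_lt_top.ne this.symm

/-- Rotation invariance of the sphere measure. -/
lemma sphere_rot (R : R3 ≃ₗᵢ[ℝ] R3) (H : R3 → ℝ≥0∞) (hH : Measurable H) :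
    ∫⁻ ω : sphere (0 : R3) 1, H (R ω) ∂sphMeasure = ∫⁻ ω : sphere (0 : R3) 1, H ω ∂sphMeasure := by
  have hR : Measurable (fun y : R3 => R y) := R.continuous.measurable
  have h1 := sphere_avg (fun y => H (R y)) (hH.comp hR)
  have h2 := sphere_avg H hH
  have h3 := R.measurePreserving.lintegral_comp_emb R.toHomeomorph.measurableEmbedding
    (fun y : R3 => kcut ‖y‖ * H (‖y‖⁻¹ • y))
  simp only [LinearIsometryEquiv.norm_map] at h3
  have h4 : ∀ y : R3, H (R (‖y‖⁻¹ • y)) = H (‖y‖⁻¹ • R y) := by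
    intro y; rw [map_smul]
  simp only [h4] at h1
  rw [h3, ← h2] at h1
  exact (ENNReal.mul_right_inj ccut_ne_zero ccut_ne_top).1 h1

lemma lintegral_R3 (G : ℝ → ℝ × ℝ → ℝ≥0∞) (hG : Measurable (fun x : ℝ × (ℝ × ℝ) => G x.1 x.2)) :
    ∫⁻ y : R3, G (y 0) (y 1, y 2) = ∫⁻ x : ℝ, ∫⁻ z : ℝ × ℝ, G x z := by
  have h1 := (PiLp.volume_preserving_ofLp (Fin 3)).lintegral_comp_emb
    (MeasurableEquiv.toLp 2 (Fin 3 → ℝ)).symm.measurableEmbedding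
    (fun v : Fin 3 → ℝ => G (v 0) (v 1, v 2))
  have h2 := (volume_preserving_piFinSuccAbove (fun _ : Fin 3 => ℝ) 0).lintegral_comp_emb
    (MeasurableEquiv.measurableEmbedding _)
    (fun v : ℝ × (Fin 2 → ℝ) => G v.1 (v.2 0, v.2 1))
  have h2' : ∫⁻ v : Fin 3 → ℝ, G (v 0) (v 1, v 2)
    = ∫⁻ v : ℝ × (Fin 2 → ℝ), G v.1 (v.2 0, v.2 1) := by
    rw [← h2]
    rfl
  have hm : Measurable (fun v : ℝ × (Fin 2 → ℝ) => G v.1 (v.2 0, v.2 1)) :=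
    hG.comp (by fun_prop : Measurable (fun v : ℝ × (Fin 2 → ℝ) => (v.1, (v.2 0, v.2 1))))
  have h3 : ∫⁻ v : ℝ × (Fin 2 → ℝ), G v.1 (v.2 0, v.2 1)
      = ∫⁻ x : ℝ, ∫⁻ z : ℝ × ℝ, G x z := by
    rw [show (volume : Measure (ℝ × (Fin 2 → ℝ))) = volume.prod volume from rfl,
      lintegral_prod _ hm.aemeasurable]
    refine lintegral_congr fun x => ?_
    have h4 := (volume_preserving_finTwoArrow ℝ).lintegral_comp_emb
      (MeasurableEquiv.measurableEmbedding _) (fun z : ℝ × ℝ => G x z)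
    rw [← h4]
    rfl
  rw [← h3, ← h2', ← h1]

lemma lintegral_sq_plane (K : ℝ → ℝ≥0∞) (hK : Measurable K) :
    ∫⁻ z : ℝ × ℝ, K (z.1 ^ 2 + z.2 ^ 2)
      = ENNReal.ofReal (2 * π) * ∫⁻ s in Set.Ioi (0 : ℝ), ENNReal.ofReal s * K (s ^ 2) := by
  rw [← lintegral_comp_polarCoord_symm]
  have h1 : ∀ p : ℝ × ℝ, ENNReal.ofReal p.1 • K ((polarCoord.symm p).1 ^ 2
      + (polarCoord.symm p).2 ^ 2) = ENNReal.ofReal p.1 * K (p.1 ^ 2) := by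
    intro p
    rw [polarCoord_symm_apply]
    simp only [smul_eq_mul]
    congr 2
    have := Real.sin_sq_add_cos_sq p.2
    linear_combination p.1 ^ 2 * this
  simp only [h1]
  rw [polarCoord_target, show (volume : Measure (ℝ × ℝ)) = volume.prod volume from rfl,
    ← Measure.prod_restrict, lintegral_prod _ (by fun_prop)]
  simp only [lintegral_const, Measure.restrict_apply_univ, Real.volume_Ioo]
  rw [lintegral_mul_const _ (by fun_prop), mul_comm]
  congr 2
  ring

lemma lintegral_half_plane (K : ℝ → ℝ → ℝ≥0∞) (hK : Measurable (fun x : ℝ × ℝ => K x.1 x.2)) :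
    ∫⁻ x : ℝ, ∫⁻ s in Set.Ioi (0 : ℝ), ENNReal.ofReal s * K x s
      = ∫⁻ r in Set.Ioi (0 : ℝ), ∫⁻ θ in Set.Ioo (0 : ℝ) π,
        ENNReal.ofReal (r ^ 2) * (ENNReal.ofReal (Real.sin θ) *
          K (r * Real.cos θ) (r * Real.sin θ)) := by
  have hm : Measurable (fun x : ℝ × ℝ => ENNReal.ofReal x.2 * K x.1 x.2) := by fun_prop
  have hz : ∀ x : ℝ, ∫⁻ s in Set.Ioi (0 : ℝ), ENNReal.ofReal s * K x s
      = ∫⁻ s : ℝ, ENNReal.ofReal s * K x s := by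
    intro x
    rw [← lintegral_indicator measurableSet_Ioi]
    refine lintegral_congr fun s => ?_
    by_cases hs : 0 < s
    · simp [Set.indicator, hs]
    · simp [Set.indicator, hs, ENNReal.ofReal_of_nonpos (not_lt.1 hs)]
  simp only [hz]
  have h1 := lintegral_prod (μ := (volume : Measure ℝ)) (ν := (volume : Measure ℝ)) _ hm.aemeasurable
  simp only at h1
  rw [← h1, ← Measure.volume_eq_prod, ← lintegral_comp_polarCoord_symm, polarCoord_target,
    Measure.volume_eq_prod, ← Measure.prod_restrict, lintegral_prod _ (by
      have h2 : Measurable (fun p : ℝ × ℝ => polarCoord.symm p) := by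
        simp only [polarCoord_symm_apply]; fun_prop
      have h3 := hm.comp h2
      simp only [Function.comp_def] at h3
      simp only [smul_eq_mul]
      exact (ENNReal.measurable_ofReal.comp measurable_fst).aemeasurable.mul h3.aemeasurable)]
  refine setLIntegral_congr_fun measurableSet_Ioi fun r hr => ?_
  have hr0 : (0 : ℝ) < r := hr
  simp only [polarCoord_symm_apply, smul_eq_mul]
  rw [← lintegral_indicator measurableSet_Ioo, ← lintegral_indicator measurableSet_Ioo]
  refine lintegral_congr fun θ => ?_
  by_cases h2 : θ ∈ Set.Ioo 0 π
  · have h3 : θ ∈ Set.Ioo (-π) π := ⟨by linarith [h2.1, Real.pi_pos], h2.2⟩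
    rw [Set.indicator_of_mem h2, Set.indicator_of_mem h3, ENNReal.ofReal_mul hr0.le, pow_two,
      ENNReal.ofReal_mul hr0.le]
    ring
  · rw [Set.indicator_of_notMem h2]
    by_cases h3 : θ ∈ Set.Ioo (-π) π
    · rw [Set.indicator_of_mem h3]
      have h4 : θ ≤ 0 := by
        by_contra hc
        exact h2 ⟨not_le.1 hc, h3.2⟩
      have h5 : r * Real.sin θ ≤ 0 :=
        mul_nonpos_of_nonneg_of_nonpos hr0.le (Real.sin_nonpos_of_nonpos_of_neg_pi_le h4 h3.1.le)
      rw [ENNReal.ofReal_of_nonpos h5]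
      simp
    · rw [Set.indicator_of_notMem h3]

lemma lintegral_cos (h : ℝ → ℝ≥0∞) :
    ∫⁻ θ in Set.Ioo (0 : ℝ) π, ENNReal.ofReal (Real.sin θ) * h (Real.cos θ)
      = ∫⁻ u in Set.Ioo (-1 : ℝ) 1, h u := by
  have h1 := lintegral_image_eq_lintegral_deriv_mul_of_antitoneOn (f := Real.cos)
    (f' := fun θ => - Real.sin θ) (s := Set.Ioo (0 : ℝ) π) measurableSet_Ioo
    (fun x _ => (Real.hasDerivAt_cos x).hasDerivWithinAt)
    (Real.strictAntiOn_cos.antitoneOn.mono Set.Ioo_subset_Icc_self) h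
  simp only [neg_neg] at h1
  rw [← h1]
  congr 2
  ext u
  constructor
  · rintro ⟨θ, hθ, rfl⟩
    constructor
    · rw [← Real.cos_pi]
      exact Real.strictAntiOn_cos ⟨hθ.1.le, hθ.2.le⟩ ⟨Real.pi_pos.le, le_rfl⟩ hθ.2
    · rw [← Real.cos_zero]
      exact Real.strictAntiOn_cos ⟨le_rfl, Real.pi_pos.le⟩ ⟨hθ.1.le, hθ.2.le⟩ hθ.1
  · intro hu
    exact ⟨Real.arccos u, ⟨Real.arccos_pos.2 hu.2, by
      rw [← Real.arccos_neg_one]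
      exact Real.strictAntiOn_arccos ⟨le_rfl, by norm_num⟩ ⟨hu.1.le, hu.2.le⟩ hu.1⟩,
      Real.cos_arccos hu.1.le hu.2.le⟩

lemma zonal_aux (h : ℝ → ℝ≥0∞) (hh : Measurable h) :
    ∫⁻ ω : sphere (0 : R3) 1, h ((ω : R3) 0) ∂sphMeasure
      = ENNReal.ofReal (2 * π) * ∫⁻ u in Set.Ioo (-1 : ℝ) 1, h u := by
  have hk := measurable_kcut
  refine (ENNReal.mul_right_inj ccut_ne_zero ccut_ne_top).1 ?_
  rw [sphere_avg (fun y => h (y 0)) (hh.comp (by fun_prop))]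
  have hn : ∀ y : R3, ‖y‖ = √((y 0) ^ 2 + ((y 1) ^ 2 + (y 2) ^ 2)) := by
    intro y
    rw [EuclideanSpace.norm_eq, Fin.sum_univ_three]
    simp only [Real.norm_eq_abs, sq_abs]
    congr 1; ring
  have h1 : ∀ y : R3, kcut ‖y‖ * h ((‖y‖⁻¹ • y) 0) =
      (fun (x : ℝ) (z : ℝ × ℝ) => kcut (√(x ^ 2 + (z.1 ^ 2 + z.2 ^ 2))) *
        h ((√(x ^ 2 + (z.1 ^ 2 + z.2 ^ 2)))⁻¹ * x)) (y 0) (y 1, y 2) := by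
    intro y
    rw [hn y]
    simp
  simp only [h1]
  have h1' := lintegral_R3 (fun (x : ℝ) (z : ℝ × ℝ) => kcut (√(x ^ 2 + (z.1 ^ 2 + z.2 ^ 2))) *
        h ((√(x ^ 2 + (z.1 ^ 2 + z.2 ^ 2)))⁻¹ * x)) (by fun_prop)
  simp only at h1'
  rw [h1']
  have h2 : ∀ x : ℝ, ∫⁻ z : ℝ × ℝ, kcut (√(x ^ 2 + (z.1 ^ 2 + z.2 ^ 2))) *
        h ((√(x ^ 2 + (z.1 ^ 2 + z.2 ^ 2)))⁻¹ * x)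
      = ENNReal.ofReal (2 * π) * ∫⁻ s in Set.Ioi (0 : ℝ), ENNReal.ofReal s *
        (kcut (√(x ^ 2 + s ^ 2)) * h ((√(x ^ 2 + s ^ 2))⁻¹ * x)) := fun x =>
    lintegral_sq_plane (fun w => kcut (√(x ^ 2 + w)) * h ((√(x ^ 2 + w))⁻¹ * x)) (by fun_prop)
  simp only [h2]
  rw [lintegral_const_mul' _ _ ENNReal.ofReal_ne_top]
  rw [lintegral_half_plane (fun x s => kcut (√(x ^ 2 + s ^ 2)) * h ((√(x ^ 2 + s ^ 2))⁻¹ * x))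
    (by fun_prop)]
  rw [← lintegral_cos, mul_left_comm]
  congr 1
  have hmc : Measurable (fun r : ℝ => ENNReal.ofReal (r ^ 2) * kcut r) := by fun_prop
  rw [ccut, ← lintegral_mul_const _ hmc]
  refine setLIntegral_congr_fun measurableSet_Ioi fun r hr => ?_
  have hr0 : (0 : ℝ) < r := hr
  have h3 : ∀ θ : ℝ, √((r * Real.cos θ) ^ 2 + (r * Real.sin θ) ^ 2) = r := by
    intro θ
    have : (r * Real.cos θ) ^ 2 + (r * Real.sin θ) ^ 2 = r ^ 2 := by
      have := Real.sin_sq_add_cos_sq θ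
      linear_combination r ^ 2 * this
    rw [this, Real.sqrt_sq hr0.le]
  simp only [h3, inv_mul_cancel_left₀ hr0.ne']
  rw [← lintegral_const_mul _ (by fun_prop)]
  refine lintegral_congr fun θ => ?_
  ring

/-- Archimedes: zonal integrals on the sphere. -/
lemma zonal (e : R3) (he : ‖e‖ = 1) (h : ℝ → ℝ≥0∞) (hh : Measurable h) :
    ∫⁻ ω : sphere (0 : R3) 1, h ⟪e, (ω : R3)⟫ ∂sphMeasure
      = ENNReal.ofReal (2 * π) * ∫⁻ u in Set.Ioo (-1 : ℝ) 1, h u := by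
  set e₀ : R3 := EuclideanSpace.single 0 1 with he₀
  have hn : ‖e‖ = ‖e₀‖ := by rw [he, he₀]; simp
  set R : R3 ≃ₗᵢ[ℝ] R3 := Submodule.reflection (Submodule.span ℝ {e - e₀})ᗮ
  have hR : R e = e₀ := Submodule.reflection_sub hn
  rw [← zonal_aux h hh, ← sphere_rot R (fun y => h (y 0)) (hh.comp (by fun_prop))]
  refine lintegral_congr fun ω => ?_
  congr 1
  rw [← R.inner_map_map, hR, he₀]
  simp [EuclideanSpace.inner_single_left]

end Zonal

end

section


section Averages

open scoped ENNReal

lemma norm_pPost (p q ω : R3) (h : 0 < relMom p q) (hω : ‖ω‖ = 1) :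
    ‖pPost p q ω‖ = (‖p‖ + ‖q‖ + ⟪p + q, ω⟫) / 2 := by
  have hr : relMom p ((p + q) - p) = relMom p q := by rw [add_sub_cancel_left]
  have h1 := Tmap_Tinv (p + q) p (by rw [hr]; exact h)
  have hpos : 0 < ‖p‖ + ‖q‖ := by
    by_contra hc
    have h6 : ‖p‖ = 0 := by linarith [norm_nonneg p, norm_nonneg q]
    have := relMom_sq_le p q
    rw [h6] at this
    nlinarith
  have h2 := norm_Tinv (p + q) p (by rw [add_sub_cancel_left]; exact hpos)
  rw [hr] at h2
  have hy : Tinv (p + q) p ≠ 0 := by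
    intro hc
    rw [hc, norm_zero] at h2
    linarith
  set y := Tinv (p + q) p with hyd
  have h3 := pPost_Tmap (p + q) y ω hy hω
  rw [h1, add_sub_cancel_left] at h3
  have h4 := sumE_Tmap (p + q) y hy
  rw [h1, add_sub_cancel_left] at h4
  have hyp : 0 < ‖y‖ := norm_pos_iff.2 hy
  have hω0 : ω ≠ 0 := by
    intro hc; rw [hc] at hω; simp at hω
  have hyω : ‖y‖ • ω ≠ 0 := smul_ne_zero hyp.ne' hω0
  rw [h3, norm_Tmap _ _ hyω, norm_smul, hω, norm_norm, mul_one, inner_smul_right, ← h4]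
  field_simp

lemma norm_pPost_le (p q ω : R3) (h : 0 < relMom p q) (hω : ‖ω‖ = 1) :
    ‖pPost p q ω‖ ≤ ‖p‖ + ‖q‖ := by
  rw [norm_pPost p q ω h hω]
  have h1 := real_inner_le_norm (p + q) ω
  have h2 := norm_add_le p q
  rw [hω] at h1
  linarith

lemma exists_unit_dir (P : R3) : ∃ e : R3, ‖e‖ = 1 ∧ P = ‖P‖ • e := by
  by_cases hP : P = 0
  · exact ⟨EuclideanSpace.single 0 1, by simp, by simp [hP]⟩
  · have h : ‖P‖ ≠ 0 := norm_ne_zero_iff.2 hP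
    refine ⟨‖P‖⁻¹ • P, ?_, ?_⟩
    · rw [norm_smul, norm_inv, norm_norm, inv_mul_cancel₀ h]
    · rw [smul_smul, mul_inv_cancel₀ h, one_smul]

lemma inv_sq_int (E s : ℝ) (hs : 0 ≤ s) (hE : s < E) :
    ∫⁻ u in Set.Ioo (-1 : ℝ) 1, ENNReal.ofReal (1 / ((E + s * u) / 2) ^ 2)
      = ENNReal.ofReal (8 / (E ^ 2 - s ^ 2)) := by
  have hpos : ∀ u ∈ Set.Icc (-1 : ℝ) 1, 0 < E + s * u := by
    intro u hu
    nlinarith [hu.1, hu.2]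
  have hcont : ContinuousOn (fun u : ℝ => 1 / ((E + s * u) / 2) ^ 2) (Set.Icc (-1) 1) := by
    refine ContinuousOn.div continuousOn_const (by fun_prop) ?_
    intro u hu
    have := hpos u hu
    positivity
  have hint : IntervalIntegrable (fun u : ℝ => 1 / ((E + s * u) / 2) ^ 2) volume (-1) 1 := by
    refine ContinuousOn.intervalIntegrable ?_
    rwa [Set.uIcc_of_le (by norm_num)]
  have hE0 : 0 < E := lt_of_le_of_lt hs hE
  have hd : ∀ u ∈ Set.uIcc (-1 : ℝ) 1,
      HasDerivAt (fun u => 4 / E * (u / (E + s * u))) (1 / ((E + s * u) / 2) ^ 2) u := by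
    intro u hu
    rw [Set.uIcc_of_le (by norm_num)] at hu
    have h0 := hpos u hu
    have h1 : HasDerivAt (fun u : ℝ => E + s * u) s u := by
      simpa using ((hasDerivAt_id u).const_mul s).const_add E
    have h2 := ((hasDerivAt_id u).fun_div h1 h0.ne').const_mul (4 / E)
    refine h2.congr_deriv ?_
    simp only [id]
    field_simp
    ring
  have h3 := intervalIntegral.integral_eq_sub_of_hasDerivAt hd hint
  rw [intervalIntegral.integral_of_le (by norm_num), integral_Ioc_eq_integral_Ioo] at h3
  rw [← ofReal_integral_eq_lintegral_ofReal, h3]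
  · congr 1
    have h4 : E + s ≠ 0 := by linarith
    have h5 : E - s ≠ 0 := by linarith
    have h6 : E ^ 2 - s ^ 2 ≠ 0 := by nlinarith
    rw [mul_one, mul_neg_one, ← sub_eq_add_neg]
    field_simp
    ring
  · exact ((intervalIntegrable_iff_integrableOn_Ioc_of_le (by norm_num)).1 hint).mono_set Set.Ioo_subset_Ioc_self
  · exact Filter.Eventually.of_forall fun u => by positivity

lemma inv_sq_avg (p q : R3) (h : 0 < relMom p q) :
    ∫⁻ ω : sphere (0 : R3) 1, ENNReal.ofReal (1 / ‖pPost p q ω‖ ^ 2) ∂sphMeasure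
      = ENNReal.ofReal (16 * π / relMom p q ^ 2) := by
  obtain ⟨e, he, hP⟩ := exists_unit_dir (p + q)
  have h1 : ∀ ω : sphere (0 : R3) 1, ENNReal.ofReal (1 / ‖pPost p q ω‖ ^ 2)
      = (fun u => ENNReal.ofReal (1 / ((‖p‖ + ‖q‖ + ‖p + q‖ * u) / 2) ^ 2)) ⟪e, (ω : R3)⟫ := by
    intro ω
    rw [norm_pPost p q ω h (by simp)]
    simp only
    rw [← real_inner_smul_left, ← hP]
  simp only [h1]
  have hsq : relMom p q ^ 2 = (‖p‖ + ‖q‖) ^ 2 - ‖p + q‖ ^ 2 := by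
    rw [relMom_sq, norm_add_sq_real]; ring
  have hlt : ‖p + q‖ < ‖p‖ + ‖q‖ := by
    have h2 : 0 < relMom p q ^ 2 := by positivity
    nlinarith [norm_nonneg (p + q), norm_nonneg p, norm_nonneg q]
  rw [zonal e he (fun u => ENNReal.ofReal (1 / ((‖p‖ + ‖q‖ + ‖p + q‖ * u) / 2) ^ 2))
    (by fun_prop), inv_sq_int _ _ (norm_nonneg _) hlt, ← ENNReal.ofReal_mul (by positivity), hsq]
  congr 1
  ring

lemma angle_avg (b : ℝ) (hb1 : 1 < b) (hb2 : b < 2) : ∃ C : ℝ, 0 ≤ C ∧ ∀ e : R3, ‖e‖ = 1 →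
    ∫⁻ ω : sphere (0 : R3) 1, ENNReal.ofReal ((1 - ⟪e, (ω : R3)⟫) ^ (-(b / 2))) ∂sphMeasure
      ≤ ENNReal.ofReal C := by
  have hint : IntervalIntegrable (fun u : ℝ => (1 - u) ^ (-(b / 2))) volume (-1) 1 := by
    have h1 : IntervalIntegrable (fun u : ℝ => u ^ (-(b / 2))) volume 0 2 :=
      intervalIntegral.intervalIntegrable_rpow' (by linarith)
    have h2 := h1.comp_sub_left 1
    norm_num at h2
    exact h2.symm
  have hI : IntegrableOn (fun u : ℝ => (1 - u) ^ (-(b / 2))) (Set.Ioo (-1) 1) :=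
    ((intervalIntegrable_iff_integrableOn_Ioc_of_le (by norm_num)).1 hint).mono_set
      Set.Ioo_subset_Ioc_self
  have hfin : ENNReal.ofReal (2 * π) *
      ∫⁻ u in Set.Ioo (-1 : ℝ) 1, ENNReal.ofReal ((1 - u) ^ (-(b / 2))) ≠ ⊤ :=
    ENNReal.mul_ne_top ENNReal.ofReal_ne_top hI.lintegral_lt_top.ne
  refine ⟨(ENNReal.ofReal (2 * π) * ∫⁻ u in Set.Ioo (-1 : ℝ) 1,
    ENNReal.ofReal ((1 - u) ^ (-(b / 2)))).toReal, ENNReal.toReal_nonneg, fun e he => ?_⟩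
  rw [zonal e he (fun u => ENNReal.ofReal ((1 - u) ^ (-(b / 2)))) (by fun_prop),
    ENNReal.ofReal_toReal hfin]

end Averages

end

section


section Operator

open scoped ENNReal

/-- Collision configuration space. -/
abbrev XX : Type := R3 × (R3 × sphere (0 : R3) 1)

/-- Collision measure `dq dω`. -/
abbrev muZ : Measure (R3 × sphere (0 : R3) 1) := (volume : Measure R3).prod sphMeasure

/-- Collision measure `dp dq dω`. -/
abbrev muX : Measure XX := (volume : Measure R3).prod muZ

/-- Two-particle measure. -/
abbrev muP : Measure (R3 × R3) := (volume : Measure R3).prod volume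

/-- Pre-collisional pair. -/
def preX (x : XX) : R3 × R3 := (x.1, x.2.1)

/-- Post-collisional pair. -/
def postX (x : XX) : R3 × R3 := (pPost x.1 x.2.1 x.2.2, qPost x.1 x.2.1 x.2.2)

/-- Collision kernel. -/
def Bk (b ε : ℝ) (p q : R3) : ℝ :=
  if ε ≤ relMom p q then relMom p q ^ (2 - b) / (‖p‖ * ‖q‖) else 0

/-- Weight in the relative momentum. -/
def wfun (b ε : ℝ) (r : ℝ) : ℝ≥0∞ := ENNReal.ofReal (if ε ≤ r then r ^ (2 - b) else 0)

lemma measurable_wfun (b ε : ℝ) : Measurable (wfun b ε) := by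
  unfold wfun
  exact ENNReal.measurable_ofReal.comp
    (Measurable.ite measurableSet_Ici (by fun_prop) measurable_const)

lemma Bk_nonneg (b ε : ℝ) (p q : R3) : 0 ≤ Bk b ε p q := by
  unfold Bk
  have := relMom_nonneg p q
  split_ifs <;> positivity

lemma ofReal_Bk (b ε : ℝ) (p q : R3) : ENNReal.ofReal (Bk b ε p q) = kap (wfun b ε) p q := by
  unfold Bk kap wfun
  split_ifs
  · rw [div_eq_mul_one_div, ENNReal.ofReal_mul (rpow_nonneg (relMom_nonneg p q) _)]
  · simp

lemma Bk_le {b ε : ℝ} (hb1 : 1 < b) (hε : 0 < ε) (p q : R3) :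
    Bk b ε p q ≤ 4 * ε ^ (-b) := by
  unfold Bk
  split_ifs with h
  · have hr : 0 < relMom p q := lt_of_lt_of_le hε h
    have h1 := relMom_sq_le p q
    have h2 : 0 < ‖p‖ * ‖q‖ := by
      have : 0 < relMom p q ^ 2 := by positivity
      linarith
    have h3 : relMom p q ^ (-b) ≤ ε ^ (-b) :=
      rpow_le_rpow_of_nonpos hε h (by linarith)
    have h4 : relMom p q ^ (2 - b) = relMom p q ^ 2 * relMom p q ^ (-b) := by
      rw [sub_eq_add_neg, rpow_add hr, rpow_two]
    rw [div_le_iff₀ h2, h4]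
    have h5 : 0 < relMom p q ^ (-b) := rpow_pos_of_pos hr _
    calc relMom p q ^ 2 * relMom p q ^ (-b) ≤ 4 * (‖p‖ * ‖q‖) * ε ^ (-b) := by
          gcongr
      _ = _ := by ring
  · positivity

lemma measurable_Bk (b ε : ℝ) : Measurable (fun x : R3 × R3 => Bk b ε x.1 x.2) := by
  unfold Bk
  refine Measurable.ite (measurableSet_le measurable_const measurable_relMom) ?_ measurable_const
  have := measurable_relMom
  fun_prop

lemma measurable_preX : Measurable preX := by
  unfold preX; fun_prop

lemma measurable_postX : Measurable postX := by
  unfold postX pPost qPost relMom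
  fun_prop

lemma measurable_BkX (b ε : ℝ) : Measurable (fun x : XX => Bk b ε x.1 x.2.1) := by
  unfold Bk relMom
  refine Measurable.ite (measurableSet_le measurable_const (by fun_prop)) (by fun_prop)
    measurable_const

lemma measurable_oBk (b ε : ℝ) : Measurable (fun x : XX => ENNReal.ofReal (Bk b ε x.1 x.2.1)) := by
  have := measurable_BkX b ε
  fun_prop

lemma lintegral_muX (F : XX → ℝ≥0∞) (hF : Measurable F) :
    ∫⁻ x, F x ∂muX = ∫⁻ p, ∫⁻ q, ∫⁻ ω, F (p, q, ω) ∂sphMeasure := by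
  rw [lintegral_prod _ hF.aemeasurable]
  refine lintegral_congr fun p => ?_
  have h : Measurable (fun y : R3 × sphere (0 : R3) 1 => F (p, y)) := by fun_prop
  rw [lintegral_prod _ h.aemeasurable]

/-- Collision measure weighted with the kernel. -/
def nuX (b ε : ℝ) : Measure XX := muX.withDensity (fun x => ENNReal.ofReal (Bk b ε x.1 x.2.1))

lemma lintegral_nuX (b ε : ℝ) (F : XX → ℝ≥0∞) (hF : Measurable F) :
    ∫⁻ x, F x ∂(nuX b ε) = ∫⁻ p, ∫⁻ q, kap (wfun b ε) p q * ∫⁻ ω, F (p, q, ω) ∂sphMeasure := by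
  have hB : Measurable (fun x : XX => ENNReal.ofReal (Bk b ε x.1 x.2.1)) :=
    measurable_oBk b ε
  rw [nuX, lintegral_withDensity_eq_lintegral_mul _ hB hF, lintegral_muX _ (hB.mul hF)]
  refine lintegral_congr fun p => lintegral_congr fun q => ?_
  simp only [Pi.mul_apply]
  rw [lintegral_const_mul, ofReal_Bk]
  exact hF.comp (by fun_prop)

lemma map_symm (b ε : ℝ) : Measure.map (fun x => (preX x, postX x)) (nuX b ε)
    = Measure.map (fun x => (postX x, preX x)) (nuX b ε) := by
  have hpre := measurable_preX
  have hpost := measurable_postX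
  refine Measure.ext_of_lintegral _ fun F hF => ?_
  have h1 : Measurable (fun x => F (preX x, postX x)) := by fun_prop
  have h2 : Measurable (fun x => F (postX x, preX x)) := by fun_prop
  rw [lintegral_map hF (by fun_prop), lintegral_map hF (by fun_prop),
    lintegral_nuX _ _ _ h1, lintegral_nuX _ _ _ h2]
  exact kap_symm (wfun b ε) (measurable_wfun b ε) (fun x y => F (x, y)) hF

lemma map_post (b ε : ℝ) : Measure.map postX (nuX b ε) = Measure.map preX (nuX b ε) := by
  have hpre := measurable_preX
  have hpost := measurable_postX
  have h := congrArg (Measure.map Prod.snd) (map_symm b ε)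
  rw [Measure.map_map measurable_snd (by fun_prop), Measure.map_map measurable_snd (by fun_prop)] at h
  exact h

lemma map_pre_muX : Measure.map preX muX = sphMeasure Set.univ • muP := by
  have hpre := measurable_preX
  refine Measure.ext_of_lintegral _ fun F hF => ?_
  have h0 : Measurable (fun x => F (preX x)) := by fun_prop
  rw [lintegral_map hF hpre, lintegral_muX _ h0, lintegral_smul_measure,
    lintegral_prod _ hF.aemeasurable]
  simp only [preX, lintegral_const]
  have h1 : ∀ p : R3, ∫⁻ q : R3, F (p, q) * sphMeasure Set.univ
      = (∫⁻ q : R3, F (p, q)) * sphMeasure Set.univ := fun p =>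
    lintegral_mul_const _ (hF.comp (by fun_prop))
  simp only [h1]
  rw [lintegral_mul_const _ hF.lintegral_prod_right', smul_eq_mul, mul_comm]

lemma nuX_le {b ε : ℝ} (hb1 : 1 < b) (hε : 0 < ε) :
    nuX b ε ≤ ENNReal.ofReal (4 * ε ^ (-b)) • muX := by
  have h : nuX b ε ≤ muX.withDensity (fun _ => ENNReal.ofReal (4 * ε ^ (-b))) :=
    withDensity_mono (Filter.Eventually.of_forall fun x =>
      ENNReal.ofReal_le_ofReal (Bk_le hb1 hε _ _))
  rwa [withDensity_const] at h

lemma map_pre_le {b ε : ℝ} (hb1 : 1 < b) (hε : 0 < ε) :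
    Measure.map preX (nuX b ε) ≤
      (ENNReal.ofReal (4 * ε ^ (-b)) * sphMeasure Set.univ) • muP := by
  have h := Measure.map_mono (nuX_le hb1 hε) measurable_preX
  rwa [Measure.map_smul, map_pre_muX, smul_smul] at h

lemma integrable_pre {H : R3 × R3 → ℝ} (hH : Integrable H muP) :
    Integrable (fun x => H (preX x)) muX := by
  have h : Integrable H (Measure.map preX muX) := by
    rw [map_pre_muX]
    exact hH.smul_measure (measure_ne_top _ _)
  exact h.comp_measurable measurable_preX

lemma integral_pre {H : R3 × R3 → ℝ} (hH : Integrable H muP) :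
    ∫ x, H (preX x) ∂muX = sphMeasure.real Set.univ * ∫ x, H x ∂muP := by
  have h : Integrable H (Measure.map preX muX) := by
    rw [map_pre_muX]
    exact hH.smul_measure (measure_ne_top _ _)
  rw [← integral_map measurable_preX.aemeasurable h.aestronglyMeasurable, map_pre_muX,
    integral_smul_measure]
  rfl

lemma integrable_nu_pre {b ε : ℝ} (hb1 : 1 < b) (hε : 0 < ε) {H : R3 × R3 → ℝ}
    (hH : Integrable H muP) : Integrable H (Measure.map preX (nuX b ε)) :=
  (hH.smul_measure (ENNReal.mul_ne_top ENNReal.ofReal_ne_top (measure_ne_top _ _))).mono_measure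
    (map_pre_le hb1 hε)

lemma integrable_nuX_iff {b ε : ℝ} {F : XX → ℝ} :
    Integrable F (nuX b ε) ↔ Integrable (fun x => Bk b ε x.1 x.2.1 * F x) muX := by
  rw [nuX, integrable_withDensity_iff_integrable_smul'
    (measurable_oBk b ε)
    (Filter.Eventually.of_forall fun x => ENNReal.ofReal_lt_top)]
  simp only [ENNReal.toReal_ofReal (Bk_nonneg _ _ _ _), smul_eq_mul]

lemma integral_nuX {b ε : ℝ} (F : XX → ℝ) :
    ∫ x, F x ∂(nuX b ε) = ∫ x, Bk b ε x.1 x.2.1 * F x ∂muX := by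
  rw [nuX, integral_withDensity_eq_integral_toReal_smul
    (measurable_oBk b ε)
    (Filter.Eventually.of_forall fun x => ENNReal.ofReal_lt_top)]
  simp only [ENNReal.toReal_ofReal (Bk_nonneg _ _ _ _), smul_eq_mul]

lemma integrable_post {b ε : ℝ} (hb1 : 1 < b) (hε : 0 < ε) {H : R3 × R3 → ℝ}
    (hH : Integrable H muP) :
    Integrable (fun x => Bk b ε x.1 x.2.1 * H (postX x)) muX := by
  rw [← integrable_nuX_iff]
  have h := integrable_nu_pre hb1 hε hH
  rw [← map_post] at h
  exact h.comp_measurable measurable_postX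

lemma integrable_Bpre {b ε : ℝ} (hb1 : 1 < b) (hε : 0 < ε) {H : R3 × R3 → ℝ}
    (hH : Integrable H muP) :
    Integrable (fun x => Bk b ε x.1 x.2.1 * H (preX x)) muX := by
  rw [← integrable_nuX_iff]
  exact (integrable_nu_pre hb1 hε hH).comp_measurable measurable_preX

/-- Symmetry with a bounded weight. -/
lemma integral_symm_weight {b ε : ℝ} {H : R3 × R3 → ℝ} (hb1 : 1 < b) (hε : 0 < ε)
    (hH : Integrable H muP) (φ : R3 → ℝ) (hφ : Measurable φ) :
    ∫ x, Bk b ε x.1 x.2.1 * (H (postX x) * φ x.1) ∂muX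
      = ∫ x, Bk b ε x.1 x.2.1 * (H (preX x) * φ (postX x).1) ∂muX := by
  rw [← integral_nuX, ← integral_nuX]
  have hpre := measurable_preX
  have hpost := measurable_postX
  have hs : AEStronglyMeasurable (fun z : (R3 × R3) × (R3 × R3) => H z.1 * φ z.2.1)
      (Measure.map (fun x => (postX x, preX x)) (nuX b ε)) := by
    refine AEStronglyMeasurable.mul ?_
      (hφ.comp (measurable_fst.comp measurable_snd)).aestronglyMeasurable
    have h := (integrable_nu_pre hb1 hε hH).aestronglyMeasurable
    rw [← map_post] at h
    refine AEStronglyMeasurable.comp_measurable ?_ measurable_fst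
    rwa [Measure.map_map measurable_fst (by fun_prop)]
  have h1 := integral_map (by fun_prop) hs
  have h2 := integral_map (f := fun z : (R3 × R3) × (R3 × R3) => H z.1 * φ z.2.1)
    (φ := (fun x => (preX x, postX x))) (μ := nuX b ε) (by fun_prop) (by rwa [map_symm])
  rw [map_symm, h1] at h2
  exact h2

lemma post_congr {b ε : ℝ} (hb1 : 1 < b) (hε : 0 < ε) {H H' : R3 × R3 → ℝ}
    (h : H =ᵐ[muP] H') : (fun x => Bk b ε x.1 x.2.1 * H (postX x)) =ᵐ[muX]
      (fun x => Bk b ε x.1 x.2.1 * H' (postX x)) := by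
  have h1 : H =ᵐ[Measure.map preX (nuX b ε)] H' :=
    ae_mono (map_pre_le hb1 hε) (Measure.smul_absolutelyContinuous h)
  rw [← map_post] at h1
  have h2 := ae_of_ae_map measurable_postX.aemeasurable h1
  rw [nuX, ae_withDensity_iff (measurable_oBk b ε)] at h2
  filter_upwards [h2] with x hx
  by_cases hB : Bk b ε x.1 x.2.1 = 0
  · rw [hB]; simp
  · have hpos : 0 < Bk b ε x.1 x.2.1 := lt_of_le_of_ne (Bk_nonneg _ _ _ _) (Ne.symm hB)
    rw [hx (ENNReal.ofReal_pos.2 hpos).ne']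

lemma pre_congr {H H' : R3 × R3 → ℝ}
    (h : H =ᵐ[muP] H') : (fun x => H (preX x)) =ᵐ[muX] (fun x => H' (preX x)) := by
  have h1 : H =ᵐ[Measure.map preX muX] H' := by
    rw [map_pre_muX]
    exact Measure.smul_absolutelyContinuous h
  exact ae_of_ae_map measurable_preX.aemeasurable h1

end Operator

end

section


section OperatorL1

open scoped ENNReal

lemma mkL1 {α β : Type*} [MeasurableSpace α] [MeasurableSpace β] {μ : Measure α} {ν : Measure β}
    (T : (α → ℝ) → (β → ℝ)) (C : ℝ)
    (hint : ∀ f, Integrable f μ → Integrable (T f) ν)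
    (hcongr : ∀ f g, f =ᵐ[μ] g → T f =ᵐ[ν] T g)
    (hadd : ∀ f g, Integrable f μ → Integrable g μ → T (f + g) =ᵐ[ν] T f + T g)
    (hsmul : ∀ (c : ℝ) f, Integrable f μ → T (c • f) =ᵐ[ν] c • T f)
    (hbd : ∀ f, Integrable f μ → ∫ y, ‖T f y‖ ∂ν ≤ C * ∫ x, ‖f x‖ ∂μ) :
    ∃ L : Lp ℝ 1 μ →L[ℝ] Lp ℝ 1 ν, ∀ f : Lp ℝ 1 μ, ⇑(L f) =ᵐ[ν] T f := by
  have hi : ∀ f : Lp ℝ 1 μ, Integrable f μ := fun f => L1.integrable_coeFn f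
  let L0 : Lp ℝ 1 μ →ₗ[ℝ] Lp ℝ 1 ν :=
    { toFun := fun f => (hint f (hi f)).toL1 _
      map_add' := by
        intro f g
        rw [← Integrable.toL1_add, Integrable.toL1_eq_toL1_iff]
        exact (hcongr _ _ (Lp.coeFn_add f g)).trans (hadd _ _ (hi f) (hi g))
      map_smul' := by
        intro c f
        rw [RingHom.id_apply, ← Integrable.toL1_smul', Integrable.toL1_eq_toL1_iff]
        · exact (hcongr _ _ (Lp.coeFn_smul c f)).trans (hsmul c _ (hi f)) }
  refine ⟨L0.mkContinuous C ?_, fun f => ?_⟩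
  · intro f
    rw [L1.norm_eq_integral_norm, L1.norm_eq_integral_norm]
    refine le_trans (le_of_eq ?_) (hbd f (hi f))
    refine integral_congr_ae ?_
    filter_upwards [Integrable.coeFn_toL1 (hint f (hi f))] with y hy
    change ‖((hint f (hi f)).toL1 _ : β → ℝ) y‖ = _
    rw [hy]
  · exact Integrable.coeFn_toL1 (hint f (hi f))

/-- L¹ space. -/
abbrev EE : Type := Lp ℝ 1 (volume : Measure R3)

lemma EE_int (f : EE) : Integrable f := L1.integrable_coeFn f

/-- Tensor product of functions. -/
def tfun (f g : R3 → ℝ) (x : R3 × R3) : ℝ := f x.1 * g x.2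

lemma tfun_int {f g : R3 → ℝ} (hf : Integrable f) (hg : Integrable g) :
    Integrable (tfun f g) muP := hf.mul_prod hg

lemma tfun_congr {f f' g g' : R3 → ℝ} (hf : f =ᵐ[volume] f') (hg : g =ᵐ[volume] g') :
    tfun f g =ᵐ[muP] tfun f' g' := by
  have h1 : (fun x : R3 × R3 => f x.1) =ᵐ[muP] fun x => f' x.1 :=
    Measure.quasiMeasurePreserving_fst.ae_eq_comp hf
  have h2 : (fun x : R3 × R3 => g x.2) =ᵐ[muP] fun x => g' x.2 :=
    Measure.quasiMeasurePreserving_snd.ae_eq_comp hg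
  exact h1.mul h2

/-- Tensor product in L¹. -/
def tens : EE →L[ℝ] EE →L[ℝ] Lp ℝ 1 muP :=
  LinearMap.mkContinuous₂ (LinearMap.mk₂ ℝ
    (fun f g : EE => ((tfun_int (EE_int f) (EE_int g)).toL1 _ : Lp ℝ 1 muP))
    (by
      intro f f' g
      rw [← Integrable.toL1_add, Integrable.toL1_eq_toL1_iff]
      refine (tfun_congr (Lp.coeFn_add f f') (Filter.EventuallyEq.refl _ _)).trans ?_
      refine Filter.Eventually.of_forall fun x => ?_
      simp [tfun, add_mul])
    (by
      intro c f g
      rw [← Integrable.toL1_smul', Integrable.toL1_eq_toL1_iff]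
      refine (tfun_congr (Lp.coeFn_smul c f) (Filter.EventuallyEq.refl _ _)).trans ?_
      refine Filter.Eventually.of_forall fun x => ?_
      simp [tfun, mul_assoc])
    (by
      intro f g g'
      rw [← Integrable.toL1_add, Integrable.toL1_eq_toL1_iff]
      refine (tfun_congr (Filter.EventuallyEq.refl _ _) (Lp.coeFn_add g g')).trans ?_
      refine Filter.Eventually.of_forall fun x => ?_
      simp [tfun, mul_add])
    (by
      intro c f g
      rw [← Integrable.toL1_smul', Integrable.toL1_eq_toL1_iff]
      refine (tfun_congr (Filter.EventuallyEq.refl _ _) (Lp.coeFn_smul c g)).trans ?_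
      refine Filter.Eventually.of_forall fun x => ?_
      simp [tfun, mul_left_comm])) 1 (by
    intro f g
    rw [one_mul, L1.norm_eq_integral_norm, L1.norm_eq_integral_norm, L1.norm_eq_integral_norm,
      ← integral_prod_mul]
    refine le_of_eq (integral_congr_ae ?_)
    filter_upwards [Integrable.coeFn_toL1 (tfun_int (EE_int f) (EE_int g))] with x hx
    change ‖((tfun_int (EE_int f) (EE_int g)).toL1 _ : R3 × R3 → ℝ) x‖ = _
    rw [hx, tfun, norm_mul])

lemma tens_coe (f g : EE) : ⇑(tens f g) =ᵐ[muP] tfun f g :=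
  Integrable.coeFn_toL1 (tfun_int (EE_int f) (EE_int g))

/-- Upper bound for the collision kernel. -/
def Lam (C₁ b ε : ℝ) : ℝ := C₁ * (4 * ε ^ (-b))

/-- Regularised gain operator on collision space. -/
def Kop (C₁ b ε : ℝ) (H : R3 × R3 → ℝ) (x : XX) : ℝ :=
  C₁ * (Bk b ε x.1 x.2.1 * H (postX x)) +
    (Lam C₁ b ε * H (preX x) - C₁ * (Bk b ε x.1 x.2.1 * H (preX x)))

/-- Regularised gain operator. -/
def Gfun (C₁ b ε : ℝ) (H : R3 × R3 → ℝ) (p : R3) : ℝ := ∫ z, Kop C₁ b ε H (p, z) ∂muZ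

lemma Kop_int {C₁ b ε : ℝ} (hb1 : 1 < b) (hε : 0 < ε) {H : R3 × R3 → ℝ} (hH : Integrable H muP) : Integrable (Kop C₁ b ε H) muX :=
  ((integrable_post hb1 hε hH).const_mul C₁).add
    (((integrable_pre hH).const_mul _).sub ((integrable_Bpre hb1 hε hH).const_mul C₁))

end OperatorL1

end

section


section OperatorGamma

open scoped ENNReal

lemma Kop_congr {C₁ b ε : ℝ} (hb1 : 1 < b) (hε : 0 < ε) {H H' : R3 × R3 → ℝ}
    (h : H =ᵐ[muP] H') : Kop C₁ b ε H =ᵐ[muX] Kop C₁ b ε H' := by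
  filter_upwards [post_congr hb1 hε h, pre_congr h] with x h1 h2
  unfold Kop
  rw [h1, h2]

lemma Kop_nonneg {C₁ b ε : ℝ} (hC : 0 < C₁) (hb1 : 1 < b) (hε : 0 < ε) {H : R3 × R3 → ℝ}
    (h : ∀ x, 0 ≤ H x) (x : XX) : 0 ≤ Kop C₁ b ε H x := by
  unfold Kop Lam
  have h1 := Bk_nonneg b ε x.1 x.2.1
  have h2 := Bk_le hb1 hε x.1 x.2.1
  have h3 := h (postX x)
  have h4 := h (preX x)
  have h5 : 0 ≤ C₁ * (4 * ε ^ (-b) - Bk b ε x.1 x.2.1) * H (preX x) :=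
    mul_nonneg (mul_nonneg hC.le (by linarith)) h4
  have h6 : 0 ≤ C₁ * (Bk b ε x.1 x.2.1 * H (postX x)) := by positivity
  nlinarith

lemma Kop_norm_le {C₁ b ε : ℝ} (hC : 0 < C₁) (hb1 : 1 < b) (hε : 0 < ε) (H : R3 × R3 → ℝ)
    (x : XX) : ‖Kop C₁ b ε H x‖ ≤ Kop C₁ b ε (fun y => ‖H y‖) x := by
  have h1 := Kop_nonneg hC hb1 hε (H := fun y => ‖H y‖ - H y)
    (fun y => by linarith [le_norm_self (H y)]) x
  have h2 := Kop_nonneg hC hb1 hε (H := fun y => ‖H y‖ + H y)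
    (fun y => by linarith [neg_le_of_abs_le (le_refl |H y|), Real.norm_eq_abs (H y)]) x
  rw [Real.norm_eq_abs, abs_le]
  unfold Kop at *
  constructor <;> linarith

/-- Total collision rate constant. -/
def lamC (C₁ b ε : ℝ) : ℝ := Lam C₁ b ε * sphMeasure.real Set.univ

lemma sph_real_pos : 0 < sphMeasure.real Set.univ :=
  ENNReal.toReal_pos sph_univ_ne_zero (measure_ne_top _ _)

lemma lamC_pos {C₁ b ε : ℝ} (hC : 0 < C₁) (hε : 0 < ε) : 0 < lamC C₁ b ε := by
  unfold lamC Lam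
  have := sph_real_pos
  positivity

lemma integral_Kop_weight {C₁ b ε : ℝ} (hb1 : 1 < b) (hε : 0 < ε) {H : R3 × R3 → ℝ}
    (hH : Integrable H muP) (φ : R3 → ℝ) (hφ : Measurable φ) (k : ℝ) (hk : ∀ p, ‖φ p‖ ≤ k) :
    ∫ x, Kop C₁ b ε H x * φ x.1 ∂muX
      = C₁ * (∫ x, Bk b ε x.1 x.2.1 * (H (preX x) * φ (postX x).1) ∂muX)
        + (lamC C₁ b ε * (∫ x, H x * φ x.1 ∂muP)
        - C₁ * (∫ x, Bk b ε x.1 x.2.1 * (H (preX x) * φ (preX x).1) ∂muX)) := by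
  have hφX : AEStronglyMeasurable (fun x : XX => φ x.1) muX :=
    (hφ.comp measurable_fst).aestronglyMeasurable
  have hbX : ∀ᵐ x ∂muX, ‖φ x.1‖ ≤ k := Filter.Eventually.of_forall fun x => hk _
  have hHφ : Integrable (fun x : R3 × R3 => H x * φ x.1) muP :=
    hH.mul_bdd (hφ.comp measurable_fst).aestronglyMeasurable
      (Filter.Eventually.of_forall fun x => hk _)
  have i1 := ((integrable_post hb1 hε hH).mul_bdd hφX hbX)
  have i2 := integrable_pre hHφ
  have i3 := integrable_Bpre hb1 hε hHφ
  have i23 : Integrable (fun x => Lam C₁ b ε * (H (preX x) * φ (preX x).1)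
      - C₁ * (Bk b ε x.1 x.2.1 * (H (preX x) * φ (preX x).1))) muX :=
    (i2.const_mul _).sub (i3.const_mul _)
  have e1 : ∀ x : XX, Kop C₁ b ε H x * φ x.1 = C₁ * (Bk b ε x.1 x.2.1 * H (postX x) * φ x.1)
      + (Lam C₁ b ε * (H (preX x) * φ (preX x).1)
        - C₁ * (Bk b ε x.1 x.2.1 * (H (preX x) * φ (preX x).1))) := by
    intro x
    unfold Kop
    simp only [preX]
    ring
  have e2 : ∫ x, Bk b ε x.1 x.2.1 * H (postX x) * φ x.1 ∂muX
     = ∫ x, Bk b ε x.1 x.2.1 * (H (preX x) * φ (postX x).1) ∂muX := by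
    rw [← integral_symm_weight hb1 hε hH φ hφ]
    refine integral_congr_ae (Filter.Eventually.of_forall fun x => ?_)
    simp only [mul_assoc]
  rw [integral_congr_ae (Filter.Eventually.of_forall e1), integral_add (i1.const_mul _) i23, integral_sub (i2.const_mul _) (i3.const_mul _),
    integral_const_mul, integral_const_mul, integral_const_mul, e2,
    integral_pre hHφ, lamC]
  ring

lemma integral_Kop {C₁ b ε : ℝ} (hb1 : 1 < b) (hε : 0 < ε) {H : R3 × R3 → ℝ}
    (hH : Integrable H muP) : ∫ x, Kop C₁ b ε H x ∂muX = lamC C₁ b ε * ∫ x, H x ∂muP := by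
  have h := integral_Kop_weight (C₁ := C₁) hb1 hε hH (fun _ => 1) measurable_const 1 (by simp)
  simp only [mul_one] at h
  rw [h]
  ring

lemma exists_Gop {C₁ b ε : ℝ} (hC : 0 < C₁) (hb1 : 1 < b) (hε : 0 < ε) :
    ∃ L : Lp ℝ 1 muP →L[ℝ] EE, ∀ H : Lp ℝ 1 muP, ⇑(L H) =ᵐ[volume] Gfun C₁ b ε H := by
  refine mkL1 (Gfun C₁ b ε) (lamC C₁ b ε) ?_ ?_ ?_ ?_ ?_
  · intro H hH
    exact (Kop_int hb1 hε hH).integral_prod_left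
  · intro H H' h
    filter_upwards [Measure.ae_ae_of_ae_prod (Kop_congr (C₁ := C₁) hb1 hε h)] with p hp
    exact integral_congr_ae hp
  · intro H H' hH hH'
    filter_upwards [(Kop_int (C₁ := C₁) hb1 hε hH).prod_right_ae,
      (Kop_int (C₁ := C₁) hb1 hε hH').prod_right_ae] with p h1 h2
    rw [Pi.add_apply]
    unfold Gfun
    rw [← integral_add h1 h2]
    refine integral_congr_ae (Filter.Eventually.of_forall fun z => ?_)
    simp only [Kop, Pi.add_apply]
    ring
  · intro c H hH
    refine Filter.Eventually.of_forall fun p => ?_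
    rw [Pi.smul_apply, smul_eq_mul]
    unfold Gfun
    rw [← integral_const_mul]
    refine integral_congr_ae (Filter.Eventually.of_forall fun z => ?_)
    simp only [Kop, Pi.smul_apply, smul_eq_mul]
    ring
  · intro H hH
    have h1 := Kop_int (C₁ := C₁) hb1 hε hH
    have h2 := Kop_int (C₁ := C₁) hb1 hε hH.norm
    calc ∫ p, ‖Gfun C₁ b ε H p‖ ≤ ∫ p, ∫ z, ‖Kop C₁ b ε H (p, z)‖ ∂muZ := by
          refine integral_mono h1.integral_prod_left.norm h1.norm.integral_prod_left fun p => ?_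
          exact norm_integral_le_integral_norm _
      _ = ∫ x, ‖Kop C₁ b ε H x‖ ∂muX := (integral_prod _ h1.norm).symm
      _ ≤ ∫ x, Kop C₁ b ε (fun y => ‖H y‖) x ∂muX :=
          integral_mono h1.norm h2 fun x => Kop_norm_le hC hb1 hε H x
      _ = _ := integral_Kop hb1 hε hH.norm

lemma Gfun_congr {C₁ b ε : ℝ} (hb1 : 1 < b) (hε : 0 < ε) {H H' : R3 × R3 → ℝ}
    (h : H =ᵐ[muP] H') : Gfun C₁ b ε H =ᵐ[volume] Gfun C₁ b ε H' := by
  filter_upwards [Measure.ae_ae_of_ae_prod (Kop_congr (C₁ := C₁) hb1 hε h)] with p hp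
  exact integral_congr_ae hp

lemma exists_Gamma {C₁ b ε : ℝ} (hC : 0 < C₁) (hb1 : 1 < b) (hε : 0 < ε) :
    ∃ Γ : EE →L[ℝ] EE →L[ℝ] EE, ∀ f g : EE, ⇑(Γ f g) =ᵐ[volume] Gfun C₁ b ε (tfun f g) := by
  obtain ⟨L, hL⟩ := exists_Gop hC hb1 hε
  refine ⟨(ContinuousLinearMap.compL ℝ EE (Lp ℝ 1 muP) EE L).comp tens, fun f g => ?_⟩
  exact (hL (tens f g)).trans (Gfun_congr hb1 hε (tens_coe f g))

lemma Gfun_weight {C₁ b ε : ℝ} (hb1 : 1 < b) (hε : 0 < ε) {H : R3 × R3 → ℝ}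
    (hH : Integrable H muP) (φ : R3 → ℝ) (hφ : Measurable φ) (k : ℝ) (hk : ∀ p, ‖φ p‖ ≤ k) :
    ∫ p, Gfun C₁ b ε H p * φ p = ∫ x, Kop C₁ b ε H x * φ x.1 ∂muX := by
  have hφX : AEStronglyMeasurable (fun x : XX => φ x.1) muX :=
    (hφ.comp measurable_fst).aestronglyMeasurable
  have hbX : ∀ᵐ x ∂muX, ‖φ x.1‖ ≤ k := Filter.Eventually.of_forall fun x => hk _
  rw [integral_prod _ ((Kop_int hb1 hε hH).mul_bdd hφX hbX)]
  refine integral_congr_ae (Filter.Eventually.of_forall fun p => ?_)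
  simp only [Gfun]
  rw [integral_mul_const]

lemma Qcoll_eq {C₁ b ε : ℝ} (hb1 : 1 < b) (hε : 0 < ε) {f : R3 → ℝ} (hf : Integrable f) :
    Qcoll C₁ b ε f =ᵐ[volume]
      fun p => Gfun C₁ b ε (tfun f f) p - (lamC C₁ b ε * ∫ q, f q) * f p := by
  have hH := tfun_int hf hf
  filter_upwards [(integrable_post hb1 hε hH).prod_right_ae,
    (integrable_Bpre hb1 hε hH).prod_right_ae, (integrable_pre hH).prod_right_ae] with p h1 h2 h3
  have h12 : Integrable (fun z => Bk b ε p z.1 * tfun f f (postX (p, z))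
      - Bk b ε p z.1 * tfun f f (preX (p, z))) muZ := h1.sub h2
  have h4 : ∫ z, tfun f f (preX (p, z)) ∂muZ = f p * ((∫ q, f q) * sphMeasure.real Set.univ) := by
    have h5 := integral_prod_mul (μ := (volume : Measure R3)) (ν := sphMeasure) f (fun _ => (1 : ℝ))
    simp only [mul_one, integral_const, smul_eq_mul] at h5
    simp only [preX, tfun]
    rw [integral_const_mul, h5]
  have h6 : ∀ z, Kop C₁ b ε (tfun f f) (p, z) = C₁ * (Bk b ε p z.1 * tfun f f (postX (p, z))
      - Bk b ε p z.1 * tfun f f (preX (p, z))) + Lam C₁ b ε * tfun f f (preX (p, z)) := by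
    intro z
    unfold Kop
    ring
  have h7 : Gfun C₁ b ε (tfun f f) p = C₁ * (∫ z, (Bk b ε p z.1 * tfun f f (postX (p, z))
      - Bk b ε p z.1 * tfun f f (preX (p, z))) ∂muZ) + Lam C₁ b ε * (f p * ((∫ q, f q) *
        sphMeasure.real Set.univ)) := by
    unfold Gfun
    rw [integral_congr_ae (Filter.Eventually.of_forall h6),
      integral_add (h12.const_mul _) (h3.const_mul _), integral_const_mul,
      integral_const_mul, h4]
  rw [h7, integral_prod _ h12]
  unfold Qcoll lamC
  have h8 : ∀ (q : R3) (ω : sphere (0 : R3) 1), (if ε ≤ relMom p q then relMom p q ^ (2 - b) /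
      (‖p‖ * ‖q‖) else 0) * (f (pPost p q ω) * f (qPost p q ω) - f p * f q) =
      Bk b ε p q * tfun f f (postX (p, q, ω)) - Bk b ε p q * tfun f f (preX (p, q, ω)) := by
    intro q ω
    rw [← mul_sub]
    rfl
  simp only [h8]
  ring

end OperatorGamma

end

section


section Existence

open scoped ENNReal

lemma bilin_unique {E : Type*} [NormedAddCommGroup E] [NormedSpace ℝ E]
    (V : E →L[ℝ] E →L[ℝ] E) {F G : ℝ → E} (h0 : F 0 = G 0)
    (hF : ∀ s ∈ Set.Ici (0 : ℝ), HasDerivWithinAt F (V (F s) (F s)) (Set.Ici 0) s)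
    (hG : ∀ s ∈ Set.Ici (0 : ℝ), HasDerivWithinAt G (V (G s) (G s)) (Set.Ici 0) s)
    (s : ℝ) (hs : 0 ≤ s) : F s = G s := by
  have cF : ContinuousOn F (Set.Icc 0 s) := fun t ht =>
    ((hF t ht.1).continuousWithinAt).mono Set.Icc_subset_Ici_self
  have cG : ContinuousOn G (Set.Icc 0 s) := fun t ht =>
    ((hG t ht.1).continuousWithinAt).mono Set.Icc_subset_Ici_self
  obtain ⟨A, hA⟩ := isCompact_Icc.exists_bound_of_continuousOn cF
  obtain ⟨B, hB⟩ := isCompact_Icc.exists_bound_of_continuousOn cG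
  set R := max A B with hR
  have hA0 : 0 ≤ A := (norm_nonneg _).trans (hA 0 ⟨le_rfl, hs⟩)
  have hR0 : 0 ≤ R := hA0.trans (le_max_left _ _)
  have hlip : LipschitzOnWith (Real.toNNReal (‖V‖ * R + ‖V‖ * R)) (fun u => V u u)
      (closedBall (0 : E) R) := by
    refine LipschitzOnWith.of_dist_le_mul fun u hu w hw => ?_
    rw [mem_closedBall_zero_iff] at hu hw
    rw [Real.coe_toNNReal _ (by positivity), dist_eq_norm, dist_eq_norm]
    have e : V u u - V w w = V u (u - w) + V (u - w) w := by
      simp only [map_sub, sub_apply]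
      abel
    rw [e, add_mul]
    refine (norm_add_le _ _).trans (add_le_add ?_ ?_)
    · refine (V.le_opNorm₂ _ _).trans ?_
      gcongr
    · refine (V.le_opNorm₂ _ _).trans ?_
      rw [mul_assoc, mul_assoc, mul_comm ‖u - w‖]
      gcongr
  have key := ODE_solution_unique_of_mem_Icc_right (v := fun _ u => V u u)
    (s := fun _ => closedBall (0 : E) R) (f := F) (g := G) (a := 0) (b := s)
    (fun t _ => hlip) cF
    (fun t ht => (hF t ht.1).mono (Set.Ici_subset_Ici.2 ht.1))
    (fun t ht => mem_closedBall_zero_iff.2 ((hA t ⟨ht.1, ht.2.le⟩).trans (le_max_left _ _))) cG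
    (fun t ht => (hG t ht.1).mono (Set.Ici_subset_Ici.2 ht.1))
    (fun t ht => mem_closedBall_zero_iff.2 ((hB t ⟨ht.1, ht.2.le⟩).trans (le_max_right _ _))) h0
  exact key ⟨hs, le_rfl⟩

/-- Mass functional. -/
def massL : EE →L[ℝ] ℝ := L1.integralCLM

lemma massL_eq (f : EE) : massL f = ∫ p, f p := by
  rw [massL, ← L1.integral_eq, L1.integral_eq_integral]

/-- The right hand side as a bilinear map. -/
def Vop (Γ : EE →L[ℝ] EE →L[ℝ] EE) (lam : ℝ) : EE →L[ℝ] EE →L[ℝ] EE :=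
  Γ - lam • massL.smulRight (ContinuousLinearMap.id ℝ EE)

lemma Vop_apply (Γ : EE →L[ℝ] EE →L[ℝ] EE) (lam : ℝ) (f g : EE) :
    Vop Γ lam f g = Γ f g - (lam * massL f) • g := by
  simp [Vop, mul_smul]

variable {C₁ b ε : ℝ}

lemma Gam_pos (hC : 0 < C₁) (hb1 : 1 < b) (hε : 0 < ε) {Γ : EE →L[ℝ] EE →L[ℝ] EE}
    (hΓ : ∀ f g : EE, ⇑(Γ f g) =ᵐ[volume] Gfun C₁ b ε (tfun f g)) {f g : EE}
    (hf : 0 ≤ f) (hg : 0 ≤ g) : 0 ≤ Γ f g := by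
  rw [← Lp.coeFn_nonneg] at hf hg ⊢
  have h1 : tfun f g =ᵐ[muP] tfun (fun p => |f p|) (fun p => |g p|) := by
    refine tfun_congr ?_ ?_
    · filter_upwards [hf] with p hp
      exact (abs_of_nonneg hp).symm
    · filter_upwards [hg] with p hp
      exact (abs_of_nonneg hp).symm
  filter_upwards [hΓ f g, Gfun_congr (C₁ := C₁) hb1 hε h1] with p hp1 hp2
  rw [hp1, hp2]
  exact integral_nonneg fun z => Kop_nonneg hC hb1 hε
    (fun x => mul_nonneg (abs_nonneg _) (abs_nonneg _)) _

lemma Gam_mass (hb1 : 1 < b) (hε : 0 < ε) {Γ : EE →L[ℝ] EE →L[ℝ] EE}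
    (hΓ : ∀ f g : EE, ⇑(Γ f g) =ᵐ[volume] Gfun C₁ b ε (tfun f g)) (f g : EE) :
    massL (Γ f g) = lamC C₁ b ε * massL f * massL g := by
  rw [massL_eq, massL_eq, massL_eq, integral_congr_ae (hΓ f g)]
  have hH := tfun_int (EE_int f) (EE_int g)
  have h := Gfun_weight (C₁ := C₁) hb1 hε hH (fun _ => 1) measurable_const 1 (by simp)
  simp only [mul_one] at h
  rw [h, integral_Kop hb1 hε hH]
  have := integral_prod_mul (μ := (volume : Measure R3)) (ν := (volume : Measure R3)) f g
  unfold tfun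
  rw [this, mul_assoc]

lemma norm_eq_mass {f : EE} (hf : 0 ≤ f) : ‖f‖ = massL f := by
  rw [← Lp.coeFn_nonneg] at hf
  rw [massL_eq, L1.norm_eq_integral_norm]
  refine integral_congr_ae ?_
  filter_upwards [hf] with p hp
  exact Real.norm_of_nonneg hp

lemma Vop_Qcoll (hb1 : 1 < b) (hε : 0 < ε) {Γ : EE →L[ℝ] EE →L[ℝ] EE}
    (hΓ : ∀ f g : EE, ⇑(Γ f g) =ᵐ[volume] Gfun C₁ b ε (tfun f g)) (f : EE) :
    ⇑(Vop Γ (lamC C₁ b ε) f f) =ᵐ[volume] Qcoll C₁ b ε f := by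
  rw [Vop_apply]
  filter_upwards [Lp.coeFn_sub (Γ f f) ((lamC C₁ b ε * massL f) • f),
    Lp.coeFn_smul (lamC C₁ b ε * massL f) f, hΓ f f, Qcoll_eq (C₁ := C₁) hb1 hε (EE_int f)]
    with p h1 h2 h3 h4
  rw [h1, h4, Pi.sub_apply, h2, h3, massL_eq, Pi.smul_apply, smul_eq_mul]

lemma sol_deriv (hb1 : 1 < b) (hε : 0 < ε) {Γ : EE →L[ℝ] EE →L[ℝ] EE}
    (hΓ : ∀ f g : EE, ⇑(Γ f g) =ᵐ[volume] Gfun C₁ b ε (tfun f g)) {f₀ : R3 → ℝ} {F : ℝ → EE}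
    (h : IsSolOn C₁ b ε f₀ F (Set.Ici 0)) (s : ℝ) (hs : s ∈ Set.Ici (0 : ℝ)) :
    HasDerivWithinAt F (Vop Γ (lamC C₁ b ε) (F s) (F s)) (Set.Ici 0) s := by
  obtain ⟨-, F', -, h1, h2⟩ := h
  have : F' s = Vop Γ (lamC C₁ b ε) (F s) (F s) :=
    Lp.ext ((h2 s hs).trans (Vop_Qcoll hb1 hε hΓ (F s)).symm)
  rw [← this]
  exact h1 s hs

/-- Existence within an invariant cone. -/
lemma sol_exists (hC : 0 < C₁) (hb1 : 1 < b) (hε : 0 < ε) {Γ : EE →L[ℝ] EE →L[ℝ] EE}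
    (hΓ : ∀ f g : EE, ⇑(Γ f g) =ᵐ[volume] Gfun C₁ b ε (tfun f g))
    (S : Submodule ℝ EE) (hS : IsClosed (S : Set EE))
    (hSΓ : ∀ f ∈ S, ∀ g ∈ S, Γ f g ∈ S) (f0 : EE) (hf0 : f0 ∈ S) (hpos : 0 ≤ f0) :
    ∃ F : ℝ → EE, F 0 = f0 ∧ (∀ t ≥ 0, 0 ≤ F t ∧ F t ∈ S) ∧ (∀ t ≥ 0, massL (F t) = massL f0) ∧
      ∀ t, 0 ≤ t → HasDerivAt F (Vop Γ (lamC C₁ b ε) (F t) (F t)) t := by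
  obtain ⟨F, h0, hK, hm, hd⟩ := wild_existence Γ massL (lamC C₁ b ε) (lamC_pos hC hε)
    ({f : EE | 0 ≤ f} ∩ S) (isClosed_nonneg.inter hS) ⟨(le_refl (0 : EE) : (0 : EE) ≤ 0), S.zero_mem⟩
    (fun f hf g hg => ⟨(add_nonneg hf.1 hg.1 : (0 : EE) ≤ f + g), S.add_mem hf.2 hg.2⟩)
    (fun c hc f hf => ⟨by
      have h1 := (Lp.coeFn_nonneg f).2 hf.1
      refine (Lp.coeFn_nonneg _).1 ?_
      filter_upwards [h1, Lp.coeFn_smul c f] with p hp1 hp2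
      rw [hp2]
      exact mul_nonneg hc hp1, S.smul_mem c hf.2⟩)
    (fun f hf g hg => ⟨Gam_pos hC hb1 hε hΓ hf.1 hg.1, hSΓ f hf.2 g hg.2⟩)
    (fun f hf g hg => Gam_mass hb1 hε hΓ f g) (fun f hf => norm_eq_mass hf.1) f0 ⟨hpos, hf0⟩
  refine ⟨F, h0, fun t ht => hK t ht, hm, fun t ht => ?_⟩
  rw [Vop_apply, hm t ht]
  exact hd t ht

lemma part_one (hC : 0 < C₁) (hb1 : 1 < b) (hε : 0 < ε)
    (f₀ : R3 → ℝ) (hint : Integrable f₀) (hpos : ∀ᵐ p : R3, 0 ≤ f₀ p) :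
    ∃ F : ℝ → Lp ℝ 1 (volume : Measure R3),
        IsSolOn C₁ b ε f₀ F (Set.Ici 0) ∧
        (∀ s : ℝ, 0 ≤ s → ∀ᵐ p : R3, 0 ≤ F s p) ∧
        (∀ G : ℝ → Lp ℝ 1 (volume : Measure R3),
          IsSolOn C₁ b ε f₀ G (Set.Ici 0) → ∀ s : ℝ, 0 ≤ s → G s = F s) := by
  obtain ⟨Γ, hΓ⟩ := exists_Gamma hC hb1 hε
  have h1 : ⇑(hint.toL1 f₀) =ᵐ[volume] f₀ := hint.coeFn_toL1
  obtain ⟨F, h0, hK, -, hd⟩ := sol_exists hC hb1 hε hΓ ⊤ isClosed_univ (fun _ _ _ _ => trivial)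
    (hint.toL1 f₀) trivial ((Lp.coeFn_nonneg _).1 (by
      filter_upwards [h1, hpos] with p hp1 hp2
      rw [hp1]; exact hp2))
  have hd' : ∀ s ∈ Set.Ici (0 : ℝ),
      HasDerivWithinAt F (Vop Γ (lamC C₁ b ε) (F s) (F s)) (Set.Ici 0) s :=
    fun s hs => (hd s hs).hasDerivWithinAt
  refine ⟨F, ⟨by rw [h0]; exact h1, fun s => Vop Γ (lamC C₁ b ε) (F s) (F s), ?_, hd',
    fun s _ => Vop_Qcoll hb1 hε hΓ (F s)⟩, fun s hs => (Lp.coeFn_nonneg _).2 (hK s hs).1, ?_⟩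
  · have cF : ContinuousOn F (Set.Ici 0) := fun s hs => (hd' s hs).continuousWithinAt
    exact ((Vop Γ (lamC C₁ b ε)).continuous.comp_continuousOn cF).clm_apply cF
  · intro G hG s hs
    refine bilin_unique (Vop Γ (lamC C₁ b ε)) ?_ (sol_deriv hb1 hε hΓ hG) hd' s hs
    rw [h0]
    exact Lp.ext (hG.1.trans h1.symm)

end Existence

end

section


section Radial

open scoped ENNReal

/-- Rotation of the sphere. -/
def rotS (R : R3 ≃ₗᵢ[ℝ] R3) : sphere (0 : R3) 1 ≃ᵐ sphere (0 : R3) 1 where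
  toFun ω := ⟨R ω, by simp⟩
  invFun ω := ⟨R.symm ω, by simp⟩
  left_inv ω := by simp
  right_inv ω := by simp
  measurable_toFun := (R.continuous.measurable.comp measurable_subtype_coe).subtype_mk
  measurable_invFun := (R.symm.continuous.measurable.comp measurable_subtype_coe).subtype_mk

lemma rotS_coe (R : R3 ≃ₗᵢ[ℝ] R3) (ω : sphere (0 : R3) 1) : ((rotS R ω : sphere (0 : R3) 1) : R3) = R ω := rfl

lemma rotS_mp (R : R3 ≃ₗᵢ[ℝ] R3) : MeasurePreserving (rotS R) sphMeasure sphMeasure := by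
  refine ⟨(rotS R).measurable, Measure.ext fun A hA => ?_⟩
  rw [Measure.map_apply (rotS R).measurable hA]
  have hE : MeasurableEmbedding (Subtype.val : sphere (0 : R3) 1 → R3) :=
    MeasurableEmbedding.subtype_coe isClosed_sphere.measurableSet
  have hA' : MeasurableSet (Subtype.val '' A : Set R3) := hE.measurableSet_image.2 hA
  have h := sphere_rot R ((Subtype.val '' A : Set R3).indicator 1) (measurable_one.indicator hA')
  have e1 : ∀ ω : sphere (0 : R3) 1, (Subtype.val '' A : Set R3).indicator (1 : R3 → ℝ≥0∞) ω
      = A.indicator 1 ω := by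
    intro ω
    by_cases h : ω ∈ A <;> simp [Set.indicator, h]
  have e2 : ∀ ω : sphere (0 : R3) 1, (Subtype.val '' A : Set R3).indicator (1 : R3 → ℝ≥0∞) (R ω)
      = (rotS R ⁻¹' A).indicator 1 ω := by
    intro ω
    rw [← rotS_coe, e1]
    rfl
  simp only [e1, e2] at h
  rwa [lintegral_indicator_one hA, lintegral_indicator_one ((rotS R).measurable hA)] at h

lemma relMom_rot (R : R3 ≃ₗᵢ[ℝ] R3) (p q : R3) : relMom (R p) (R q) = relMom p q := by
  unfold relMom
  rw [R.inner_map_map, R.norm_map, R.norm_map]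

lemma pPost_rot (R : R3 ≃ₗᵢ[ℝ] R3) (p q ω : R3) :
    pPost (R p) (R q) (R ω) = R (pPost p q ω) := by
  unfold pPost
  rw [relMom_rot, ← map_add, R.inner_map_map, R.norm_map, R.norm_map]
  simp only [map_add, map_smul]

lemma qPost_rot (R : R3 ≃ₗᵢ[ℝ] R3) (p q ω : R3) :
    qPost (R p) (R q) (R ω) = R (qPost p q ω) := by
  rw [qPost_eq, qPost_eq, pPost_rot, map_sub, map_add]

lemma Bk_rot (b ε : ℝ) (R : R3 ≃ₗᵢ[ℝ] R3) (p q : R3) : Bk b ε (R p) (R q) = Bk b ε p q := by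
  unfold Bk
  rw [relMom_rot, R.norm_map, R.norm_map]

/-- Radial functions. -/
def RadF (u : R3 → ℝ) : Prop := ∀ p q : R3, ‖p‖ = ‖q‖ → u p = u q

lemma Gfun_rad (C₁ b ε : ℝ) {f g : R3 → ℝ} (hf : RadF f) (hg : RadF g) :
    RadF (Gfun C₁ b ε (tfun f g)) := by
  intro p q hpq
  obtain ⟨R, hR⟩ : ∃ R : R3 ≃ₗᵢ[ℝ] R3, R p = q :=
    ⟨_, Submodule.reflection_sub hpq⟩
  have mp : MeasurePreserving (MeasurableEquiv.prodCongr R.toMeasurableEquiv (rotS R)) muZ muZ :=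
    R.measurePreserving.prod (rotS_mp R)
  unfold Gfun
  rw [← hR]
  symm
  rw [← mp.integral_comp']
  refine integral_congr_ae (Filter.Eventually.of_forall fun z => ?_)
  have e : MeasurableEquiv.prodCongr R.toMeasurableEquiv (rotS R) z = (R z.1, rotS R z.2) := rfl
  simp only [e, Kop, preX, postX, tfun, rotS_coe, Bk_rot, pPost_rot, qPost_rot]
  rw [hf (R (pPost p z.1 z.2)) (pPost p z.1 z.2) (R.norm_map _),
    hg (R (qPost p z.1 z.2)) (qPost p z.1 z.2) (R.norm_map _), hf (R p) p (R.norm_map _),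
    hg (R z.1) z.1 (R.norm_map _)]

lemma measurable_radmap : Measurable (fun x : R3 × sphere (0 : R3) 1 => ‖x.1‖ • (x.2 : R3)) := by
  fun_prop

lemma map_rad : Measure.map (fun x : R3 × sphere (0 : R3) 1 => ‖x.1‖ • (x.2 : R3)) muZ
    = sphMeasure Set.univ • volume := by
  refine Measure.ext_of_lintegral _ fun F hF => ?_
  have hc : Measurable (fun x : R3 × sphere (0 : R3) 1 => F (‖x.1‖ • (x.2 : R3))) :=
    hF.comp measurable_radmap
  rw [lintegral_map hF measurable_radmap, lintegral_smul_measure,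
    lintegral_prod _ hc.aemeasurable]
  have hm : Measurable (fun p : R3 => ∫⁻ ω : sphere (0 : R3) 1, F (‖p‖ • (ω : R3)) ∂sphMeasure) :=
    hc.lintegral_prod_right'
  rw [lintegral_polar _ hm, lintegral_polar F hF]
  have e : ∀ ω : sphere (0 : R3) 1, ∫⁻ r in Set.Ioi (0 : ℝ), ENNReal.ofReal (r ^ 2) *
      (∫⁻ ω' : sphere (0 : R3) 1, F (‖r • (ω : R3)‖ • (ω' : R3)) ∂sphMeasure)
      = ∫⁻ r in Set.Ioi (0 : ℝ), ∫⁻ ω' : sphere (0 : R3) 1, ENNReal.ofReal (r ^ 2) *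
        F (r • (ω' : R3)) ∂sphMeasure := by
    intro ω
    refine setLIntegral_congr_fun measurableSet_Ioi fun r hr => ?_
    have hr' : ‖r • (ω : R3)‖ = r := by
      rw [norm_smul, Real.norm_of_nonneg (le_of_lt hr)]
      simp
    simp only [hr']
    rw [lintegral_const_mul]
    have : Measurable (fun ω' : sphere (0 : R3) 1 => r • (ω' : R3)) := by fun_prop
    exact hF.comp this
  simp only [e]
  rw [lintegral_const, mul_comm, smul_eq_mul]
  congr 1
  rw [lintegral_lintegral_swap]
  have : Measurable (fun x : ℝ × sphere (0 : R3) 1 => x.1 • (x.2 : R3)) := by fun_prop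
  exact ((by fun_prop : Measurable fun x : ℝ × sphere (0 : R3) 1 =>
    ENNReal.ofReal (x.1 ^ 2)).mul (hF.comp this)).aemeasurable

/-- Spherical average. -/
def Afun (f : R3 → ℝ) (p : R3) : ℝ :=
  (sphMeasure.real Set.univ)⁻¹ * ∫ ω : sphere (0 : R3) 1, f (‖p‖ • (ω : R3)) ∂sphMeasure

lemma Afun_rad (f : R3 → ℝ) : RadF (Afun f) := by
  intro p q h
  unfold Afun
  rw [h]

lemma Afun_of_rad {f : R3 → ℝ} (hf : RadF f) : Afun f = f := by
  funext p
  unfold Afun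
  have : ∀ ω : sphere (0 : R3) 1, f (‖p‖ • (ω : R3)) = f p := by
    intro ω
    apply hf
    rw [norm_smul]
    simp
  simp only [this, integral_const, smul_eq_mul]
  have := sph_real_pos
  field_simp

lemma rad_int {f : R3 → ℝ} (hf : Integrable f) :
    Integrable (fun x : R3 × sphere (0 : R3) 1 => f (‖x.1‖ • (x.2 : R3))) muZ := by
  have h : Integrable f (sphMeasure Set.univ • volume) := hf.smul_measure (measure_ne_top _ _)
  rw [← map_rad] at h
  exact h.comp_measurable measurable_radmap

lemma rad_integral {f : R3 → ℝ} (hf : Integrable f) :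
    ∫ x : R3 × sphere (0 : R3) 1, f (‖x.1‖ • (x.2 : R3)) ∂muZ
      = sphMeasure.real Set.univ * ∫ p, f p := by
  have h : Integrable f (sphMeasure Set.univ • volume) := hf.smul_measure (measure_ne_top _ _)
  rw [← map_rad] at h
  rw [← integral_map measurable_radmap.aemeasurable h.1, map_rad, integral_smul_measure]
  rfl

lemma Afun_congr {f g : R3 → ℝ} (h : f =ᵐ[volume] g) : Afun f =ᵐ[volume] Afun g := by
  have h1 : ∀ᵐ y ∂(sphMeasure Set.univ • (volume : Measure R3)), f y = g y :=
    Measure.ae_smul_measure h _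
  rw [← map_rad] at h1
  have h2 := ae_of_ae_map measurable_radmap.aemeasurable h1
  filter_upwards [Measure.ae_ae_of_ae_prod h2] with p hp
  unfold Afun
  congr 1
  exact integral_congr_ae hp

lemma exists_Aop : ∃ L : EE →L[ℝ] EE, ∀ f : EE, ⇑(L f) =ᵐ[volume] Afun f := by
  refine mkL1 Afun 1 ?_ (fun f g => Afun_congr) ?_ ?_ ?_
  · intro f hf
    exact (rad_int hf).integral_prod_left.const_mul _
  · intro f g hf hg
    filter_upwards [(rad_int hf).prod_right_ae, (rad_int hg).prod_right_ae] with p h1 h2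
    rw [Pi.add_apply]
    unfold Afun
    rw [← mul_add, ← integral_add h1 h2]
    rfl
  · intro c f hf
    refine Filter.Eventually.of_forall fun p => ?_
    rw [Pi.smul_apply, smul_eq_mul]
    unfold Afun
    simp only [Pi.smul_apply, smul_eq_mul]
    rw [integral_const_mul]
    ring
  · intro f hf
    have h1 := rad_int hf
    have hs := sph_real_pos
    calc ∫ p, ‖Afun f p‖ ≤ ∫ p, (sphMeasure.real Set.univ)⁻¹ *
          ∫ ω : sphere (0 : R3) 1, ‖f (‖p‖ • (ω : R3))‖ ∂sphMeasure := by
          refine integral_mono (h1.integral_prod_left.const_mul _).norm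
            (h1.norm.integral_prod_left.const_mul _) fun p => ?_
          unfold Afun
          rw [norm_mul, Real.norm_of_nonneg (inv_nonneg.2 hs.le)]
          gcongr
          exact norm_integral_le_integral_norm _
      _ = (sphMeasure.real Set.univ)⁻¹ * ∫ x : R3 × sphere (0 : R3) 1,
            ‖f (‖x.1‖ • (x.2 : R3))‖ ∂muZ := by
          rw [integral_const_mul, integral_prod _ h1.norm]
      _ = _ := by
          rw [rad_integral hf.norm]
          field_simp
    

/-- Radial elements. -/
lemma exists_rad_submodule : ∃ S : Submodule ℝ EE, IsClosed (S : Set EE) ∧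
    ∀ f : EE, f ∈ S ↔ ⇑f =ᵐ[volume] Afun f := by
  obtain ⟨L, hL⟩ := exists_Aop
  refine ⟨LinearMap.ker (L - ContinuousLinearMap.id ℝ EE).toLinearMap,
    (L - ContinuousLinearMap.id ℝ EE).isClosed_ker, fun f => ?_⟩
  rw [LinearMap.mem_ker]
  have : (L - ContinuousLinearMap.id ℝ EE).toLinearMap f = L f - f := rfl
  rw [this, sub_eq_zero]
  constructor
  · intro h
    have := hL f
    rwa [h] at this
  · intro h
    exact Lp.ext ((hL f).trans h.symm)

lemma rad_mem_iff_of_ae {f : R3 → ℝ} {u : R3 → ℝ} (hu : RadF u) (h : f =ᵐ[volume] u) :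
    f =ᵐ[volume] Afun f := by
  refine h.trans ?_
  have := Afun_congr h
  rw [Afun_of_rad hu] at this
  exact this.symm

lemma Gam_rad {C₁ b ε : ℝ} (hb1 : 1 < b) (hε : 0 < ε) {Γ : EE →L[ℝ] EE →L[ℝ] EE}
    (hΓ : ∀ f g : EE, ⇑(Γ f g) =ᵐ[volume] Gfun C₁ b ε (tfun f g)) {f g : EE}
    (hf : ⇑f =ᵐ[volume] Afun f) (hg : ⇑g =ᵐ[volume] Afun g) :
    ⇑(Γ f g) =ᵐ[volume] Afun (Γ f g) :=
  rad_mem_iff_of_ae (Gfun_rad C₁ b ε (Afun_rad f) (Afun_rad g))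
    ((hΓ f g).trans (Gfun_congr hb1 hε (tfun_congr hf hg)))

end Radial

end

section


section Moments

open scoped ENNReal

/-- Moment weight. -/
def phi (p : R3) : ℝ := 1 / ‖p‖ ^ 2 + ‖p‖ ^ 2

/-- Truncated moment weight. -/
def phik (k : ℝ) (p : R3) : ℝ := min (phi p) k

lemma phi_nonneg (p : R3) : 0 ≤ phi p := by unfold phi; positivity

lemma phik_nonneg {k : ℝ} (hk : 0 ≤ k) (p : R3) : 0 ≤ phik k p := le_min (phi_nonneg p) hk

lemma measurable_phi : Measurable phi := by unfold phi; fun_prop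

lemma measurable_phik (k : ℝ) : Measurable (phik k) := measurable_phi.min measurable_const

lemma rpow_le_phi' {r : ℝ} (hr : 0 < r) {m : ℝ} (h1 : -2 ≤ m) (h2 : m ≤ 2) :
    r ^ m ≤ 1 / r ^ 2 + r ^ 2 := by
  have e1 : r ^ (-2 : ℝ) = 1 / r ^ 2 := by
    rw [Real.rpow_neg hr.le, one_div]
    norm_cast
  have e2 : r ^ (2 : ℝ) = r ^ 2 := by norm_cast
  have p1 : 0 < 1 / r ^ 2 := by positivity
  have p2 : 0 < r ^ 2 := by positivity
  rcases le_total 1 r with h | h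
  · have := Real.rpow_le_rpow_of_exponent_le h h2
    rw [e2] at this
    linarith
  · have := Real.rpow_le_rpow_of_exponent_ge hr h h1
    rw [e1] at this
    linarith

lemma rpow_le_phi {p : R3} (hp : p ≠ 0) {m : ℝ} (h1 : -2 ≤ m) (h2 : m ≤ 2) :
    ‖p‖ ^ m ≤ phi p := rpow_le_phi' (norm_pos_iff.2 hp) h1 h2

lemma gain_le {b ε : ℝ} (u : R3 → ℝ≥0∞) (hu : Measurable u)
    (ψ : R3 → ℝ) (hψ : Measurable ψ) (W : R3 → R3 → ℝ≥0∞)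
    (hW : ∀ p q, ε ≤ relMom p q →
      ∫⁻ ω : sphere (0 : R3) 1, ENNReal.ofReal (ψ (pPost p q ω)) ∂sphMeasure ≤ W p q) :
    ∫⁻ x, ENNReal.ofReal (Bk b ε x.1 x.2.1) * (u x.1 * u x.2.1 * ENNReal.ofReal (ψ (postX x).1)) ∂muX
      ≤ ∫⁻ p, ∫⁻ q, ENNReal.ofReal (Bk b ε p q) * (u p * u q * W p q) := by
  have hψ' : Measurable (fun x : XX => ENNReal.ofReal (ψ (postX x).1)) :=
    (hψ.comp (measurable_fst.comp measurable_postX)).ennreal_ofReal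
  have hu1 : Measurable (fun x : XX => u x.1) := hu.comp measurable_fst
  have hu2 : Measurable (fun x : XX => u x.2.1) := hu.comp (measurable_fst.comp measurable_snd)
  have hall : Measurable (fun x : XX => ENNReal.ofReal (Bk b ε x.1 x.2.1) *
      (u x.1 * u x.2.1 * ENNReal.ofReal (ψ (postX x).1))) :=
    (measurable_oBk b ε).mul ((hu1.mul hu2).mul hψ')
  rw [lintegral_muX _ hall]
  refine lintegral_mono fun p => lintegral_mono fun q => ?_
  have hψ3 : Measurable (fun ω : sphere (0 : R3) 1 => ENNReal.ofReal (ψ (postX (p, q, ω)).1)) := by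
    have : Measurable (fun ω : sphere (0 : R3) 1 => ((p, q, ω) : XX)) := by fun_prop
    exact hψ'.comp this
  simp only
  rw [lintegral_const_mul _ (hψ3.const_mul _), lintegral_const_mul _ hψ3]
  by_cases h : ε ≤ relMom p q
  · gcongr
    exact hW p q h
  · simp [Bk, h]

lemma sph_ofReal : sphMeasure Set.univ = ENNReal.ofReal (sphMeasure.real Set.univ) := by
  simp [Measure.real]

lemma phik_post {k : ℝ} (hk : 0 ≤ k) (p q ω : R3) (h : 0 < relMom p q) (hω : ‖ω‖ = 1) :
    phik k (pPost p q ω) ≤ 1 / ‖pPost p q ω‖ ^ 2 + (2 * phik k p + 2 * phik k q) := by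
  have h1 := norm_pPost_le p q ω h hω
  have hp : ‖p‖ ^ 2 ≤ phi p := by unfold phi; have : 0 ≤ 1 / ‖p‖ ^ 2 := by positivity
                                  linarith
  have hq : ‖q‖ ^ 2 ≤ phi q := by unfold phi; have : 0 ≤ 1 / ‖q‖ ^ 2 := by positivity
                                  linarith
  have h2 : ‖pPost p q ω‖ ^ 2 ≤ 2 * ‖p‖ ^ 2 + 2 * ‖q‖ ^ 2 := by
    nlinarith [norm_nonneg (pPost p q ω), norm_nonneg p, norm_nonneg q, sq_nonneg (‖p‖ - ‖q‖)]
  have h3 : 0 ≤ 1 / ‖pPost p q ω‖ ^ 2 := by positivity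
  have h4 := phik_nonneg hk p
  have h5 := phik_nonneg hk q
  unfold phik at *
  rcases le_total (phi p) k with a | a
  · rcases le_total (phi q) k with c | c
    · rw [min_eq_left a, min_eq_left c]
      refine (min_le_left _ _).trans ?_
      unfold phi at *
      linarith
    · rw [min_eq_right c] at *
      refine (min_le_right _ _).trans ?_
      linarith
  · rw [min_eq_right a] at *
    refine (min_le_right _ _).trans ?_
    linarith

lemma measurable_inv_post (p q : R3) : Measurable (fun ω : sphere (0 : R3) 1 =>
    ENNReal.ofReal (1 / ‖pPost p q ω‖ ^ 2)) := by
  unfold pPost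
  fun_prop

lemma post_avg_k {k : ℝ} (hk : 0 ≤ k) (p q : R3) (h : 0 < relMom p q) :
    ∫⁻ ω : sphere (0 : R3) 1, ENNReal.ofReal (phik k (pPost p q ω)) ∂sphMeasure
      ≤ ENNReal.ofReal (16 * π / relMom p q ^ 2)
        + sphMeasure Set.univ * ENNReal.ofReal (2 * phik k p + 2 * phik k q) := by
  rw [← inv_sq_avg p q h, mul_comm, ← lintegral_const, ← lintegral_add_left (measurable_inv_post p q)]
  refine lintegral_mono fun ω => ?_
  rw [← ENNReal.ofReal_add (by positivity) (by
    have := phik_nonneg hk p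
    have := phik_nonneg hk q
    positivity)]
  exact ENNReal.ofReal_le_ofReal (phik_post hk p q ω h (by simp))

lemma post_avg (p q : R3) (h : 0 < relMom p q) :
    ∫⁻ ω : sphere (0 : R3) 1, ENNReal.ofReal (phi (pPost p q ω)) ∂sphMeasure
      ≤ ENNReal.ofReal (16 * π / relMom p q ^ 2)
        + sphMeasure Set.univ * ENNReal.ofReal ((‖p‖ + ‖q‖) ^ 2) := by
  rw [← inv_sq_avg p q h, mul_comm, ← lintegral_const, ← lintegral_add_left (measurable_inv_post p q)]
  refine lintegral_mono fun ω => ?_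
  rw [← ENNReal.ofReal_add (by positivity) (by positivity)]
  refine ENNReal.ofReal_le_ofReal ?_
  have := norm_pPost_le p q ω h (by simp)
  unfold phi
  gcongr

lemma dbl (u v : R3 → ℝ≥0∞) (hv : Measurable v) (hu : Measurable u) :
    ∫⁻ p, ∫⁻ q, u p * v q = (∫⁻ p, u p) * ∫⁻ q, v q := by
  rw [← lintegral_mul_const _ hu]
  refine lintegral_congr fun p => ?_
  rw [lintegral_const_mul _ hv]

lemma gain_a {b ε : ℝ} (hb1 : 1 < b) (hε : 0 < ε) : ∃ c : ℝ, 0 ≤ c ∧ ∀ k : ℝ, 0 ≤ k →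
    ∀ u : R3 → ℝ≥0∞, Measurable u →
    ∫⁻ x, ENNReal.ofReal (Bk b ε x.1 x.2.1) *
      (u x.1 * u x.2.1 * ENNReal.ofReal (phik k (postX x).1)) ∂muX
      ≤ ENNReal.ofReal c * ((∫⁻ p, u p) * (∫⁻ p, u p) +
        (∫⁻ p, u p) * ∫⁻ p, u p * ENNReal.ofReal (phik k p)) := by
  set s := sphMeasure.real Set.univ with hs
  have hs0 : 0 < s := sph_real_pos
  set A := 16 * π / ε ^ 2 with hA
  have hA0 : 0 < A := by positivity
  set B := 4 * ε ^ (-b) with hB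
  have hB0 : 0 < B := by positivity
  refine ⟨B * (A + 4 * s), by positivity, fun k hk u hu => ?_⟩
  have hφ : Measurable (fun p => u p * ENNReal.ofReal (phik k p)) :=
    hu.mul (measurable_phik k).ennreal_ofReal
  have step := gain_le (b := b) (ε := ε) u hu (phik k) (measurable_phik k)
    (fun p q => ENNReal.ofReal A + ENNReal.ofReal s * ENNReal.ofReal (2 * phik k p + 2 * phik k q))
    (by
      intro p q hr
      refine (post_avg_k hk p q (hε.trans_le hr)).trans ?_
      rw [sph_ofReal, hA]
      gcongr)
  refine step.trans ?_
  set m := ∫⁻ p, u p with hm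
  set M := ∫⁻ p, u p * ENNReal.ofReal (phik k p) with hM
  have point : ∀ p q : R3, ENNReal.ofReal (Bk b ε p q) * (u p * u q *
      (ENNReal.ofReal A + ENNReal.ofReal s * ENNReal.ofReal (2 * phik k p + 2 * phik k q)))
      ≤ ENNReal.ofReal (B * A) * (u p * u q) + (ENNReal.ofReal (B * (2 * s)) *
        (u p * ENNReal.ofReal (phik k p)) * u q + ENNReal.ofReal (B * (2 * s)) * u p *
          (u q * ENNReal.ofReal (phik k q))) := by
    intro p q
    have h1 : ENNReal.ofReal (Bk b ε p q) ≤ ENNReal.ofReal B :=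
      ENNReal.ofReal_le_ofReal (Bk_le hb1 hε p q)
    have np := phik_nonneg hk p
    have nq := phik_nonneg hk q
    have e2 : ENNReal.ofReal 2 = 2 := by simp
    calc _ ≤ ENNReal.ofReal B * (u p * u q *
      (ENNReal.ofReal A + ENNReal.ofReal s * ENNReal.ofReal (2 * phik k p + 2 * phik k q))) := by gcongr
      _ = _ := by
        rw [ENNReal.ofReal_add (by positivity) (by positivity), ENNReal.ofReal_mul hB0.le,
          ENNReal.ofReal_mul hB0.le, ENNReal.ofReal_mul zero_le_two, ENNReal.ofReal_mul zero_le_two,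
          ENNReal.ofReal_mul zero_le_two]
        ring
  refine (lintegral_mono fun p => lintegral_mono fun q => point p q).trans ?_
  have key : ∀ p, ∫⁻ q, (ENNReal.ofReal (B * A) * (u p * u q) + (ENNReal.ofReal (B * (2 * s)) *
        (u p * ENNReal.ofReal (phik k p)) * u q + ENNReal.ofReal (B * (2 * s)) * u p *
          (u q * ENNReal.ofReal (phik k q)))) =
      u p * (ENNReal.ofReal (B * A) * m + ENNReal.ofReal (B * (2 * s)) * M)
        + (u p * ENNReal.ofReal (phik k p)) * (ENNReal.ofReal (B * (2 * s)) * m) := by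
    intro p
    rw [lintegral_add_left ((hu.const_mul _).const_mul _), lintegral_add_left (hu.const_mul _),
      lintegral_const_mul _ (hu.const_mul _), lintegral_const_mul _ hu, lintegral_const_mul _ hu,
      lintegral_const_mul _ hφ]
    ring
  simp only [key]
  rw [lintegral_add_left (hu.mul_const _), lintegral_mul_const _ hu, lintegral_mul_const _ hφ]
  rw [← hm, ← hM]
  have e : ENNReal.ofReal (B * (A + 4 * s)) = ENNReal.ofReal (B * A)
      + (ENNReal.ofReal (B * (2 * s)) + ENNReal.ofReal (B * (2 * s))) := by
    rw [← ENNReal.ofReal_add (by positivity) (by positivity),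
      ← ENNReal.ofReal_add (by positivity) (by positivity)]
    congr 1
    ring
  rw [e]
  set a' := ENNReal.ofReal (B * A)
  set s' := ENNReal.ofReal (B * (2 * s))
  have : (a' + (s' + s')) * (m * m + m * M) = m * (a' * m + s' * M) + M * (s' * m) +
    (a' * m * M + (s' + s') * m * m) := by ring
  rw [this]
  exact le_self_add

end Moments

end

section


section Moments2

open scoped ENNReal

lemma rad_lint (F : R3 → ℝ≥0∞) (hF : Measurable F) :
    ∫⁻ q : R3, ∫⁻ ω : sphere (0 : R3) 1, F (‖q‖ • (ω : R3)) ∂sphMeasure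
      = sphMeasure Set.univ * ∫⁻ q, F q := by
  have hc : Measurable (fun x : R3 × sphere (0 : R3) 1 => F (‖x.1‖ • (x.2 : R3))) :=
    hF.comp measurable_radmap
  have h := lintegral_map hF measurable_radmap (μ := muZ)
  rw [map_rad, lintegral_smul_measure, lintegral_prod _ hc.aemeasurable] at h
  exact h.symm

lemma relMom_rpow_rad {b : ℝ} {e : R3} (p q : R3) (hp : p ≠ 0) (hq : q ≠ 0)
    (he : ‖e‖ = 1) (hpe : p = ‖p‖ • e) (ω : R3) (hω : ‖ω‖ = 1) :
    relMom p (‖q‖ • ω) ^ (-b) = (2 * (‖p‖ * ‖q‖)) ^ (-(b / 2)) * (1 - ⟪e, ω⟫) ^ (-(b / 2)) := by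
  have hp' := norm_pos_iff.2 hp
  have hq' := norm_pos_iff.2 hq
  have h1 : 0 ≤ 1 - ⟪e, ω⟫ := by
    have := real_inner_le_norm e ω
    rw [he, hω] at this
    linarith
  have h2 : relMom p (‖q‖ • ω) ^ 2 = 2 * (‖p‖ * ‖q‖) * (1 - ⟪e, ω⟫) := by
    rw [relMom_sq, inner_smul_right, norm_smul, hω, norm_norm]
    have : ⟪p, ω⟫ = ‖p‖ * ⟪e, ω⟫ := by
      conv_lhs => rw [hpe]
      rw [real_inner_smul_left]
    rw [this]
    ring
  rw [← Real.mul_rpow (by positivity) h1, ← h2, ← Real.rpow_natCast,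
    ← Real.rpow_mul (relMom_nonneg _ _)]
  congr 1
  push_cast
  ring

lemma weight_first {b : ℝ} (hb1 : 1 < b) (hb2 : b < 2) : ∃ C : ℝ, 0 ≤ C ∧
    ∀ u : R3 → ℝ≥0∞, Measurable u → (∀ p q : R3, ‖p‖ = ‖q‖ → u p = u q) →
    ∀ p : R3, p ≠ 0 →
    ∫⁻ q, u q * ENNReal.ofReal (16 * π / (‖p‖ * ‖q‖) * relMom p q ^ (-b))
      ≤ ENNReal.ofReal (C * phi p) * ∫⁻ q, u q * ENNReal.ofReal (phi q) := by
  obtain ⟨C, hC0, hC⟩ := angle_avg b hb1 hb2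
  set s := sphMeasure.real Set.univ with hs
  have hs0 : 0 < s := sph_real_pos
  refine ⟨s⁻¹ * (16 * π * C), by positivity, fun u hu hrad p hp => ?_⟩
  have hp' := norm_pos_iff.2 hp
  have hW : Measurable (fun q : R3 =>
      ENNReal.ofReal (16 * π / (‖p‖ * ‖q‖) * relMom p q ^ (-b))) := by
    unfold relMom
    fun_prop
  have hF : Measurable (fun q : R3 => u q * ENNReal.ofReal (16 * π / (‖p‖ * ‖q‖) *
      relMom p q ^ (-b))) := hu.mul hW
  obtain ⟨e, he, hpe⟩ := exists_unit_dir p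
  have main : sphMeasure Set.univ * ∫⁻ q, u q * ENNReal.ofReal (16 * π / (‖p‖ * ‖q‖) *
      relMom p q ^ (-b)) ≤ ENNReal.ofReal (16 * π * C * phi p) *
        ∫⁻ q, u q * ENNReal.ofReal (phi q) := by
    have hφ : Measurable (fun p => u p * ENNReal.ofReal (phi p)) :=
      hu.mul measurable_phi.ennreal_ofReal
    rw [← rad_lint _ hF, ← lintegral_const_mul _ hφ]
    refine lintegral_mono_ae ?_
    filter_upwards [ae_ne_zero] with q hq
    have hq' := norm_pos_iff.2 hq
    have e1 : ∀ ω : sphere (0 : R3) 1, u (‖q‖ • (ω : R3)) *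
        ENNReal.ofReal (16 * π / (‖p‖ * ‖(‖q‖ • (ω : R3))‖) * relMom p (‖q‖ • (ω : R3)) ^ (-b))
        = u q * ENNReal.ofReal (16 * π / (‖p‖ * ‖q‖) * (2 * (‖p‖ * ‖q‖)) ^ (-(b / 2))) *
          ENNReal.ofReal ((1 - ⟪e, (ω : R3)⟫) ^ (-(b / 2))) := by
      intro ω
      have hω : ‖(ω : R3)‖ = 1 := by simp
      have hn : ‖(‖q‖ • (ω : R3))‖ = ‖q‖ := by rw [norm_smul, hω, norm_norm, mul_one]
      rw [hrad _ q hn, hn, relMom_rpow_rad p q hp hq he hpe ω hω, ← mul_assoc,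
        ENNReal.ofReal_mul (by positivity), mul_assoc]
    simp only [e1]
    have hm : Measurable (fun ω : sphere (0 : R3) 1 =>
        ENNReal.ofReal ((1 - ⟪e, (ω : R3)⟫) ^ (-(b / 2)))) := by fun_prop
    rw [lintegral_const_mul _ hm]
    have h3 : (2 * (‖p‖ * ‖q‖)) ^ (-(b / 2)) / (‖p‖ * ‖q‖) ≤ phi p * phi q := by
      have a1 : (2 * (‖p‖ * ‖q‖)) ^ (-(b / 2)) ≤ (‖p‖ * ‖q‖) ^ (-(b / 2)) :=
        Real.rpow_le_rpow_of_nonpos (by positivity) (by nlinarith [mul_pos hp' hq']) (by linarith)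
      have a2 : (‖p‖ * ‖q‖) ^ (-(b / 2)) / (‖p‖ * ‖q‖) = ‖p‖ ^ (-(b / 2) - 1) * ‖q‖ ^ (-(b / 2) - 1) := by
        rw [← Real.mul_rpow hp'.le hq'.le, Real.rpow_sub_one (by positivity)]
      calc _ ≤ (‖p‖ * ‖q‖) ^ (-(b / 2)) / (‖p‖ * ‖q‖) := by gcongr
        _ = _ := a2
        _ ≤ _ := mul_le_mul (rpow_le_phi hp (by linarith) (by linarith))
          (rpow_le_phi hq (by linarith) (by linarith)) (by positivity) (phi_nonneg p)
    calc _ ≤ u q * ENNReal.ofReal (16 * π / (‖p‖ * ‖q‖) * (2 * (‖p‖ * ‖q‖)) ^ (-(b / 2))) *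
          ENNReal.ofReal C := by gcongr; exact hC e he
      _ = u q * ENNReal.ofReal (16 * π * C * ((2 * (‖p‖ * ‖q‖)) ^ (-(b / 2)) / (‖p‖ * ‖q‖))) := by
          rw [mul_assoc, ← ENNReal.ofReal_mul (by positivity)]
          congr 2
          ring
      _ ≤ u q * ENNReal.ofReal (16 * π * C * (phi p * phi q)) := by gcongr
      _ = _ := by
          have := phi_nonneg p
          rw [← mul_assoc (16 * π * C), ENNReal.ofReal_mul (by positivity)]
          ring
  have hσ : ENNReal.ofReal s⁻¹ * sphMeasure Set.univ = 1 := by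
    rw [sph_ofReal, ← hs, ← ENNReal.ofReal_mul (by positivity), inv_mul_cancel₀ hs0.ne',
      ENNReal.ofReal_one]
  calc _ = ENNReal.ofReal s⁻¹ * (sphMeasure Set.univ * ∫⁻ q, u q *
      ENNReal.ofReal (16 * π / (‖p‖ * ‖q‖) * relMom p q ^ (-b))) := by
        rw [← mul_assoc, hσ, one_mul]
    _ ≤ ENNReal.ofReal s⁻¹ * (ENNReal.ofReal (16 * π * C * phi p) *
        ∫⁻ q, u q * ENNReal.ofReal (phi q)) := by gcongr
    _ = _ := by
        rw [← mul_assoc, ← ENNReal.ofReal_mul (by positivity), mul_assoc s⁻¹]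

lemma Bk_first {b ε : ℝ} (hε : 0 < ε) (p q : R3) :
    Bk b ε p q * (16 * π / relMom p q ^ 2) ≤ 16 * π / (‖p‖ * ‖q‖) * relMom p q ^ (-b) := by
  unfold Bk
  split_ifs with h
  · have hr : 0 < relMom p q := hε.trans_le h
    have : relMom p q ^ (2 - b) = relMom p q ^ 2 * relMom p q ^ (-b) := by
      rw [sub_eq_add_neg, Real.rpow_add hr]
      norm_cast
    rw [this]
    apply le_of_eq
    field_simp
  · rw [zero_mul]
    have := relMom_nonneg p q
    positivity

lemma Bk_second {b ε : ℝ} (hb1 : 1 < b) (hb2 : b < 2) (hε : 0 < ε) {p q : R3}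
    (hp : p ≠ 0) (hq : q ≠ 0) :
    Bk b ε p q * (‖p‖ + ‖q‖) ^ 2 ≤ 16 * (phi p * phi q) := by
  have hp' := norm_pos_iff.2 hp
  have hq' := norm_pos_iff.2 hq
  have n1 := phi_nonneg p
  have n2 := phi_nonneg q
  unfold Bk
  split_ifs with h
  · have hr : 0 < relMom p q := hε.trans_le h
    have h1 : relMom p q ^ (2 - b) ≤ 4 * (‖p‖ * ‖q‖) ^ (1 - b / 2) := by
      have e : relMom p q ^ (2 - b) = (relMom p q ^ 2) ^ (1 - b / 2) := by
        rw [← Real.rpow_natCast, ← Real.rpow_mul hr.le]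
        congr 1
        push_cast
        ring
      rw [e]
      calc _ ≤ (4 * (‖p‖ * ‖q‖)) ^ (1 - b / 2) :=
            Real.rpow_le_rpow (by positivity) (relMom_sq_le p q) (by linarith)
        _ = 4 ^ (1 - b / 2) * (‖p‖ * ‖q‖) ^ (1 - b / 2) := Real.mul_rpow (by norm_num) (by positivity)
        _ ≤ _ := by
          gcongr
          calc (4 : ℝ) ^ (1 - b / 2) ≤ 4 ^ (1 : ℝ) :=
                Real.rpow_le_rpow_of_exponent_le (by norm_num) (by linarith)
            _ = 4 := by simp
    have h2 : (‖p‖ * ‖q‖) ^ (1 - b / 2) / (‖p‖ * ‖q‖) = ‖p‖ ^ (-(b / 2)) * ‖q‖ ^ (-(b / 2)) := by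
      rw [← Real.mul_rpow hp'.le hq'.le, ← Real.rpow_sub_one (by positivity)]
      congr 1
      ring
    have h3 : (‖p‖ + ‖q‖) ^ 2 ≤ 2 * (‖p‖ ^ 2 + ‖q‖ ^ 2) := by nlinarith [sq_nonneg (‖p‖ - ‖q‖)]
    have h4 : ∀ r : ℝ, 0 < r → r ^ (-(b / 2)) * r ^ 2 = r ^ (2 - b / 2) := by
      intro r hr
      rw [sub_eq_neg_add, Real.rpow_add hr]
      norm_cast
    calc _ ≤ 4 * (‖p‖ * ‖q‖) ^ (1 - b / 2) / (‖p‖ * ‖q‖) * (2 * (‖p‖ ^ 2 + ‖q‖ ^ 2)) := by gcongr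
      _ = 8 * ((‖p‖ ^ (-(b / 2)) * ‖p‖ ^ 2) * ‖q‖ ^ (-(b / 2)) +
          ‖p‖ ^ (-(b / 2)) * (‖q‖ ^ (-(b / 2)) * ‖q‖ ^ 2)) := by
          rw [mul_div_assoc, h2]
          ring
      _ = 8 * (‖p‖ ^ (2 - b / 2) * ‖q‖ ^ (-(b / 2)) + ‖p‖ ^ (-(b / 2)) * ‖q‖ ^ (2 - b / 2)) := by
          rw [h4 _ hp', h4 _ hq']
      _ ≤ 8 * (phi p * phi q + phi p * phi q) := by
          have a1 := rpow_le_phi hp (m := 2 - b / 2) (by linarith) (by linarith)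
          have a2 := rpow_le_phi hp (m := -(b / 2)) (by linarith) (by linarith)
          have a3 := rpow_le_phi hq (m := 2 - b / 2) (by linarith) (by linarith)
          have a4 := rpow_le_phi hq (m := -(b / 2)) (by linarith) (by linarith)
          gcongr
      _ = _ := by ring
  · rw [zero_mul]
    positivity

lemma gain_b {b : ℝ} (hb1 : 1 < b) (hb2 : b < 2) : ∃ C : ℝ, 0 ≤ C ∧ ∀ ε : ℝ, 0 < ε →
    ∀ u : R3 → ℝ≥0∞, Measurable u → (∀ p q : R3, ‖p‖ = ‖q‖ → u p = u q) →
    ∫⁻ x, ENNReal.ofReal (Bk b ε x.1 x.2.1) *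
      (u x.1 * u x.2.1 * ENNReal.ofReal (phi (postX x).1)) ∂muX
      ≤ ENNReal.ofReal C * (∫⁻ p, u p * ENNReal.ofReal (phi p)) ^ 2 := by
  obtain ⟨C, hC0, hC⟩ := weight_first hb1 hb2
  set s := sphMeasure.real Set.univ with hs
  have hs0 : 0 < s := sph_real_pos
  refine ⟨C + s * 16, by positivity, fun ε hε u hu hrad => ?_⟩
  have hφ : Measurable (fun p => u p * ENNReal.ofReal (phi p)) :=
    hu.mul measurable_phi.ennreal_ofReal
  have step := gain_le (b := b) (ε := ε) u hu phi measurable_phi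
    (fun p q => ENNReal.ofReal (16 * π / relMom p q ^ 2)
        + ENNReal.ofReal s * ENNReal.ofReal ((‖p‖ + ‖q‖) ^ 2))
    (by
      intro p q hr
      refine (post_avg p q (hε.trans_le hr)).trans ?_
      rw [sph_ofReal])
  refine step.trans ?_
  set M := ∫⁻ p, u p * ENNReal.ofReal (phi p) with hM
  have inner : ∀ᵐ p : R3, ∫⁻ q, ENNReal.ofReal (Bk b ε p q) * (u p * u q *
      (ENNReal.ofReal (16 * π / relMom p q ^ 2)
        + ENNReal.ofReal s * ENNReal.ofReal ((‖p‖ + ‖q‖) ^ 2)))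
      ≤ (u p * ENNReal.ofReal (phi p)) * (ENNReal.ofReal (C + s * 16) * M) := by
    filter_upwards [ae_ne_zero] with p hp
    have n1 := phi_nonneg p
    have hW : Measurable (fun q : R3 => u q *
        ENNReal.ofReal (16 * π / (‖p‖ * ‖q‖) * relMom p q ^ (-b))) := by
      refine hu.mul ?_
      unfold relMom
      fun_prop
    calc _ ≤ ∫⁻ q, (u p * (u q * ENNReal.ofReal (16 * π / (‖p‖ * ‖q‖) * relMom p q ^ (-b)))
          + ENNReal.ofReal (s * 16) * (u p * ENNReal.ofReal (phi p)) *
            (u q * ENNReal.ofReal (phi q))) := by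
          refine lintegral_mono_ae ?_
          filter_upwards [ae_ne_zero] with q hq
          have b0 := Bk_nonneg b ε p q
          have n2 := phi_nonneg q
          have e1 : ENNReal.ofReal (Bk b ε p q) * ENNReal.ofReal (16 * π / relMom p q ^ 2)
              ≤ ENNReal.ofReal (16 * π / (‖p‖ * ‖q‖) * relMom p q ^ (-b)) := by
            rw [← ENNReal.ofReal_mul b0]
            exact ENNReal.ofReal_le_ofReal (Bk_first hε p q)
          have e2 : ENNReal.ofReal (Bk b ε p q) * ENNReal.ofReal ((‖p‖ + ‖q‖) ^ 2)
              ≤ ENNReal.ofReal 16 * (ENNReal.ofReal (phi p) * ENNReal.ofReal (phi q)) := by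
            rw [← ENNReal.ofReal_mul b0, ← ENNReal.ofReal_mul n1,
              ← ENNReal.ofReal_mul (by norm_num)]
            exact ENNReal.ofReal_le_ofReal (Bk_second hb1 hb2 hε hp hq)
          calc _ = u p * (u q * (ENNReal.ofReal (Bk b ε p q) *
                ENNReal.ofReal (16 * π / relMom p q ^ 2))) + ENNReal.ofReal s * (u p * u q) *
                (ENNReal.ofReal (Bk b ε p q) * ENNReal.ofReal ((‖p‖ + ‖q‖) ^ 2)) := by ring
            _ ≤ u p * (u q * ENNReal.ofReal (16 * π / (‖p‖ * ‖q‖) * relMom p q ^ (-b)))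
                + ENNReal.ofReal s * (u p * u q) *
                (ENNReal.ofReal 16 * (ENNReal.ofReal (phi p) * ENNReal.ofReal (phi q))) := by
                gcongr
            _ = _ := by
                rw [ENNReal.ofReal_mul hs0.le]
                ring
      _ = u p * (∫⁻ q, u q * ENNReal.ofReal (16 * π / (‖p‖ * ‖q‖) * relMom p q ^ (-b)))
          + ENNReal.ofReal (s * 16) * (u p * ENNReal.ofReal (phi p)) * M := by
          rw [lintegral_add_left (hW.const_mul _), lintegral_const_mul _ hW,
            lintegral_const_mul _ hφ]
      _ ≤ u p * (ENNReal.ofReal (C * phi p) * M)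
          + ENNReal.ofReal (s * 16) * (u p * ENNReal.ofReal (phi p)) * M := by
          gcongr
          exact hC u hu hrad p hp
      _ = _ := by
          rw [ENNReal.ofReal_mul hC0, ENNReal.ofReal_add hC0 (by positivity)]
          ring
  refine (lintegral_mono_ae inner).trans ?_
  rw [lintegral_mul_const _ hφ, ← hM]
  apply le_of_eq
  ring

end Moments2

end

section


section Evolution

open scoped ENNReal

lemma phik_norm_le {k : ℝ} (hk : 0 ≤ k) (p : R3) : ‖phik k p‖ ≤ k := by
  rw [Real.norm_of_nonneg (phik_nonneg hk p)]
  exact min_le_right _ _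

lemma mul_phik_int {k : ℝ} (hk : 0 ≤ k) {f : R3 → ℝ} (hf : Integrable f) :
    Integrable (fun p => f p * phik k p) :=
  hf.mul_bdd (measurable_phik k).aestronglyMeasurable
    (Filter.Eventually.of_forall fun p => phik_norm_le hk p)

lemma exists_momL {k : ℝ} (hk : 0 ≤ k) : ∃ l : EE →L[ℝ] ℝ, ∀ f : EE, l f = ∫ p, f p * phik k p := by
  let l0 : EE →ₗ[ℝ] ℝ :=
    { toFun := fun f => ∫ p, f p * phik k p
      map_add' := by
        intro f g
        rw [← integral_add (mul_phik_int hk (EE_int f)) (mul_phik_int hk (EE_int g))]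
        refine integral_congr_ae ?_
        filter_upwards [Lp.coeFn_add f g] with p hp
        rw [hp, Pi.add_apply, add_mul]
      map_smul' := by
        intro c f
        rw [RingHom.id_apply, smul_eq_mul, ← integral_const_mul]
        refine integral_congr_ae ?_
        filter_upwards [Lp.coeFn_smul c f] with p hp
        rw [hp, Pi.smul_apply, smul_eq_mul, mul_assoc] }
  refine ⟨l0.mkContinuous k fun f => ?_, fun f => rfl⟩
  rw [L1.norm_eq_integral_norm, ← integral_const_mul]
  refine (norm_integral_le_integral_norm _).trans ?_
  refine integral_mono (mul_phik_int hk (EE_int f)).norm ((EE_int f).norm.const_mul _) fun p => ?_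
  simp only
  rw [norm_mul, mul_comm]
  gcongr
  exact phik_norm_le hk p

variable {C₁ b ε : ℝ}

/-- Gain functional. -/
def gainK (b ε k : ℝ) (f : R3 → ℝ) : ℝ :=
  ∫ x, Bk b ε x.1 x.2.1 * (tfun f f (preX x) * phik k (postX x).1) ∂muX

lemma mom_V (hC : 0 < C₁) (hb1 : 1 < b) (hε : 0 < ε) {Γ : EE →L[ℝ] EE →L[ℝ] EE}
    (hΓ : ∀ f g : EE, ⇑(Γ f g) =ᵐ[volume] Gfun C₁ b ε (tfun f g)) {k : ℝ} (hk : 0 ≤ k)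
    {l : EE →L[ℝ] ℝ} (hl : ∀ f : EE, l f = ∫ p, f p * phik k p) {f : EE} (hf : 0 ≤ f) :
    l (Vop Γ (lamC C₁ b ε) f f) ≤ C₁ * gainK b ε k f := by
  have hH := tfun_int (EE_int f) (EE_int f)
  have h1 : l (Γ f f) = C₁ * gainK b ε k f
        + (lamC C₁ b ε * (∫ x, tfun f f x * phik k x.1 ∂muP)
        - C₁ * (∫ x, Bk b ε x.1 x.2.1 * (tfun f f (preX x) * phik k (preX x).1) ∂muX)) := by
    rw [hl, gainK, ← integral_Kop_weight hb1 hε hH (phik k) (measurable_phik k) k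
      (fun p => phik_norm_le hk p), ← Gfun_weight hb1 hε hH (phik k) (measurable_phik k) k
      (fun p => phik_norm_le hk p)]
    refine integral_congr_ae ?_
    filter_upwards [hΓ f f] with p hp
    rw [hp]
  have h2 : ∫ x, tfun f f x * phik k x.1 ∂muP = massL f * l f := by
    have := integral_prod_mul (μ := (volume : Measure R3)) (ν := (volume : Measure R3))
      (fun p => f p * phik k p) f
    rw [hl, massL_eq, mul_comm, ← this]
    refine integral_congr_ae (Filter.Eventually.of_forall fun x => ?_)
    simp only [tfun]
    ring
  have h3 : 0 ≤ ∫ x, Bk b ε x.1 x.2.1 * (tfun f f (preX x) * phik k (preX x).1) ∂muX := by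
    refine integral_nonneg_of_ae ?_
    have hf' := (Lp.coeFn_nonneg f).2 hf
    have h4 : tfun f f =ᵐ[muP] tfun (fun p => |f p|) (fun p => |f p|) := by
      refine tfun_congr ?_ ?_ <;>
      · filter_upwards [hf'] with p hp
        exact (abs_of_nonneg hp).symm
    filter_upwards [pre_congr h4] with x hx
    rw [hx]
    exact mul_nonneg (Bk_nonneg _ _ _ _) (mul_nonneg (mul_nonneg (abs_nonneg _) (abs_nonneg _))
      (phik_nonneg hk _))
  rw [Vop_apply, map_sub, map_smul, smul_eq_mul, h1, h2]
  nlinarith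

lemma gainK_le (hb1 : 1 < b) (hε : 0 < ε) {k : ℝ} (hk : 0 ≤ k) {f : EE}
    {v : R3 → ℝ} (hv : ⇑f =ᵐ[volume] v) (hv0 : ∀ p, 0 ≤ v p) :
    ENNReal.ofReal (gainK b ε k f) = ∫⁻ x, ENNReal.ofReal (Bk b ε x.1 x.2.1) *
      (ENNReal.ofReal (v x.1) * ENNReal.ofReal (v x.2.1) *
        ENNReal.ofReal (phik k (postX x).1)) ∂muX := by
  have hvi : Integrable v := (EE_int f).congr hv
  have e1 : gainK b ε k f = ∫ x, Bk b ε x.1 x.2.1 * (tfun v v (preX x) * phik k (postX x).1) ∂muX := by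
    refine integral_congr_ae ?_
    filter_upwards [pre_congr (tfun_congr hv hv)] with x hx
    rw [hx]
  have hφ : AEStronglyMeasurable (fun x : XX => phik k (postX x).1) muX :=
    ((measurable_phik k).comp (measurable_fst.comp measurable_postX)).aestronglyMeasurable
  have hi : Integrable (fun x => Bk b ε x.1 x.2.1 * (tfun v v (preX x) * phik k (postX x).1)) muX := by
    have := (integrable_Bpre hb1 hε (tfun_int hvi hvi)).mul_bdd hφ
      (Filter.Eventually.of_forall fun x => phik_norm_le hk _)
    refine this.congr (Filter.Eventually.of_forall fun x => ?_)
    simp only [mul_assoc]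
  have nn : ∀ x : XX, 0 ≤ tfun v v (preX x) := fun x => mul_nonneg (hv0 _) (hv0 _)
  rw [e1, ofReal_integral_eq_lintegral_ofReal hi (Filter.Eventually.of_forall fun x =>
    mul_nonneg (Bk_nonneg _ _ _ _) (mul_nonneg (nn x) (phik_nonneg hk _)))]
  refine lintegral_congr fun x => ?_
  rw [ENNReal.ofReal_mul (Bk_nonneg _ _ _ _), ENNReal.ofReal_mul (nn x)]
  simp only [tfun, preX]
  rw [ENNReal.ofReal_mul (hv0 _)]

/-- Full moment. -/
def ME (f : R3 → ℝ) : ℝ≥0∞ := ∫⁻ p, ENNReal.ofReal (f p) * ENNReal.ofReal (phi p)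

lemma ME_congr {f g : R3 → ℝ} (h : f =ᵐ[volume] g) : ME f = ME g := by
  unfold ME
  refine lintegral_congr_ae ?_
  filter_upwards [h] with p hp
  rw [hp]

lemma pos_rep {f : EE} (hf : 0 ≤ f) : ∃ v : R3 → ℝ, Measurable v ∧ (∀ p, 0 ≤ v p) ∧
    ⇑f =ᵐ[volume] v := by
  have hm := (EE_int f).aestronglyMeasurable.aemeasurable
  refine ⟨fun p => |hm.mk f p|, hm.measurable_mk.abs, fun p => abs_nonneg _, ?_⟩
  filter_upwards [hm.ae_eq_mk, (Lp.coeFn_nonneg f).2 hf] with p h1 h2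
  rw [← h1, abs_of_nonneg h2]

lemma rad_rep {f : EE} (hf : 0 ≤ f) (hr : ⇑f =ᵐ[volume] Afun f) :
    ∃ v : R3 → ℝ, Measurable v ∧ (∀ p, 0 ≤ v p) ∧ ⇑f =ᵐ[volume] v ∧ RadF v := by
  obtain ⟨v, hv, hv0, hfv⟩ := pos_rep hf
  refine ⟨Afun v, ?_, fun p => ?_, hr.trans (Afun_congr hfv), Afun_rad v⟩
  · have h1 : StronglyMeasurable (fun x : R3 × sphere (0 : R3) 1 => v (‖x.1‖ • (x.2 : R3))) :=
      (hv.comp measurable_radmap).stronglyMeasurable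
    exact (h1.integral_prod_right'.measurable).const_mul _
  · exact mul_nonneg (inv_nonneg.2 sph_real_pos.le) (integral_nonneg fun _ => hv0 _)

lemma ofReal_mom {k : ℝ} (hk : 0 ≤ k) {f : EE} {v : R3 → ℝ} (hv : ⇑f =ᵐ[volume] v)
    (hv0 : ∀ p, 0 ≤ v p) : ENNReal.ofReal (∫ p, f p * phik k p)
      = ∫⁻ p, ENNReal.ofReal (v p) * ENNReal.ofReal (phik k p) := by
  have hvi : Integrable v := (EE_int f).congr hv
  have : ∫ p, f p * phik k p = ∫ p, v p * phik k p := by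
    refine integral_congr_ae ?_
    filter_upwards [hv] with p hp
    rw [hp]
  rw [this, ofReal_integral_eq_lintegral_ofReal (mul_phik_int hk hvi)
    (Filter.Eventually.of_forall fun p => mul_nonneg (hv0 p) (phik_nonneg hk p))]
  refine lintegral_congr fun p => ?_
  rw [ENNReal.ofReal_mul (hv0 p)]

lemma ofReal_mass {f : EE} {v : R3 → ℝ} (hv : ⇑f =ᵐ[volume] v)
    (hv0 : ∀ p, 0 ≤ v p) : ENNReal.ofReal (massL f) = ∫⁻ p, ENNReal.ofReal (v p) := by
  have hvi : Integrable v := (EE_int f).congr hv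
  rw [massL_eq, integral_congr_ae hv, ofReal_integral_eq_lintegral_ofReal hvi
    (Filter.Eventually.of_forall hv0)]

lemma mom_nonneg {k : ℝ} (hk : 0 ≤ k) {f : EE} (hf : 0 ≤ f) : 0 ≤ ∫ p, f p * phik k p := by
  refine integral_nonneg_of_ae ?_
  filter_upwards [(Lp.coeFn_nonneg f).2 hf] with p hp
  exact mul_nonneg hp (phik_nonneg hk p)

lemma mom_le_ME {k : ℝ} (hk : 0 ≤ k) {f : EE} (hf : 0 ≤ f) {B : ℝ} (hB : 0 ≤ B)
    (h : ME f ≤ ENNReal.ofReal B) : ∫ p, f p * phik k p ≤ B := by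
  obtain ⟨v, hv, hv0, hfv⟩ := pos_rep hf
  rw [← ENNReal.ofReal_le_ofReal_iff hB, ofReal_mom hk hfv hv0]
  refine le_trans ?_ h
  rw [ME_congr hfv]
  refine lintegral_mono fun p => ?_
  simp only
  gcongr
  exact min_le_left _ _

lemma ME_le_of_mom {f : EE} (hf : 0 ≤ f) {B : ℝ}
    (h : ∀ k : ℕ, ∫ p, f p * phik k p ≤ B) : ME f ≤ ENNReal.ofReal B := by
  obtain ⟨v, hv, hv0, hfv⟩ := pos_rep hf
  rw [ME_congr hfv]
  have hm : ∀ k : ℕ, Measurable (fun p => ENNReal.ofReal (v p) * ENNReal.ofReal (phik k p)) :=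
    fun k => hv.ennreal_ofReal.mul (measurable_phik k).ennreal_ofReal
  have ht := lintegral_tendsto_of_tendsto_of_monotone (μ := (volume : Measure R3))
    (f := fun (k : ℕ) p => ENNReal.ofReal (v p) * ENNReal.ofReal (phik k p))
    (F := fun p => ENNReal.ofReal (v p) * ENNReal.ofReal (phi p))
    (fun k => (hm k).aemeasurable)
    (Filter.Eventually.of_forall fun p => by
      intro k j hkj
      simp only
      gcongr
      unfold phik
      gcongr)
    (Filter.Eventually.of_forall fun p => by
      obtain ⟨n, hn⟩ := exists_nat_ge (phi p)
      refine tendsto_const_nhds.congr' ?_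
      filter_upwards [Filter.eventually_ge_atTop n] with k hk
      have : phik k p = phi p := min_eq_left (hn.trans (by exact_mod_cast hk))
      rw [this])
  refine le_of_tendsto' ht fun k => ?_
  rw [← ofReal_mom k.cast_nonneg hfv hv0]
  exact ENNReal.ofReal_le_ofReal (h k)

lemma gain_a' (hb1 : 1 < b) (hε : 0 < ε) : ∃ c : ℝ, 0 ≤ c ∧ ∀ k : ℝ, 0 ≤ k → ∀ f : EE, 0 ≤ f →
    gainK b ε k f ≤ c * (massL f * massL f + massL f * ∫ p, f p * phik k p) := by
  obtain ⟨c, hc, h⟩ := gain_a hb1 hε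
  refine ⟨c, hc, fun k hk f hf => ?_⟩
  obtain ⟨v, hv, hv0, hfv⟩ := pos_rep hf
  have h1 := h k hk (fun p => ENNReal.ofReal (v p)) hv.ennreal_ofReal
  have m0 : 0 ≤ massL f := by rw [← norm_eq_mass hf]; exact norm_nonneg _
  have M0 := mom_nonneg hk hf
  rw [← gainK_le hb1 hε hk hfv hv0, ← ofReal_mass hfv hv0, ← ofReal_mom hk hfv hv0,
    ← ENNReal.ofReal_mul m0, ← ENNReal.ofReal_mul m0,
    ← ENNReal.ofReal_add (by positivity) (by positivity), ← ENNReal.ofReal_mul hc,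
    ENNReal.ofReal_le_ofReal_iff (by positivity)] at h1
  exact h1

lemma gain_b' (hb1 : 1 < b) (hb2 : b < 2) : ∃ C : ℝ, 0 ≤ C ∧ ∀ ε : ℝ, 0 < ε →
    ∀ k : ℝ, 0 ≤ k → ∀ f : EE, 0 ≤ f → ⇑f =ᵐ[volume] Afun f → ∀ B : ℝ, 0 ≤ B →
    ME f ≤ ENNReal.ofReal B → gainK b ε k f ≤ C * B ^ 2 := by
  obtain ⟨C, hC, h⟩ := gain_b hb1 hb2
  refine ⟨C, hC, fun ε hε k hk f hf hr B hB hM => ?_⟩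
  obtain ⟨v, hv, hv0, hfv, hrad⟩ := rad_rep hf hr
  have h1 := h ε hε (fun p => ENNReal.ofReal (v p)) hv.ennreal_ofReal
    (fun p q hpq => by rw [hrad p q hpq])
  rw [← ENNReal.ofReal_le_ofReal_iff (by positivity), gainK_le hb1 hε hk hfv hv0,
    ENNReal.ofReal_mul hC, ENNReal.ofReal_pow hB]
  rw [ME_congr hfv] at hM
  refine le_trans ?_ (h1.trans ?_)
  · refine lintegral_mono fun x => ?_
    simp only
    gcongr
    exact min_le_left _ _
  · gcongr
    exact hM

end Evolution

end

section


section Bootstrap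

open scoped ENNReal

lemma growth_le {y y' : ℝ → ℝ} {s t D : ℝ} (hst : s ≤ t)
    (hd : ∀ τ ∈ Set.Icc s t, HasDerivAt y (y' τ) τ) (hD : ∀ τ ∈ Set.Icc s t, y' τ ≤ D) :
    y t ≤ y s + D * (t - s) := by
  have h := (convex_Icc s t).image_sub_le_mul_sub_of_deriv_le (f := y) (C := D)
    (fun τ hτ => (hd τ hτ).continuousAt.continuousWithinAt)
    (fun τ hτ => (hd τ (interior_subset hτ)).differentiableAt.differentiableWithinAt)
    (fun τ hτ => by
      rw [(hd τ (interior_subset hτ)).deriv]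
      exact hD τ (interior_subset hτ)) s ⟨le_rfl, hst⟩ t ⟨hst, le_rfl⟩ hst
  linarith

variable {C₁ b ε : ℝ}

lemma evo_exp (hC : 0 < C₁) (hb1 : 1 < b) (hε : 0 < ε) {Γ : EE →L[ℝ] EE →L[ℝ] EE}
    (hΓ : ∀ f g : EE, ⇑(Γ f g) =ᵐ[volume] Gfun C₁ b ε (tfun f g)) {F : ℝ → EE} {m : ℝ}
    (hpos : ∀ t, 0 ≤ t → 0 ≤ F t) (hm : ∀ t, 0 ≤ t → massL (F t) = m)
    (hd : ∀ t, 0 ≤ t → HasDerivAt F (Vop Γ (lamC C₁ b ε) (F t) (F t)) t) {R : ℝ} (hR : 0 ≤ R)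
    (h0 : ME (F 0) ≤ ENNReal.ofReal R) (T : ℝ) :
    ∃ B : ℝ, 0 ≤ B ∧ ∀ t, 0 ≤ t → t ≤ T → ME (F t) ≤ ENNReal.ofReal B := by
  obtain ⟨c, hc, hg⟩ := gain_a' hb1 hε
  have m0 : 0 ≤ m := by
    rw [← hm 0 le_rfl, ← norm_eq_mass (hpos 0 le_rfl)]
    exact norm_nonneg _
  set a := C₁ * (c * (m * m + m)) with ha
  have ha0 : 0 ≤ a := by positivity
  refine ⟨(1 + R) * Real.exp (a * T), by positivity, fun t ht htT => ?_⟩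
  refine ME_le_of_mom (hpos t ht) fun k => ?_
  have hk : (0 : ℝ) ≤ k := k.cast_nonneg
  obtain ⟨l, hl⟩ := exists_momL hk
  have hy : ∀ τ ∈ Set.Icc (0 : ℝ) t, HasDerivAt (fun τ => (1 + l (F τ)) * Real.exp (-(a * τ)))
      ((l (Vop Γ (lamC C₁ b ε) (F τ) (F τ)) - a * (1 + l (F τ))) * Real.exp (-(a * τ))) τ := by
    intro τ hτ
    have h1 : HasDerivAt (fun τ => 1 + l (F τ)) (l (Vop Γ (lamC C₁ b ε) (F τ) (F τ))) τ :=
      (l.hasFDerivAt.comp_hasDerivAt τ (hd τ hτ.1)).const_add 1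
    have h2 : HasDerivAt (fun τ : ℝ => Real.exp (-(a * τ))) (Real.exp (-(a * τ)) * (-(a * 1))) τ :=
      (((hasDerivAt_id τ).const_mul a).neg).exp
    refine (h1.mul h2).congr_deriv ?_
    ring
  have hy' : ∀ τ ∈ Set.Icc (0 : ℝ) t,
      (l (Vop Γ (lamC C₁ b ε) (F τ) (F τ)) - a * (1 + l (F τ))) * Real.exp (-(a * τ)) ≤ 0 := by
    intro τ hτ
    have p0 := hpos τ hτ.1
    have h1 := mom_V hC hb1 hε hΓ hk hl p0
    have h2 := hg k hk (F τ) p0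
    rw [← hl, hm τ hτ.1] at h2
    have h3 : 0 ≤ l (F τ) := by rw [hl]; exact mom_nonneg hk p0
    refine mul_nonpos_of_nonpos_of_nonneg ?_ (Real.exp_pos _).le
    have h4 : C₁ * gainK b ε k (F τ) ≤ C₁ * (c * (m * m + m * l (F τ))) := by gcongr
    have h5 : 0 ≤ C₁ * (c * (m * m * l (F τ) + m)) := by positivity
    rw [ha]
    nlinarith
  have key := growth_le ht hy hy'
  simp only [mul_zero, neg_zero, Real.exp_zero, mul_one, zero_mul, add_zero] at key
  rw [← hl]
  have h6 : l (F 0) ≤ R := by rw [hl]; exact mom_le_ME hk (hpos 0 le_rfl) hR h0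
  have h7 : 0 ≤ l (F 0) := by rw [hl]; exact mom_nonneg hk (hpos 0 le_rfl)
  have h8 : 1 + l (F t) ≤ (1 + R) * Real.exp (a * t) := by
    have e : 1 + l (F t) = (1 + l (F t)) * Real.exp (-(a * t)) * Real.exp (a * t) := by
      rw [mul_assoc, ← Real.exp_add, neg_add_cancel, Real.exp_zero, mul_one]
    rw [e]
    gcongr
    linarith
  have h9 : Real.exp (a * t) ≤ Real.exp (a * T) := by gcongr
  nlinarith

lemma evo_step (hC : 0 < C₁) (hb1 : 1 < b) (hε : 0 < ε) {Γ : EE →L[ℝ] EE →L[ℝ] EE}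
    (hΓ : ∀ f g : EE, ⇑(Γ f g) =ᵐ[volume] Gfun C₁ b ε (tfun f g)) {F : ℝ → EE}
    (hpos : ∀ t, 0 ≤ t → 0 ≤ F t) (hr : ∀ t, 0 ≤ t → ⇑(F t) =ᵐ[volume] Afun (F t))
    (hd : ∀ t, 0 ≤ t → HasDerivAt F (Vop Γ (lamC C₁ b ε) (F t) (F t)) t) {C : ℝ}
    (hCb : ∀ k : ℝ, 0 ≤ k → ∀ f : EE, 0 ≤ f → ⇑f =ᵐ[volume] Afun f → ∀ B : ℝ, 0 ≤ B →
      ME f ≤ ENNReal.ofReal B → gainK b ε k f ≤ C * B ^ 2)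
    {s t A B : ℝ} (hs : 0 ≤ s) (hst : s ≤ t) (hA0 : 0 ≤ A) (hB0 : 0 ≤ B)
    (hA : ME (F s) ≤ ENNReal.ofReal A) (hB : ∀ τ ∈ Set.Icc s t, ME (F τ) ≤ ENNReal.ofReal B) :
    ME (F t) ≤ ENNReal.ofReal (A + C₁ * C * B ^ 2 * (t - s)) := by
  refine ME_le_of_mom (hpos t (hs.trans hst)) fun k => ?_
  have hk : (0 : ℝ) ≤ k := k.cast_nonneg
  obtain ⟨l, hl⟩ := exists_momL hk
  have key := growth_le (y := fun τ => l (F τ)) (D := C₁ * C * B ^ 2) hst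
    (fun τ hτ => l.hasFDerivAt.comp_hasDerivAt τ (hd τ (hs.trans hτ.1)))
    (fun τ hτ => by
      have p0 := hpos τ (hs.trans hτ.1)
      refine (mom_V hC hb1 hε hΓ hk hl p0).trans ?_
      rw [mul_assoc]
      gcongr
      exact hCb k hk (F τ) p0 (hr τ (hs.trans hτ.1)) B hB0 (hB τ hτ))
  have h1 : l (F s) ≤ A := by rw [hl]; exact mom_le_ME hk (hpos s hs) hA0 hA
  rw [← hl]
  linarith

lemma bootstrap {P : ℝ → ℝ≥0∞} {T R D B : ℝ} (hR : 0 ≤ R) (hD : 0 ≤ D) (hB0 : 0 ≤ B)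
    (hstep : ∀ s t A B : ℝ, 0 ≤ s → s ≤ t → 0 ≤ A → 0 ≤ B → P s ≤ ENNReal.ofReal A →
      (∀ τ ∈ Set.Icc s t, P τ ≤ ENNReal.ofReal B) → P t ≤ ENNReal.ofReal (A + D * B ^ 2 * (t - s)))
    (hB : ∀ t, 0 ≤ t → t ≤ T → P t ≤ ENNReal.ofReal B) (h0 : P 0 ≤ ENNReal.ofReal R)
    (hT : D * (R + 2) ^ 2 * T ≤ 1) (t : ℝ) (ht : 0 ≤ t) (htT : t ≤ T) :
    P t ≤ ENNReal.ofReal (R + 1) := by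
  set E := D * (R + 2) ^ 2 with hE
  have hE0 : 0 ≤ E := by positivity
  set δ := 1 / (D * B ^ 2 + 1) with hδ
  have hδ0 : 0 < δ := by positivity
  have hδ1 : D * B ^ 2 * δ ≤ 1 := by
    rw [hδ, mul_one_div, div_le_one (by positivity)]
    linarith
  have ind : ∀ n : ℕ, ∀ t, 0 ≤ t → t ≤ T → t ≤ n * δ → P t ≤ ENNReal.ofReal (R + E * t) := by
    intro n
    induction n with
    | zero =>
      intro t ht _ htn
      have : t = 0 := le_antisymm (by simpa using htn) ht
      rw [this]
      simpa using h0
    | succ n ih =>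
      intro t ht htT htn
      by_cases hc : t ≤ n * δ
      · exact ih t ht htT hc
      push Not at hc
      set s := n * δ with hs
      have hs0 : 0 ≤ s := by positivity
      have hts : t - s ≤ δ := by
        push_cast at htn
        rw [hs]
        linarith
      have hPs := ih s hs0 (hc.le.trans htT) le_rfl
      have hEs : E * s ≤ 1 := le_trans (by gcongr; exact hc.le.trans htT) hT
      have hA0 : 0 ≤ R + E * s := by positivity
      have hmid : ∀ τ ∈ Set.Icc s t, P τ ≤ ENNReal.ofReal (R + 2) := by
        intro τ hτ
        refine (hstep s τ (R + E * s) B hs0 hτ.1 hA0 hB0 hPs fun τ' hτ' =>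
          hB τ' (hs0.trans hτ'.1) (hτ'.2.trans (hτ.2.trans htT))).trans ?_
        refine ENNReal.ofReal_le_ofReal ?_
        have : D * B ^ 2 * (τ - s) ≤ D * B ^ 2 * δ := by
          gcongr
          linarith [hτ.2]
        linarith
      refine (hstep s t (R + E * s) (R + 2) hs0 hc.le hA0 (by linarith) hPs hmid).trans ?_
      refine ENNReal.ofReal_le_ofReal ?_
      rw [← hE]
      linarith
  obtain ⟨n, hn⟩ := exists_nat_ge (t / δ)
  refine (ind n t ht htT ((div_le_iff₀ hδ0).1 hn)).trans ?_
  refine ENNReal.ofReal_le_ofReal ?_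
  have : E * t ≤ E * T := by gcongr
  linarith

lemma ME_lt_top {f₀ : R3 → ℝ} (hint : Integrable f₀)
    (h : ∀ m : ℝ, -2 ≤ m → m ≤ 2 → (∫⁻ p : R3, ENNReal.ofReal (f₀ p * ‖p‖ ^ m)) < ⊤) :
    ME f₀ < ⊤ := by
  have h1 := h (-2) le_rfl (by norm_num)
  have h2 := h 2 (by norm_num) le_rfl
  have e : ∀ p : R3, ENNReal.ofReal (f₀ p) * ENNReal.ofReal (phi p)
      = ENNReal.ofReal (f₀ p * ‖p‖ ^ (-2 : ℝ)) + ENNReal.ofReal (f₀ p * ‖p‖ ^ (2 : ℝ)) := by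
    intro p
    rw [ENNReal.ofReal_mul' (by positivity), ENNReal.ofReal_mul' (by positivity), ← mul_add,
      ← ENNReal.ofReal_add (by positivity) (by positivity), phi, Real.rpow_neg (norm_nonneg p),
      one_div]
    norm_cast
  unfold ME
  simp only [e]
  have hm : AEMeasurable (fun p : R3 => ENNReal.ofReal (f₀ p * ‖p‖ ^ (-2 : ℝ))) :=
    (hint.aestronglyMeasurable.aemeasurable.mul
      (by fun_prop : Measurable fun p : R3 => ‖p‖ ^ (-2 : ℝ)).aemeasurable).ennreal_ofReal
  rw [lintegral_add_left' hm]
  exact ENNReal.add_lt_top.2 ⟨h1, h2⟩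

lemma mom_le_ME' (f : R3 → ℝ) {m : ℝ} (h1 : -2 ≤ m) (h2 : m ≤ 2) :
    (∫⁻ p : R3, ENNReal.ofReal (f p * ‖p‖ ^ m)) ≤ ME f := by
  unfold ME
  refine lintegral_mono_ae ?_
  filter_upwards [ae_ne_zero] with p hp
  rw [ENNReal.ofReal_mul' (by positivity)]
  gcongr
  exact rpow_le_phi hp h1 h2

lemma part_two (hC : 0 < C₁) (hb1 : 1 < b) (hb2 : b < 2)
    (f₀ : R3 → ℝ) (hint : Integrable f₀) (hpos : ∀ᵐ p : R3, 0 ≤ f₀ p)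
    (hrad : ∀ p q : R3, ‖p‖ = ‖q‖ → f₀ p = f₀ q)
    (hmom : ∀ m : ℝ, -2 ≤ m → m ≤ 2 →
        (∫⁻ p : R3, ENNReal.ofReal (f₀ p * ‖p‖ ^ m)) < ⊤) :
      ∃ T : ℝ, 0 < T ∧ ∃ CT : ℝ,
        ∀ ε : ℝ, 0 < ε → ∀ F : ℝ → Lp ℝ 1 (volume : Measure R3),
          IsSolOn C₁ b ε f₀ F (Set.Ici 0) →
          ∀ m : ℝ, -2 ≤ m → m ≤ 2 → ∀ s ∈ Set.Icc (0:ℝ) T,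
            (∫⁻ p : R3, ENNReal.ofReal (F s p * ‖p‖ ^ m)) ≤ ENNReal.ofReal CT := by
  obtain ⟨C, hC0, hCb⟩ := gain_b' hb1 hb2
  have hfin := ME_lt_top hint hmom
  set R := (ME f₀).toReal with hR
  have hR0 : 0 ≤ R := ENNReal.toReal_nonneg
  have hRM : ME f₀ = ENNReal.ofReal R := (ENNReal.ofReal_toReal hfin.ne).symm
  set E := C₁ * C * (R + 2) ^ 2 with hE
  have hE0 : 0 ≤ E := by positivity
  refine ⟨1 / (E + 1), by positivity, R + 1, fun ε hε G hG m hm1 hm2 s hs => ?_⟩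
  refine (mom_le_ME' (G s) hm1 hm2).trans ?_
  obtain ⟨Γ, hΓ⟩ := exists_Gamma hC hb1 hε
  obtain ⟨S, hSc, hS⟩ := exists_rad_submodule
  have h1 : ⇑(hint.toL1 f₀) =ᵐ[volume] f₀ := hint.coeFn_toL1
  obtain ⟨F, h0, hK, hmass, hd⟩ := sol_exists hC hb1 hε hΓ S hSc
    (fun f hf g hg => (hS _).2 (Gam_rad hb1 hε hΓ ((hS f).1 hf) ((hS g).1 hg)))
    (hint.toL1 f₀) ((hS _).2 (rad_mem_iff_of_ae hrad h1)) ((Lp.coeFn_nonneg _).1 (by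
      filter_upwards [h1, hpos] with p hp1 hp2
      rw [hp1]; exact hp2))
  have hGF : G s = F s := by
    refine bilin_unique (Vop Γ (lamC C₁ b ε)) ?_ (sol_deriv hb1 hε hΓ hG)
      (fun s hs => (hd s hs).hasDerivWithinAt) s hs.1
    rw [h0]
    exact Lp.ext (hG.1.trans h1.symm)
  rw [hGF]
  have hF0 : ME (F 0) ≤ ENNReal.ofReal R := by
    rw [h0, ME_congr h1, hRM]
  have hp : ∀ t, 0 ≤ t → 0 ≤ F t := fun t ht => (hK t ht).1
  obtain ⟨B, hB0, hB⟩ := evo_exp hC hb1 hε hΓ hp (fun t ht => hmass t ht) hd hR0 hF0 (1 / (E + 1))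
  refine bootstrap (P := fun t => ME (F t)) (T := 1 / (E + 1)) (D := C₁ * C) hR0 (by positivity) hB0
    (fun s t A B hs hst hA0 hB0 hA hB => evo_step hC hb1 hε hΓ hp
      (fun t ht => (hS _).1 (hK t ht).2) hd (hCb ε hε) hs hst hA0 hB0 hA hB) hB hF0 ?_ s hs.1 hs.2
  rw [← hE, mul_one_div, div_le_one (by positivity)]
  linarith

end Bootstrap

end

/-- **Proposition 1.** For each cutoff `ε > 0`, the modified Boltzmann equation
`∂ₛ f = Q_ε(f,f)` with nonnegative `L¹` data has a unique global nonnegative solution;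
moreover, for isotropic data with finite moments of orders `-2 ≤ m ≤ 2` there are `T > 0`
and `C_T`, both independent of `ε`, bounding all these moments on `[0,T]`. -/
theorem modified_boltzmann_global_existence
    (C₁ b : ℝ) (hC₁ : 0 < C₁) (hb1 : 1 < b) (hb2 : b < 2)
    (f₀ : R3 → ℝ) (hint : Integrable f₀) (hpos : ∀ᵐ p : R3, 0 ≤ f₀ p) :
    (∀ ε : ℝ, 0 < ε → ∃ F : ℝ → Lp ℝ 1 (volume : Measure R3),
        IsSolOn C₁ b ε f₀ F (Set.Ici 0) ∧
        (∀ s : ℝ, 0 ≤ s → ∀ᵐ p : R3, 0 ≤ F s p) ∧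
        (∀ G : ℝ → Lp ℝ 1 (volume : Measure R3),
          IsSolOn C₁ b ε f₀ G (Set.Ici 0) → ∀ s : ℝ, 0 ≤ s → G s = F s)) ∧
    ((∀ p q : R3, ‖p‖ = ‖q‖ → f₀ p = f₀ q) →
      (∀ m : ℝ, -2 ≤ m → m ≤ 2 →
        (∫⁻ p : R3, ENNReal.ofReal (f₀ p * ‖p‖ ^ m)) < ⊤) →
      ∃ T : ℝ, 0 < T ∧ ∃ CT : ℝ,
        ∀ ε : ℝ, 0 < ε → ∀ F : ℝ → Lp ℝ 1 (volume : Measure R3),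
          IsSolOn C₁ b ε f₀ F (Set.Ici 0) →
          ∀ m : ℝ, -2 ≤ m → m ≤ 2 → ∀ s ∈ Set.Icc (0:ℝ) T,
            (∫⁻ p : R3, ENNReal.ofReal (F s p * ‖p‖ ^ m)) ≤ ENNReal.ofReal CT) := by
  exact ⟨fun ε hε => part_one hC₁ hb1 hε f₀ hint hpos,
    fun hrad hmom => part_two hC₁ hb1 hb2 f₀ hint hpos hrad hmom⟩
end
end

section
/- For all p, q ∈ ℝ³ \ {0} that are not positive scalar multiples of each other (so that ρ(p,q) > 0), one has ∫_{S²} |p'(p,q,ω)|^{−2} dω = ∫_{S²} |q'(p,q,ω)|^{−2} dω = 16π / ρ(p,q)², where dω is the surface measure on the unit sphere S² and p', q' are the post-collision momenta defined by the stated parametrization. -/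
noncomputable section

open MeasureTheory Real Metric
open scoped RealInnerProductSpace

open Set in
lemma aux_polar (F : R3 → ℝ) (hF : Integrable F) :
    ∫ x, F x = ∫ ω : sphere (0 : R3) 1, (∫ r in Ioi (0 : ℝ), r ^ 2 * F (r • (ω : R3))) ∂sphMeasure := by
  have mp := (volume : Measure R3).measurePreserving_homeomorphUnitSphereProd
  have hd : Module.finrank ℝ R3 - 1 = 2 := by simp
  rw [hd] at mp
  have key : ∀ x : ({(0 : R3)}ᶜ : Set R3),
      F x = (fun y : sphere (0 : R3) 1 × Ioi (0 : ℝ) => F ((y.2 : ℝ) • (y.1 : R3)))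
        (homeomorphUnitSphereProd R3 x) := by
    intro x
    have := congrArg Subtype.val ((homeomorphUnitSphereProd R3).symm_apply_apply x)
    simp only [homeomorphUnitSphereProd_symm_apply_coe] at this
    simp only [this]
  have hint : Integrable (fun y : sphere (0 : R3) 1 × Ioi (0 : ℝ) => F ((y.2 : ℝ) • (y.1 : R3)))
      ((volume : Measure R3).toSphere.prod (.volumeIoiPow 2)) := by
    rw [← mp.integrable_comp_emb (Homeomorph.measurableEmbedding _)]
    have h1 : IntegrableOn F ({(0 : R3)}ᶜ) := hF.integrableOn
    rw [integrableOn_iff_comap_subtypeVal (by measurability)] at h1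
    refine h1.congr (.of_forall fun x => ?_)
    exact key x
  calc ∫ x, F x = ∫ x : ({(0 : R3)}ᶜ : Set R3), F x ∂(Measure.comap Subtype.val volume) := by
        rw [integral_subtype_comap (measurableSet_singleton _).compl F, restrict_compl_singleton]
    _ = ∫ y, F ((y.2 : ℝ) • (y.1 : R3)) ∂((volume : Measure R3).toSphere.prod (.volumeIoiPow 2)) := by
        rw [← mp.integral_comp (Homeomorph.measurableEmbedding _)]
        exact integral_congr_ae (.of_forall key)
    _ = _ := by
        rw [integral_prod _ hint]
        unfold sphMeasure
        congr 1
        ext ω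
        simp only [Measure.volumeIoiPow, ENNReal.ofReal]
        rw [integral_withDensity_eq_integral_smul,
          integral_subtype_comap measurableSet_Ioi
            fun a ↦ Real.toNNReal (a ^ 2) • F (a • (ω : R3)),
          setIntegral_congr_fun measurableSet_Ioi fun x hx ↦ ?_]
        · rw [NNReal.smul_def, Real.coe_toNNReal _ (pow_nonneg hx.out.le _), smul_eq_mul]
        · exact (measurable_subtype_coe.pow_const _).real_toNNReal

/-- The auxiliary function on momentum space. -/
def auxF (a : ℝ) (b x : R3) : ℝ := Real.exp (-(a * ‖x‖ + ⟪b, x⟫)) / ‖x‖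

lemma aux_int_r (c : ℝ) (hc : 0 < c) :
    IntegrableOn (fun r : ℝ => r * Real.exp (-(c * r))) (Set.Ioi 0) ∧
    ∫ r in Set.Ioi (0 : ℝ), r * Real.exp (-(c * r)) = (c ^ 2)⁻¹ := by
  have h1 := Real.integral_rpow_mul_exp_neg_mul_Ioi (a := 2) (r := c) (by norm_num) hc
  have h2 : ∫ r in Set.Ioi (0 : ℝ), r * Real.exp (-(c * r)) = (c ^ 2)⁻¹ := by
    have : (2 : ℝ) - 1 = 1 := by norm_num
    rw [this] at h1
    simp only [Real.rpow_one] at h1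
    rw [h1]
    have : Real.Gamma 2 = 1 := by simp
    rw [this, show (2 : ℝ) = ((2 : ℕ) : ℝ) by norm_num, Real.rpow_natCast]
    simp
  refine ⟨?_, h2⟩
  by_contra h
  have := integral_undef h
  rw [h2] at this
  have : (c ^ 2)⁻¹ > 0 := by positivity
  linarith

lemma auxF_integrable (a : ℝ) (b : R3) (h : ‖b‖ < a) : Integrable (auxF a b) := by
  have h1 : Integrable (fun x : R3 => (fun t : ℝ => Real.exp (-((a - ‖b‖) * t)) / t) ‖x‖) := by
    refine (integrable_fun_norm_addHaar (volume : Measure R3)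
      (f := fun t : ℝ => Real.exp (-((a - ‖b‖) * t)) / t)).2 ?_
    refine (aux_int_r (a - ‖b‖) (by linarith)).1.congr_fun ?_ measurableSet_Ioi
    intro r hr
    have hr : 0 < r := hr
    simp
    field_simp
  refine h1.mono' ?_ (.of_forall fun x => ?_)
  · unfold auxF
    have : Measurable fun x : R3 => Real.exp (-(a * ‖x‖ + ⟪b, x⟫)) / ‖x‖ := by fun_prop
    exact this.aestronglyMeasurable
  · unfold auxF
    rw [Real.norm_of_nonneg (by positivity)]
    have := neg_le_of_abs_le (abs_real_inner_le_norm b x)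
    simp only
    gcongr
    linarith

lemma aux_sphere (a : ℝ) (b : R3) (h : ‖b‖ < a) :
    ∫ x, auxF a b x = ∫ ω : sphere (0 : R3) 1, ((a + ⟪b, (ω : R3)⟫) ^ 2)⁻¹ ∂sphMeasure := by
  rw [aux_polar _ (auxF_integrable a b h)]
  congr 1
  ext ω
  have hω : ‖(ω : R3)‖ = 1 := by simp
  have hc : 0 < a + ⟪b, (ω : R3)⟫ := by
    have := neg_le_of_abs_le (abs_real_inner_le_norm b (ω : R3))
    rw [hω] at this
    linarith
  rw [← (aux_int_r _ hc).2]
  refine setIntegral_congr_fun measurableSet_Ioi fun r hr => ?_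
  have hr : 0 < r := hr
  simp only [auxF, norm_smul, hω, inner_smul_right, Real.norm_of_nonneg hr.le]
  field_simp

lemma aux_rot (a : ℝ) (b b' : R3) (h : ‖b‖ = ‖b'‖) :
    ∫ x, auxF a b x = ∫ x, auxF a b' x := by
  let e := (Submodule.reflection (Submodule.span ℝ {b - b'})ᗮ)
  have he : e b = b' := Submodule.reflection_sub h
  rw [← (e.measurePreserving).integral_comp e.toHomeomorph.measurableEmbedding (auxF a b')]
  congr 1
  ext x
  simp only [auxF, LinearIsometryEquiv.norm_map]
  rw [← he, LinearIsometryEquiv.inner_map_map]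

lemma aux_int_y (a z : ℝ) (ha : 0 < a) (hz : z ≠ 0) :
    ∫ y : EuclideanSpace ℝ (Fin 2), Real.exp (-(a * √(z ^ 2 + ‖y‖ ^ 2))) / √(z ^ 2 + ‖y‖ ^ 2)
      = 2 * π / a * Real.exp (-(a * |z|)) := by
  have h0 := integral_fun_norm_addHaar (volume : Measure (EuclideanSpace ℝ (Fin 2)))
    (fun t : ℝ => Real.exp (-(a * √(z ^ 2 + t ^ 2))) / √(z ^ 2 + t ^ 2))
  rw [h0]
  have hz2 : 0 < z ^ 2 := by positivity
  have hb : (volume : Measure (EuclideanSpace ℝ (Fin 2))).real (ball 0 1) = π := by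
    simp [Measure.real, EuclideanSpace.volume_ball_fin_two, Real.pi_pos.le]
  have hd : ∀ t : ℝ, HasDerivAt (fun t => -(Real.exp (-(a * √(z ^ 2 + t ^ 2))) / a))
      (t * (Real.exp (-(a * √(z ^ 2 + t ^ 2))) / √(z ^ 2 + t ^ 2))) t := by
    intro t
    have hs : 0 < z ^ 2 + t ^ 2 := by positivity
    have h1 : HasDerivAt (fun t => z ^ 2 + t ^ 2) (2 * t) t := by
      simpa using (hasDerivAt_pow 2 t).const_add (z ^ 2)
    have h2 := ((((h1.sqrt hs.ne').const_mul a).neg.exp).div_const a).neg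
    refine h2.congr_deriv ?_
    have : 0 < √(z ^ 2 + t ^ 2) := Real.sqrt_pos.2 hs
    simp only [Pi.neg_apply]
    field_simp
  have hlim : Filter.Tendsto (fun t : ℝ => -(Real.exp (-(a * √(z ^ 2 + t ^ 2))) / a))
      Filter.atTop (nhds 0) := by
    have h1 : Filter.Tendsto (fun t : ℝ => a * √(z ^ 2 + t ^ 2)) Filter.atTop Filter.atTop := by
      refine Filter.Tendsto.const_mul_atTop ha (Real.tendsto_sqrt_atTop.comp ?_)
      exact Filter.tendsto_atTop_add_const_left _ _ (Filter.tendsto_pow_atTop (by norm_num))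
    have h2 := ((Real.tendsto_exp_neg_atTop_nhds_zero.comp h1).div_const a).neg
    simpa using h2
  have h3 := integral_Ioi_of_hasDerivAt_of_nonneg' (a := 0) (fun t _ => hd t)
    (fun t ht => by
      have : (0 : ℝ) < t := ht
      positivity) hlim
  simp only [finrank_euclideanSpace, Fintype.card_fin, hb]
  simp only [show 2 - 1 = 1 from rfl, pow_one, smul_eq_mul, nsmul_eq_mul]
  rw [h3]
  simp [Real.sqrt_sq_eq_abs]
  ring

lemma aux_int_z (a c : ℝ) (h : |c| < a) :
    ∫ z : ℝ, Real.exp (-(a * |z|)) * Real.exp (-(c * z)) = 2 * a / (a ^ 2 - c ^ 2) := by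
  obtain ⟨h1, h2⟩ := abs_lt.1 h
  have e1 : Set.EqOn (fun z : ℝ => Real.exp (-(a * |z|)) * Real.exp (-(c * z)))
      (fun z => Real.exp ((a - c) * z)) (Set.Iic 0) := by
    intro z hz
    simp only [← Real.exp_add, abs_of_nonpos (show z ≤ 0 from hz)]
    congr 1; ring
  have e2 : Set.EqOn (fun z : ℝ => Real.exp (-(a * |z|)) * Real.exp (-(c * z)))
      (fun z => Real.exp (-(a + c) * z)) (Set.Ioi 0) := by
    intro z hz
    simp only [← Real.exp_add, abs_of_pos (show 0 < z from hz)]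
    congr 1; ring
  rw [← intervalIntegral.integral_Iic_add_Ioi (b := 0), setIntegral_congr_fun measurableSet_Iic e1,
    setIntegral_congr_fun measurableSet_Ioi e2, integral_exp_mul_Iic (by linarith),
    integral_exp_mul_Ioi (by linarith)]
  · have : a - c ≠ 0 := by linarith
    have : a + c ≠ 0 := by linarith
    have : a ^ 2 - c ^ 2 ≠ 0 := by
      rw [show a ^ 2 - c ^ 2 = (a - c) * (a + c) by ring]; positivity
    rw [neg_div_neg_eq]
    simp only [mul_zero, Real.exp_zero]
    rw [show a ^ 2 - c ^ 2 = (a - c) * (a + c) by ring]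
    field_simp
    ring
  · exact (integrableOn_exp_mul_Iic (by linarith) 0).congr_fun e1.symm measurableSet_Iic
  · exact (integrableOn_exp_mul_Ioi (by linarith) 0).congr_fun e2.symm measurableSet_Ioi

lemma aux_axis (a c : ℝ) (h : |c| < a) :
    ∫ x, auxF a (EuclideanSpace.single 0 c) x = 4 * π / (a ^ 2 - c ^ 2) := by
  have ha : 0 < a := (abs_nonneg c).trans_lt h
  have hI := auxF_integrable a (EuclideanSpace.single 0 c) (by simpa using h)
  let e3 : (Fin 3 → ℝ) ≃ᵐ R3 := MeasurableEquiv.toLp 2 (Fin 3 → ℝ)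
  let e2 : (Fin 2 → ℝ) ≃ᵐ EuclideanSpace ℝ (Fin 2) := MeasurableEquiv.toLp 2 (Fin 2 → ℝ)
  let es : (Fin 3 → ℝ) ≃ᵐ ℝ × (Fin 2 → ℝ) := MeasurableEquiv.piFinSuccAbove (fun _ : Fin 3 => ℝ) 0
  have mp3 : MeasurePreserving e3 := PiLp.volume_preserving_toLp (Fin 3)
  have mp2 : MeasurePreserving e2.symm := PiLp.volume_preserving_ofLp (Fin 2)
  have mps : MeasurePreserving es := volume_preserving_piFinSuccAbove (fun _ : Fin 3 => ℝ) 0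
  let Φ : ℝ × EuclideanSpace ℝ (Fin 2) ≃ᵐ R3 :=
    ((MeasurableEquiv.refl ℝ).prodCongr e2.symm).trans (es.symm.trans e3)
  have mpΦ : MeasurePreserving Φ :=
    mp3.comp (mps.symm.comp ((MeasurePreserving.id volume).prod mp2))
  have hval : ∀ x : ℝ × EuclideanSpace ℝ (Fin 2),
      auxF a (EuclideanSpace.single 0 c) (Φ x) =
      (Real.exp (-(a * √(x.1 ^ 2 + ‖x.2‖ ^ 2))) / √(x.1 ^ 2 + ‖x.2‖ ^ 2)) *
        Real.exp (-(c * x.1)) := by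
    rintro ⟨z, y⟩
    have c0 : Φ (z, y) 0 = z := rfl
    have c1 : Φ (z, y) 1 = y 0 := rfl
    have c2 : Φ (z, y) 2 = y 1 := rfl
    have hn : ‖Φ (z, y)‖ = √(z ^ 2 + ‖y‖ ^ 2) := by
      rw [EuclideanSpace.norm_eq, EuclideanSpace.norm_sq_eq, Fin.sum_univ_three,
        Fin.sum_univ_two, c0, c1, c2]
      simp [add_assoc]
    have hi : ⟪EuclideanSpace.single 0 c, Φ (z, y)⟫ = c * z := by
      rw [EuclideanSpace.inner_single_left, c0]
      simp
    simp only [auxF]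
    rw [hn, hi, neg_add, Real.exp_add]
    ring
  rw [← mpΦ.integral_comp Φ.measurableEmbedding]
  rw [← mpΦ.integrable_comp_emb Φ.measurableEmbedding] at hI
  have hI' := hI.congr (.of_forall hval)
  simp only [hval]
  rw [Measure.volume_eq_prod] at hI' ⊢
  rw [integral_prod _ hI']
  have hae : ∀ᵐ z : ℝ, z ≠ 0 := by simp [ae_iff]
  have : ∀ᵐ z : ℝ, (∫ y : EuclideanSpace ℝ (Fin 2),
      (Real.exp (-(a * √(z ^ 2 + ‖y‖ ^ 2))) / √(z ^ 2 + ‖y‖ ^ 2)) * Real.exp (-(c * z)))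
      = 2 * π / a * (Real.exp (-(a * |z|)) * Real.exp (-(c * z))) := by
    filter_upwards [hae] with z hz
    rw [integral_mul_const, aux_int_y a z ha hz]
    ring
  rw [integral_congr_ae this, integral_const_mul, aux_int_z a c h]
  field_simp
  ring

lemma aux_main (a : ℝ) (b : R3) (h : ‖b‖ < a) :
    ∫ ω : sphere (0 : R3) 1, ((a + ⟪b, (ω : R3)⟫) ^ 2)⁻¹ ∂sphMeasure
      = 4 * π / (a ^ 2 - ‖b‖ ^ 2) := by
  rw [← aux_sphere a b h, aux_rot a b (EuclideanSpace.single 0 ‖b‖) (by simp),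
    aux_axis a _ (by simpa using h)]

lemma aux_relMom_sq (p q : R3) : relMom p q ^ 2 = (‖p‖ + ‖q‖) ^ 2 - ‖p + q‖ ^ 2 := by
  unfold relMom
  rw [Real.sq_sqrt (by linarith [real_inner_le_norm p q]), norm_add_sq_real]
  ring

lemma aux_norm (p q ω : R3) (hω : ‖ω‖ = 1) (hp : p ≠ 0) (t : ℝ) (ht : t ^ 2 = 1) :
    ‖(1 / 2 : ℝ) • (p + q) + (t * (relMom p q / 2)) • ω
    + (t * (⟪p + q, ω⟫ / 2 / (‖p‖ + ‖q‖ + relMom p q))) • (p + q)‖ ^ 2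
     = ((‖p‖ + ‖q‖) / 2 + t * (⟪p + q, ω⟫ / 2)) ^ 2 := by
  have hr := aux_relMom_sq p q
  have hr0 : 0 ≤ relMom p q := Real.sqrt_nonneg _
  have hpp : 0 < ‖p‖ := norm_pos_iff.2 hp
  have hE : 0 < ‖p‖ + ‖q‖ + relMom p q := by positivity
  set P := p + q
  set E := ‖p‖ + ‖q‖
  set ρ := relMom p q
  set s := ⟪P, ω⟫
  have h1 : ∀ u v : ℝ, ‖u • P + v • ω‖ ^ 2 = u ^ 2 * ‖P‖ ^ 2 + 2 * u * v * s + v ^ 2 := by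
    intro u v
    rw [norm_add_sq_real, norm_smul, norm_smul, inner_smul_left, inner_smul_right, hω, mul_pow,
      mul_pow]
    simp
    ring
  have h2 : (1 / 2 : ℝ) • P + (t * (ρ / 2)) • ω + (t * (s / 2 / (E + ρ))) • P
     = (1 / 2 + t * (s / 2 / (E + ρ))) • P + (t * (ρ / 2)) • ω := by module
  rw [h2, h1, show ‖P‖ ^ 2 = (E - ρ) * (E + ρ) by linarith]
  field_simp
  linear_combination ρ ^ 2 * (E + ρ) * ht


/-- **Lemma 5.** `∫_{S²} |p'|⁻² dω = ∫_{S²} |q'|⁻² dω = 16π/ρ(p,q)²`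
whenever `p, q ≠ 0` are not positive scalar multiples of each other. -/
theorem sphere_integral_inv_sq_pPost (p q : R3) (hp : p ≠ 0) (hq : q ≠ 0)
    (hpq : ∀ c : ℝ, 0 < c → q ≠ c • p) :
    (∫ ω : sphere (0 : R3) 1, (‖pPost p q (ω : R3)‖ ^ 2)⁻¹ ∂sphMeasure)
      = (∫ ω : sphere (0 : R3) 1, (‖qPost p q (ω : R3)‖ ^ 2)⁻¹ ∂sphMeasure) ∧
    (∫ ω : sphere (0 : R3) 1, (‖pPost p q (ω : R3)‖ ^ 2)⁻¹ ∂sphMeasure)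
      = 16 * π / relMom p q ^ 2 := by
  have hpp : 0 < ‖p‖ := norm_pos_iff.2 hp
  have hqq : 0 < ‖q‖ := norm_pos_iff.2 hq
  have hlt : ⟪p, q⟫ < ‖p‖ * ‖q‖ := by
    refine lt_of_le_of_ne (real_inner_le_norm p q) fun h => ?_
    have h1 := inner_eq_norm_mul_iff_real.1 h
    refine hpq (‖q‖ / ‖p‖) (by positivity) ?_
    rw [div_eq_inv_mul, mul_smul, h1, smul_smul, inv_mul_cancel₀ hpp.ne', one_smul]
  have hρ : 0 < relMom p q := Real.sqrt_pos.2 (by linarith)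
  have hsq := aux_relMom_sq p q
  have hn : ‖p + q‖ < ‖p‖ + ‖q‖ := by
    refine lt_of_pow_lt_pow_left₀ 2 (by positivity) ?_
    have : 0 < relMom p q ^ 2 := by positivity
    linarith
  have gen : ∀ t : ℝ, t ^ 2 = 1 →
      ∫ ω : sphere (0 : R3) 1, (‖(1 / 2 : ℝ) • (p + q) + (t * (relMom p q / 2)) • (ω : R3)
    + (t * (⟪p + q, (ω : R3)⟫ / 2 / (‖p‖ + ‖q‖ + relMom p q))) • (p + q)‖ ^ 2)⁻¹ ∂sphMeasure
      = 16 * π / relMom p q ^ 2 := by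
    intro t ht
    have ht' : |t| = 1 := by rw [← sq_eq_sq₀ (abs_nonneg t) zero_le_one, sq_abs, ht]; norm_num
    have hb : ‖(t / 2) • (p + q)‖ = ‖p + q‖ / 2 := by
      rw [norm_smul, Real.norm_eq_abs, abs_div, ht']; norm_num; ring
    have := aux_main ((‖p‖ + ‖q‖) / 2) ((t / 2) • (p + q)) (by rw [hb]; linarith)
    rw [hb] at this
    rw [hsq]
    convert this using 1
    · congr 1
      ext ω
      rw [aux_norm p q ω (by simp) hp t ht, inner_smul_left]
      simp
      ring_nf
    · have : (‖p‖ + ‖q‖) ^ 2 - ‖p + q‖ ^ 2 ≠ 0 := by rw [← hsq]; positivity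
      rw [show ((‖p‖ + ‖q‖) / 2) ^ 2 - (‖p + q‖ / 2) ^ 2
        = ((‖p‖ + ‖q‖) ^ 2 - ‖p + q‖ ^ 2) / 4 by ring]
      field_simp
      norm_num
  have g1 : (∫ ω : sphere (0 : R3) 1, (‖pPost p q (ω : R3)‖ ^ 2)⁻¹ ∂sphMeasure)
      = 16 * π / relMom p q ^ 2 := by
    rw [← gen 1 (by norm_num)]
    simp only [pPost, one_mul]
  have g2 : (∫ ω : sphere (0 : R3) 1, (‖qPost p q (ω : R3)‖ ^ 2)⁻¹ ∂sphMeasure)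
      = 16 * π / relMom p q ^ 2 := by
    rw [← gen (-1) (by norm_num)]
    simp only [qPost, neg_mul, one_mul, neg_smul, sub_eq_add_neg]
  exact ⟨g1.trans g2.symm, g1⟩
end
end
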